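/- Let T>0, let a: S¹×[0,T]→ℝ be of class C¹ and b: S¹×[0,T]→ℝ be continuous, and let v: S¹×(0,T)→ℝ be a bounded classical solution of the linear parabolic equation v_t = v_xx + a(x,t)v_x + b(x,t)v which is not identically zero. Then for every t ∈ (0,T) the zero number z(v(·,t)) is finite, the map t ↦ z(v(·,t)) is nonincreasing on (0,T), and z(v(·,t)) strictly decreases at t = t₀ (i.e. z(v(·,t₁)) > z(v(·,t₂)) for all t₁ < t₀ < t₂ in (0,T)) if and only if the function x ↦ v(x,t₀) has a multiple zero. -/

import Mathlib

open Set

/-- The zero number of a function `φ : ℝ → ℝ` viewed as a function on the circle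
`S¹ = ℝ/ℤ` (i.e. a `1`-periodic function): the number of strict sign changes of `φ`,
namely the supremum of all `k` for which there exist points
`x₁ < x₂ < ⋯ < x_k < x₁ + 1` with `φ(xᵢ) · φ(xᵢ₊₁) < 0` for all `i`
(indices taken cyclically). -/
noncomputable def zeroNumber (φ : ℝ → ℝ) : ℕ∞ :=
  ⨆ k ∈ {k : ℕ | ∃ x : Fin k → ℝ, StrictMono x ∧ (∀ i j : Fin k, x j < x i + 1) ∧
      ∀ i : Fin k, φ (x i) * φ (x (finRotate k i)) < 0}, (k : ℕ∞)

/-- A multiple zero of a (C¹) function `φ : ℝ → ℝ`: a point where both `φ` and its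
derivative vanish. -/
def HasMultipleZero (φ : ℝ → ℝ) : Prop := ∃ x, φ x = 0 ∧ deriv φ x = 0

section
/-- Cyclic alternation of length `k`, with integer-indexed points. -/
def Alt (k : ℕ) (φ : ℝ → ℝ) : Prop :=
  ∃ X : ℤ → ℝ, StrictMono X ∧ (∀ i, X (i + k) = X i + 1) ∧ ∀ i, φ (X i) * φ (X (i + 1)) < 0

lemma alt_of_mem {φ : ℝ → ℝ} (hφ : Function.Periodic φ 1) {k : ℕ} (hk : 0 < k)
    (h : ∃ x : Fin k → ℝ, StrictMono x ∧ (∀ i j : Fin k, x j < x i + 1) ∧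
      ∀ i : Fin k, φ (x i) * φ (x (finRotate k i)) < 0) : Alt k φ := by
  obtain ⟨n, rfl⟩ : ∃ n, k = n + 1 := ⟨k - 1, by omega⟩
  obtain ⟨x, hx, hx1, hxφ⟩ := h
  have hpos : (0 : ℤ) < ((n + 1 : ℕ) : ℤ) := by positivity
  have hb : ∀ i : ℤ, (i % ((n + 1 : ℕ) : ℤ)).toNat < n + 1 := by
    intro i
    have h1 := Int.emod_nonneg i hpos.ne'
    have h2 := Int.emod_lt_of_pos i hpos
    omega
  set N : ℤ := ((n + 1 : ℕ) : ℤ) with hN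
  let X : ℤ → ℝ := fun i => x ⟨(i % N).toNat, hb i⟩ + ((i / N : ℤ) : ℝ)
  have hval : ∀ i, φ (X i) = φ (x ⟨(i % N).toNat, hb i⟩) := by
    intro i
    have := hφ.int_mul (i / N) (x ⟨(i % N).toNat, hb i⟩)
    simpa [X] using this
  have hcase : ∀ i : ℤ, (∃ h : (i % N).toNat + 1 < n + 1,
        X (i + 1) = x ⟨(i % N).toNat + 1, h⟩ + ((i / N : ℤ) : ℝ)) ∨
      ((i % N).toNat = n ∧ X (i + 1) = x ⟨0, Nat.succ_pos n⟩ + ((i / N : ℤ) : ℝ) + 1) := by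
    intro i
    have h1 := Int.emod_nonneg i hpos.ne'
    have h2 := Int.emod_lt_of_pos i hpos
    have h3 := Int.emod_add_mul_ediv i N
    rcases lt_or_ge ((i % N) + 1) N with h | h
    · left
      have e1 : (i + 1) / N = i / N := by
        rw [Int.ediv_eq_iff_of_pos hpos]
        constructor <;> nlinarith
      have e2 : (i + 1) % N = i % N + 1 := by
        have := Int.emod_add_mul_ediv (i + 1) N
        rw [e1] at this; linarith
      refine ⟨by omega, ?_⟩
      simp only [X, e1]
      congr 2
      ext; simp only [e2]; omega
    · right
      have e1 : (i + 1) / N = i / N + 1 := by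
        rw [Int.ediv_eq_iff_of_pos hpos]
        constructor <;> nlinarith
      have e2 : (i + 1) % N = 0 := by
        have := Int.emod_add_mul_ediv (i + 1) N
        rw [e1] at this
        have h5 : i % N + 1 = N := by omega
        linarith
      refine ⟨by omega, ?_⟩
      simp only [X, e1]
      push_cast
      rw [add_assoc]
      congr 2
      ext; simp only [e2]; rfl
  refine ⟨X, ?_, ?_, ?_⟩
  · apply strictMono_int_of_lt_succ
    intro i
    rcases hcase i with ⟨h, e⟩ | ⟨h, e⟩
    · rw [e]
      have : x ⟨(i % N).toNat, hb i⟩ < x ⟨(i % N).toNat + 1, h⟩ := hx (by simp [Fin.lt_def])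
      simp only [X]; linarith
    · rw [e]
      have := hx1 ⟨0, Nat.succ_pos n⟩ ⟨(i % N).toNat, hb i⟩
      simp only [X]; linarith
  · intro i
    have e1 : (i + N) / N = i / N + 1 := by
      rw [Int.add_ediv_of_dvd_right (dvd_refl N), Int.ediv_self hpos.ne']
    have e2 : (i + N) % N = i % N := by simp
    change X (i + N) = X i + 1
    simp only [X, e1, e2]; push_cast; ring
  · intro i
    rw [hval i]
    rcases hcase i with ⟨h, e⟩ | ⟨h, e⟩
    · have h7 : φ (X (i + 1)) = φ (x ⟨(i % N).toNat + 1, h⟩) := by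
        rw [e]
        simpa using hφ.int_mul (i / N) (x ⟨(i % N).toNat + 1, h⟩)
      have := hxφ ⟨(i % N).toNat, hb i⟩
      rw [finRotate_of_lt (by omega)] at this
      rw [h7]; exact this
    · have h7 : φ (X (i + 1)) = φ (x ⟨0, Nat.succ_pos n⟩) := by
        rw [e, hφ]
        simpa using hφ.int_mul (i / N) (x ⟨0, Nat.succ_pos n⟩)
      have := hxφ ⟨(i % N).toNat, hb i⟩
      rw [h7]
      have h8 : (⟨(i % N).toNat, hb i⟩ : Fin (n+1)) = ⟨n, by omega⟩ := by ext; exact h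
      rw [h8] at this ⊢
      rw [finRotate_last'] at this
      exact this

lemma mem_of_alt {φ : ℝ → ℝ} (hφ : Function.Periodic φ 1) {k : ℕ} (hk : 0 < k) (h : Alt k φ) :
    ∃ x : Fin k → ℝ, StrictMono x ∧ (∀ i j : Fin k, x j < x i + 1) ∧
      ∀ i : Fin k, φ (x i) * φ (x (finRotate k i)) < 0 := by
  obtain ⟨n, rfl⟩ : ∃ n, k = n + 1 := ⟨k - 1, by omega⟩
  obtain ⟨X, hX, hX1, hXφ⟩ := h
  refine ⟨fun i => X (i : ℕ), ?_, ?_, ?_⟩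
  · intro i j hij
    apply hX
    exact_mod_cast hij
  · intro i j
    rw [← hX1]
    apply hX
    have := j.2
    push_cast
    omega
  · intro i
    rcases lt_or_ge (i : ℕ) n with h | h
    · obtain ⟨m, hm⟩ := i
      rw [finRotate_of_lt h]
      simpa using hXφ m
    · have hi : i = ⟨n, by omega⟩ := by ext; simp; omega
      rw [hi, finRotate_last']
      have h1 := hXφ n
      have h2 := hX1 0
      have h3 : φ (X ((n : ℤ) + 1)) = φ (X 0) := by
        rw [← hφ (X 0), ← h2]; simp
      rw [h3] at h1
      simpa using h1

lemma z_le {φ ψ : ℝ → ℝ} (hφ : Function.Periodic φ 1) (hψ : Function.Periodic ψ 1)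
    (h : ∀ k, 0 < k → Alt k φ → Alt k ψ) : zeroNumber φ ≤ zeroNumber ψ := by
  unfold zeroNumber
  apply iSup₂_le
  intro k hk
  rcases Nat.eq_zero_or_pos k with rfl | hk0
  · simp
  · exact le_iSup₂_of_le (f := fun (k : ℕ) _ => (k : ℕ∞)) k
      (mem_of_alt hψ hk0 (h k hk0 (alt_of_mem hφ hk0 hk))) le_rfl

lemma z_ne_top {φ : ℝ → ℝ} (hφ : Function.Periodic φ 1) (M : ℕ)
    (h : ∀ k, 0 < k → Alt k φ → k ≤ M) : zeroNumber φ ≠ ⊤ := by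
  have : zeroNumber φ ≤ M := by
    unfold zeroNumber
    apply iSup₂_le
    intro k hk
    rcases Nat.eq_zero_or_pos k with rfl | hk0
    · simp
    · exact_mod_cast h k hk0 (alt_of_mem hφ hk0 hk)
  exact ne_top_of_le_ne_top (ENat.natCast_ne_top M) this

lemma z_ge {ψ : ℝ → ℝ} (hψ : Function.Periodic ψ 1) {k : ℕ} (hk : 0 < k) (h : Alt k ψ) :
    (k : ℕ∞) ≤ zeroNumber ψ :=
  le_iSup₂_of_le (f := fun (k : ℕ) _ => (k : ℕ∞)) k (mem_of_alt hψ hk h) le_rfl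

lemma z_attained {φ : ℝ → ℝ} (hφ : Function.Periodic φ 1) {N : ℕ} (hN : 0 < N)
    (h : zeroNumber φ = N) : Alt N φ := by
  by_contra hcon
  have : zeroNumber φ ≤ ((N - 1 : ℕ) : ℕ∞) := by
    nth_rewrite 1 [zeroNumber]
    apply iSup₂_le
    intro k hk
    rcases Nat.eq_zero_or_pos k with rfl | hk0
    · simp
    · have h1 := alt_of_mem hφ hk0 hk
      have h2 := z_ge hφ hk0 h1
      rw [h] at h2
      have h3 : k ≤ N := by exact_mod_cast h2
      have h4 : k ≠ N := fun e => hcon (e ▸ h1)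
      exact_mod_cast (by omega : k ≤ N - 1)
  rw [h] at this
  have : N ≤ N - 1 := by exact_mod_cast this
  omega

lemma alt_of_nat {φ : ℝ → ℝ} (hφ : Function.Periodic φ 1) (n : ℕ) (Y : ℕ → ℝ)
    (h1 : ∀ m, m < n → Y m < Y (m + 1)) (h2 : Y n < Y 0 + 1)
    (h3 : ∀ m, m < n → φ (Y m) * φ (Y (m + 1)) < 0) (h4 : φ (Y n) * φ (Y 0) < 0) :
    Alt (n + 1) φ := by
  apply alt_of_mem hφ (by omega)
  have hmono : ∀ b, b ≤ n → ∀ a, a < b → Y a < Y b := by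
    intro b
    induction b with
    | zero => intro _ a ha; omega
    | succ b ih =>
      intro hb a ha
      rcases Nat.lt_succ_iff_lt_or_eq.mp ha with h | rfl
      · exact (ih (by omega) a h).trans (h1 b (by omega))
      · exact h1 a (by omega)
  have hle : ∀ a b, a ≤ b → b ≤ n → Y a ≤ Y b := by
    intro a b hab hb
    rcases hab.lt_or_eq with h | rfl
    · exact (hmono b hb a h).le
    · exact le_rfl
  refine ⟨fun i => Y i, ?_, ?_, ?_⟩
  · intro i j hij
    exact hmono j (by have := j.2; omega) i hij
  · intro i j
    have := hle j n (by have := j.2; omega) le_rfl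
    have := hle 0 i (by omega) (by have := i.2; omega)
    simp only
    linarith
  · intro i
    rcases lt_or_ge (i : ℕ) n with h | h
    · obtain ⟨m, hm⟩ := i
      rw [finRotate_of_lt h]
      exact h3 m h
    · have hi : i = ⟨n, by omega⟩ := by ext; simp; omega
      rw [hi, finRotate_last']
      exact h4

lemma alt_two {φ : ℝ → ℝ} (hφ : Function.Periodic φ 1) {p q : ℝ} (hpq : p < q) (hq : q < p + 1)
    (h : φ p * φ q < 0) : Alt 2 φ := by
  refine alt_of_nat hφ 1 (fun n => if n = 0 then p else q) ?_ ?_ ?_ ?_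
  · intro m hm
    obtain rfl : m = 0 := by omega
    simpa using hpq
  · simpa using hq
  · intro m hm
    obtain rfl : m = 0 := by omega
    simpa using h
  · simpa [mul_comm] using h

lemma alt_gap {X : ℤ → ℝ} {k : ℕ} (hX : StrictMono X) (hX1 : ∀ i, X (i + k) = X i + 1)
    (ξ : ℝ) : ∃ j, X j ≤ ξ ∧ ξ < X (j + 1) := by
  have hk : ∀ m : ℕ, X (m * k) = X 0 + m := by
    intro m
    induction m with
    | zero => simp
    | succ m ih =>
      have : ((m + 1 : ℕ) : ℤ) * k = m * k + k := by push_cast; ring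
      rw [this, hX1, ih]; push_cast; ring
  have hk' : ∀ m : ℕ, X (-(m * k)) = X 0 - m := by
    intro m
    induction m with
    | zero => simp
    | succ m ih =>
      have h1 := hX1 (-(((m + 1 : ℕ) : ℤ) * k))
      have : -(((m + 1 : ℕ) : ℤ) * k) + k = -(m * k) := by push_cast; ring
      rw [this, ih] at h1
      push_cast at h1 ⊢; linarith
  obtain ⟨M, hM⟩ := exists_nat_gt (ξ - X 0)
  obtain ⟨M', hM'⟩ := exists_nat_gt (X 0 - ξ)
  obtain ⟨j, hj, hj'⟩ := Int.exists_greatest_of_bdd (P := fun j => X j ≤ ξ)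
    ⟨M * k, fun z hz => by
      by_contra hcon
      have := hX (not_le.mp hcon)
      rw [hk] at this; linarith⟩
    ⟨-(M' * k), by rw [hk']; linarith⟩
  refine ⟨j, hj, ?_⟩
  by_contra hcon
  have := hj' (j + 1) (not_lt.mp hcon)
  omega

lemma mul_neg_of_same {a b c d : ℝ} (h1 : 0 < a * c) (h2 : 0 < b * d) (h : a * b < 0) :
    c * d < 0 := by
  have : 0 < (a * c) * (b * d) := mul_pos h1 h2
  have h3 : (a * c) * (b * d) = (a * b) * (c * d) := by ring
  rw [h3] at this
  exact neg_of_mul_pos_right this h.le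

/-- Insertion of two more sign changes. -/
lemma alt_insert {ψ : ℝ → ℝ} (hψ : Function.Periodic ψ 1) {k : ℕ} (hk : 0 < k) {X : ℤ → ℝ}
    (hX : StrictMono X) (hX1 : ∀ i, X (i + k) = X i + 1)
    (hXψ : ∀ i, ψ (X i) * ψ (X (i + 1)) < 0) {j : ℤ} {p q r : ℝ} (hp : X j < p) (hpq : p < q)
    (hqr : q < r) (hr : r < X (j + 1)) (h1 : ψ p * ψ q < 0) (h2 : ψ q * ψ r < 0) :
    Alt (k + 2) ψ := by
  have hper : ψ (X (j + k)) = ψ (X j) := by rw [hX1, hψ]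
  have main : ∀ q1 q2, X j < q1 → q1 < q2 → q2 < X (j + 1) → ψ (X j) * ψ q1 < 0 → ψ q1 * ψ q2 < 0 →
      Alt (k + 2) ψ := by
    intro q1 q2 a1 a2 a3 a4 a5
    have a6 : ψ q2 * ψ (X (j + 1)) < 0 := by
      have := hXψ j
      have e1 : 0 < ψ (X j) * ψ q2 := by
        have : 0 < (ψ (X j) * ψ q1) * (ψ q1 * ψ q2) := mul_pos_of_neg_of_neg a4 a5
        have h3 : (ψ (X j) * ψ q1) * (ψ q1 * ψ q2) = (ψ (X j) * ψ q2) * (ψ q1)^2 := by ring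
        rw [h3] at this
        exact pos_of_mul_pos_left this (sq_nonneg _)
      have e2 : 0 < ψ (X (j+1)) * ψ (X (j+1)) := by
        apply mul_self_pos.mpr
        intro h0; rw [h0] at this; simp at this
      exact mul_neg_of_same e1 e2 this
    refine alt_of_nat hψ (k + 1)
      (fun n => if n = 0 then q1 else if n = 1 then q2 else X (j + n - 1)) ?_ ?_ ?_ ?_
    · intro m hm
      rcases m with _ | _ | m
      · simpa using a2
      · simp only [Nat.cast_add]
        norm_num
        convert a3 using 2; ring
      · simp only [Nat.cast_add]
        norm_num
        apply hX; omega
    · simp only [Nat.cast_add]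
      norm_num
      rw [if_neg (by omega)]
      have : j + (k + 1) - 1 = j + k := by ring
      rw [this, hX1]; linarith
    · intro m hm
      rcases m with _ | _ | m
      · simpa using a5
      · simp only [Nat.cast_add]
        norm_num
        have : j + 2 - 1 = j + 1 := by ring
        rw [this]; exact a6
      · simp only [Nat.cast_add]
        norm_num
        have := hXψ (j + (m + 1 + 1) - 1)
        convert this using 4; ring
    · simp only [Nat.cast_add]
      norm_num
      rw [if_neg (by omega)]
      have : j + (k + 1) - 1 = j + k := by ring
      rw [this, hper]; exact a4
  have hj0 : ψ (X j) ≠ 0 := by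
    intro h0; have := hXψ j; rw [h0] at this; simp at this
  have hp0 : ψ p ≠ 0 := by
    intro h0; rw [h0] at h1; simp at h1
  rcases lt_or_gt_of_ne (mul_ne_zero hj0 hp0) with h | h
  · exact main p q hp hpq (hqr.trans hr) h h1
  · refine main q r (hp.trans hpq) hqr hr ?_ h2
    have e2 : 0 < ψ q * ψ q := by
      apply mul_self_pos.mpr
      intro h0; rw [h0] at h1; simp at h1
    rw [mul_comm] at h
    exact mul_neg_of_same h e2 h1

/-- Transporting alternations between nearby functions with simple zeros. -/
lemma alt_move {φ ψ : ℝ → ℝ} (hφ : Function.Periodic φ 1) (hψ : Function.Periodic ψ 1) {δ : ℝ}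
    (hδ : 0 < δ)
    (H : ∀ x, 0 < φ x * ψ x ∨ ∃ e : ℝ, (∀ y z, x - δ ≤ y → y ≤ z → z ≤ x + δ → e * φ y ≤ e * φ z) ∧
      0 < e * ψ (x + δ / 2) ∧ e * ψ (x - δ / 2) < 0) {k : ℕ} (h : Alt k φ) : Alt k ψ := by
  classical
  obtain ⟨X, hX, hX1, hXφ⟩ := h
  let m : ℝ → ℝ := fun x => if 0 < φ x * ψ x then x else
    if 0 < φ x * ψ (x + δ / 2) then x + δ / 2 else x - δ / 2
  have hne : ∀ i, φ (X i) ≠ 0 := by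
    intro i h0; have := hXφ i; rw [h0] at this; simp at this
  have hsign : ∀ i, 0 < φ (X i) * ψ (m (X i)) := by
    intro i
    simp only [m]
    split_ifs with h1 h2
    · exact h1
    · exact h2
    · rcases H (X i) with h | ⟨e, he, he1, he2⟩
      · exact absurd h h1
      · have h3 : φ (X i) * ψ (X i + δ / 2) ≤ 0 := not_lt.mp h2
        have h4 : e * φ (X i) ≤ 0 := by
          by_contra hcon
          have := mul_pos (not_le.mp hcon) he1
          have e5 : e * φ (X i) * (e * ψ (X i + δ / 2)) = e^2 * (φ (X i) * ψ (X i + δ / 2)) := by ring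
          rw [e5] at this
          nlinarith [sq_nonneg e]
        have h5 : e ≠ 0 := by rintro rfl; simp at he1
        have h6 : e * φ (X i) < 0 := lt_of_le_of_ne h4 (mul_ne_zero h5 (hne i))
        have := mul_pos_of_neg_of_neg h6 he2
        have e5 : e * φ (X i) * (e * ψ (X i - δ / 2)) = e^2 * (φ (X i) * ψ (X i - δ / 2)) := by ring
        rw [e5] at this
        exact pos_of_mul_pos_right this (sq_nonneg e)
  -- movement to the right forces a gap on the right, etc.
  have hcase : ∀ i, m (X i) = X i ∨ (m (X i) = X i + δ / 2 ∧ X i + δ < X (i + 1)) ∨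
      (m (X i) = X i - δ / 2 ∧ X (i - 1) < X i - δ) := by
    intro i
    have hs := hsign i
    simp only [m] at hs ⊢
    split_ifs at hs ⊢ with h1 h2
    · left; rfl
    · right; left
      refine ⟨rfl, ?_⟩
      rcases H (X i) with h | ⟨e, he, he1, he2⟩
      · exact absurd h h1
      · by_contra hcon
        have h3 := he (X i) (X (i + 1)) (by linarith) (hX (by omega)).le (not_lt.mp hcon)
        have h4 : 0 < e * φ (X i) := by
          by_contra hc
          have := mul_nonneg_of_nonpos_of_nonpos (not_lt.mp hc) (neg_nonpos.mpr he1.le)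
          nlinarith [sq_nonneg e, mul_pos h2 (sq_pos_of_ne_zero (show e ≠ 0 by rintro rfl; simp at he1))]
        have h5 := mul_pos h4 (lt_of_lt_of_le h4 h3)
        have := hXφ i
        nlinarith [sq_nonneg e]
    · right; right
      refine ⟨rfl, ?_⟩
      rcases H (X i) with h | ⟨e, he, he1, he2⟩
      · exact absurd h h1
      · by_contra hcon
        have h3 := he (X (i - 1)) (X i) (not_lt.mp hcon) (hX (by omega)).le (by linarith)
        have h4 : e * φ (X i) < 0 := by
          by_contra hc
          have := mul_nonneg (not_lt.mp hc) (neg_nonneg.mpr he2.le)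
          nlinarith [sq_nonneg e, mul_pos hs (sq_pos_of_ne_zero (show e ≠ 0 by rintro rfl; simp at he1))]
        have h5 := mul_pos_of_neg_of_neg h4 (lt_of_le_of_lt h3 h4)
        have := hXφ (i - 1)
        rw [sub_add_cancel] at this
        nlinarith [sq_nonneg e]
  refine ⟨fun i => m (X i), ?_, ?_, ?_⟩
  · apply strictMono_int_of_lt_succ
    intro i
    have hlt : X i < X (i + 1) := hX (by omega)
    have hc := hcase (i + 1)
    rw [add_sub_cancel_right] at hc
    change m (X i) < m (X (i + 1))
    rcases hcase i with h | ⟨h, h'⟩ | ⟨h, h'⟩ <;> rcases hc with g | ⟨g, g'⟩ | ⟨g, g'⟩ <;> rw [h, g] <;> linarith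
  · intro i
    have e1 : φ (X i + 1) = φ (X i) := hφ _
    have e2 : ψ (X i + 1) = ψ (X i) := hψ _
    have e3 : ψ (X i + 1 + δ / 2) = ψ (X i + δ / 2) := by rw [← hψ (X i + δ / 2)]; congr 1; ring
    simp only [m, hX1, e1, e2, e3]
    split_ifs <;> ring
  · intro i
    exact mul_neg_of_same (hsign i) (hsign (i + 1)) (hXφ i)

lemma zeros_finite {φ : ℝ → ℝ}
    (h : ∀ x0, ∃ δ > 0, ∀ x, x ≠ x0 → |x - x0| < δ → φ x ≠ 0) :
    {x | x ∈ Icc (0 : ℝ) 1 ∧ φ x = 0}.Finite := by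
  by_contra hinf
  obtain ⟨x0, _, hx0⟩ := Set.Infinite.exists_accPt_of_subset_isCompact (hinf)
    (isCompact_Icc (a := (0 : ℝ)) (b := 1)) (fun x hx => hx.1)
  obtain ⟨δ, hδ, hd⟩ := h x0
  rw [accPt_iff_nhds] at hx0
  obtain ⟨y, ⟨hy1, hy2⟩, hy3⟩ := hx0 (Metric.ball x0 δ) (Metric.ball_mem_nhds x0 hδ)
  exact hd y hy3 (by simpa [Real.dist_eq] using hy1) hy2.2

lemma alt_bound {φ : ℝ → ℝ} (hc : Continuous φ) (hφ : Function.Periodic φ 1)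
    (hS : {x | x ∈ Icc (0 : ℝ) 1 ∧ φ x = 0}.Finite) {k : ℕ} (h : Alt k φ) :
    k ≤ hS.toFinset.card := by
  obtain ⟨X, hX, hX1, hXφ⟩ := h
  have hz : ∀ i, ∃ ζ, X i < ζ ∧ ζ < X (i + 1) ∧ φ ζ = 0 := by
    intro i
    have hlt : X i < X (i + 1) := hX (by omega)
    have hp := hXφ i
    rcases mul_neg_iff.mp hp with ⟨h1, h2⟩ | ⟨h1, h2⟩
    · obtain ⟨ζ, hζ, hζ0⟩ := intermediate_value_Ioo' hlt.le hc.continuousOn (show (0 : ℝ) ∈ Ioo _ _ from ⟨h2, h1⟩)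
      exact ⟨ζ, hζ.1, hζ.2, hζ0⟩
    · obtain ⟨ζ, hζ, hζ0⟩ := intermediate_value_Ioo hlt.le hc.continuousOn (show (0 : ℝ) ∈ Ioo _ _ from ⟨h1, h2⟩)
      exact ⟨ζ, hζ.1, hζ.2, hζ0⟩
  choose ζ h1 h2 h3 using hz
  have hmono : StrictMono ζ := by
    apply strictMono_int_of_lt_succ
    intro i
    exact (h2 i).trans (h1 (i + 1))
  have hcard : (Finset.range k).card ≤ hS.toFinset.card := by
    apply Finset.card_le_card_of_injOn (fun i : ℕ => Int.fract (ζ i))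
    · intro i _
      simp only [Finite.coe_toFinset, mem_setOf_eq]
      refine ⟨⟨Int.fract_nonneg _, (Int.fract_lt_one _).le⟩, ?_⟩
      have := hφ.int_mul (⌊ζ i⌋) (Int.fract (ζ i))
      rw [mul_one, Int.fract_add_floor, h3] at this
      exact this.symm
    · intro i hi j hj hij
      simp only [Finset.coe_range, mem_Iio] at hi hj
      simp only at hij
      have hb : ∀ l : ℕ, l < k → X 0 < ζ l ∧ ζ l < X 0 + 1 := by
        intro l hl
        constructor
        · exact lt_of_le_of_lt (hX.monotone (by omega)) (h1 l)
        · rw [← hX1]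
          exact lt_of_lt_of_le (h2 l) (hX.monotone (by omega))
      obtain ⟨z, hzz⟩ := Int.fract_eq_fract.mp hij
      have hbi := hb i hi
      have hbj := hb j hj
      have hz0 : z = 0 := by
        have e1 : (z : ℝ) < 1 := by linarith
        have e2 : (-1 : ℝ) < z := by linarith
        have e3 : z < 1 := by exact_mod_cast e1
        have e4 : -1 < z := by exact_mod_cast e2
        omega
      rw [hz0] at hzz
      have : ζ i = ζ j := by simp at hzz; linarith
      exact_mod_cast hmono.injective this
  simpa using hcard
end

section
/-- Classical solutions on `S¹ × (0,T)` with named derivatives. -/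
structure Sol (T : ℝ) (a b v vx vxx vt : ℝ → ℝ → ℝ) : Prop where
  aper : ∀ t, Function.Periodic (a t) 1
  bper : ∀ t, Function.Periodic (b t) 1
  vper : ∀ t, Function.Periodic (v t) 1
  vxper : ∀ t, Function.Periodic (vx t) 1
  vxxper : ∀ t, Function.Periodic (vxx t) 1
  vtper : ∀ t, Function.Periodic (vt t) 1
  ac : ContinuousOn (fun p : ℝ × ℝ => a p.1 p.2) (Ioo 0 T ×ˢ (univ : Set ℝ))
  bc : ContinuousOn (fun p : ℝ × ℝ => b p.1 p.2) (Ioo 0 T ×ˢ (univ : Set ℝ))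
  vc : ContinuousOn (fun p : ℝ × ℝ => v p.1 p.2) (Ioo 0 T ×ˢ (univ : Set ℝ))
  vxc : ContinuousOn (fun p : ℝ × ℝ => vx p.1 p.2) (Ioo 0 T ×ˢ (univ : Set ℝ))
  vxxc : ContinuousOn (fun p : ℝ × ℝ => vxx p.1 p.2) (Ioo 0 T ×ˢ (univ : Set ℝ))
  vtc : ContinuousOn (fun p : ℝ × ℝ => vt p.1 p.2) (Ioo 0 T ×ˢ (univ : Set ℝ))
  hx : ∀ t ∈ Ioo 0 T, ∀ x, HasDerivAt (v t) (vx t x) x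
  hxx : ∀ t ∈ Ioo 0 T, ∀ x, HasDerivAt (vx t) (vxx t x) x
  ht : ∀ t ∈ Ioo 0 T, ∀ x, HasDerivAt (fun s => v s x) (vt t x) t
  eq : ∀ t ∈ Ioo 0 T, ∀ x, vt t x = vxx t x + a t x * vx t x + b t x * v t x

lemma per_shift {φ : ℝ → ℝ} (hφ : Function.Periodic φ 1) (n : ℤ) (x : ℝ) : φ (x - n) = φ x := by
  have := hφ.int_mul n (x - n)
  simpa using this.symm

lemma periodic_bdd {T t1 t2 : ℝ} (h1 : 0 < t1) (h2 : t2 < T) {g : ℝ → ℝ → ℝ}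
    (hp : ∀ t, Function.Periodic (g t) 1)
    (hc : ContinuousOn (fun p : ℝ × ℝ => g p.1 p.2) (Ioo 0 T ×ˢ (univ : Set ℝ))) :
    ∃ C > 0, ∀ t ∈ Icc t1 t2, ∀ x, |g t x| ≤ C := by
  have hK : IsCompact (Icc t1 t2 ×ˢ Icc (0 : ℝ) 1) := isCompact_Icc.prod isCompact_Icc
  have hsub : Icc t1 t2 ×ˢ Icc (0 : ℝ) 1 ⊆ Ioo 0 T ×ˢ (univ : Set ℝ) := by
    rintro ⟨t, x⟩ ⟨ht, _⟩
    exact ⟨⟨h1.trans_le ht.1, ht.2.trans_lt h2⟩, mem_univ _⟩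
  obtain ⟨C, hC⟩ := hK.exists_bound_of_continuousOn (hc.mono hsub)
  refine ⟨max C 1, by positivity, fun t ht x => ?_⟩
  have := hC (t, Int.fract x) ⟨ht, Int.fract_nonneg x, (Int.fract_lt_one x).le⟩
  have e : g t (Int.fract x) = g t x := per_shift (hp t) ⌊x⌋ x
  simp only [e, Real.norm_eq_abs] at this
  exact this.trans (le_max_left _ _)

lemma periodic_unif {T t1 t2 : ℝ} (h1 : 0 < t1) (h2 : t2 < T) {g : ℝ → ℝ → ℝ}
    (hp : ∀ t, Function.Periodic (g t) 1)
    (hc : ContinuousOn (fun p : ℝ × ℝ => g p.1 p.2) (Ioo 0 T ×ˢ (univ : Set ℝ))) {ε : ℝ}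
    (hε : 0 < ε) :
    ∃ δ > 0, ∀ t ∈ Icc t1 t2, ∀ t' ∈ Icc t1 t2, ∀ x x', |t - t'| < δ → |x - x'| < δ →
      |g t x - g t' x'| < ε := by
  have hK : IsCompact (Icc t1 t2 ×ˢ Icc (-1 : ℝ) 2) := isCompact_Icc.prod isCompact_Icc
  have hsub : Icc t1 t2 ×ˢ Icc (-1 : ℝ) 2 ⊆ Ioo 0 T ×ˢ (univ : Set ℝ) := by
    rintro ⟨t, x⟩ ⟨ht, _⟩
    exact ⟨⟨h1.trans_le ht.1, ht.2.trans_lt h2⟩, mem_univ _⟩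
  have hu := hK.uniformContinuousOn_of_continuous (hc.mono hsub)
  rw [Metric.uniformContinuousOn_iff] at hu
  obtain ⟨δ, hδ, hd⟩ := hu ε hε
  refine ⟨min δ 1, by positivity, fun t ht t' ht' x x' htt hxx => ?_⟩
  have h3 := lt_of_lt_of_le hxx (min_le_right δ 1)
  have h4 := lt_of_lt_of_le hxx (min_le_left δ 1)
  have h5 := lt_of_lt_of_le htt (min_le_left δ 1)
  have f1 := Int.fract_nonneg x
  have f2 := Int.fract_lt_one x
  rw [abs_lt] at h3
  have e0 : x - ⌊x⌋ = Int.fract x := rfl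
  have key := hd (t, x - ⌊x⌋) ⟨ht, by constructor <;> simp only <;> linarith⟩ (t', x' - ⌊x⌋)
    ⟨ht', by constructor <;> simp only <;> linarith⟩ (by
      rw [Prod.dist_eq]
      simp only [Real.dist_eq]
      apply max_lt h5
      have e1 : x - ⌊x⌋ - (x' - ⌊x⌋) = x - x' := by ring
      rw [e1]
      exact h4)
  rw [Real.dist_eq] at key
  simp only [per_shift (hp t), per_shift (hp t')] at key
  exact key

lemma taylor1 {f f' : ℝ → ℝ} {x y c ω : ℝ} (hf : ∀ z ∈ uIcc x y, HasDerivAt f (f' z) z)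
    (hb : ∀ z ∈ uIcc x y, |f' z - c| ≤ ω) : |f y - f x - (y - x) * c| ≤ ω * |y - x| := by
  have := Convex.norm_image_sub_le_of_norm_hasDerivWithin_le (f := fun z => f z - z * c)
    (f' := fun z => f' z - c) (C := ω) (s := uIcc x y) (x := x) (y := y)
    (fun z hz => by
      have h1 := (hf z hz).sub ((hasDerivAt_id z).mul_const c)
      simp only [id, one_mul] at h1
      exact h1.hasDerivWithinAt)
    (fun z hz => hb z hz) (convex_uIcc x y) left_mem_uIcc right_mem_uIcc
  simp only [Real.norm_eq_abs] at this
  convert this using 2; ring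

lemma taylor2 {f f' f'' : ℝ → ℝ} {x y c ω : ℝ} (hf : ∀ z, HasDerivAt f (f' z) z)
    (hf' : ∀ z, HasDerivAt f' (f'' z) z)
    (hb : ∀ z ∈ uIcc x y, |f'' z - c| ≤ ω) :
    |f y - f x - (y - x) * f' x - (y - x)^2 / 2 * c| ≤ ω * |y - x|^2 := by
  have hω : 0 ≤ ω := (abs_nonneg _).trans (hb x left_mem_uIcc)
  have hz : ∀ z ∈ uIcc x y, |f' z - (f' x + (z - x) * c) - 0| ≤ ω * |y - x| := by
    intro z hz
    have h1 := taylor1 (f := f') (f' := f'') (x := x) (y := z) (c := c) (ω := ω) (fun u _ => hf' u)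
      (fun u hu => hb u (uIcc_subset_uIcc_left hz hu))
    have h2 : |z - x| ≤ |y - x| := abs_sub_left_of_mem_uIcc hz
    have h3 : f' z - (f' x + (z - x) * c) - 0 = f' z - f' x - (z - x) * c := by ring
    rw [h3]
    exact h1.trans (by gcongr)
  have := taylor1 (f := fun z => f z - (z * f' x + (z - x)^2 / 2 * c))
    (f' := fun z => f' z - (f' x + (z - x) * c)) (x := x) (y := y) (c := 0)
    (fun z _ => by
      have h1 : HasDerivAt (fun z : ℝ => z * f' x + (z - x)^2 / 2 * c) (f' x + (z - x) * c) z := by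
        have a1 := (hasDerivAt_id z).mul_const (f' x)
        have a2 := ((((hasDerivAt_id z).sub_const x).pow 2).div_const 2).mul_const c
        exact (a1.add a2).congr_deriv (by simp only [id]; push_cast; ring)
      exact (hf z).sub h1) hz
  refine le_trans (le_of_eq ?_) (this.trans (le_of_eq ?_))
  · congr 1; ring
  · ring

/-- Alternation on a periodic grid. -/
def AltZ (N k : ℕ) (V : ℤ → ℝ) : Prop :=
  ∃ J : ℤ → ℤ, StrictMono J ∧ (∀ i, J (i + k) = J i + N) ∧ ∀ i, V (J i) * V (J (i + 1)) < 0

lemma altZ_step {N k : ℕ} {V V' : ℤ → ℝ} (hV : ∀ j, V (j + N) = V j) (hV' : ∀ j, V' (j + N) = V' j)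
    (h : ∀ j, V' j ≠ 0 → 0 < V' j * V j ∨ 0 < V' j * V (j + 1)) (hA : AltZ N k V') : AltZ N k V := by
  classical
  obtain ⟨J, hJ, hJ1, hJ2⟩ := hA
  let m : ℤ → ℤ := fun j => if 0 < V' j * V j then j else j + 1
  have hne : ∀ i, V' (J i) ≠ 0 := by
    intro i h0; have := hJ2 i; rw [h0] at this; simp at this
  have hs : ∀ i, 0 < V' (J i) * V (m (J i)) := by
    intro i
    simp only [m]
    split_ifs with h1
    · exact h1
    · exact (h _ (hne i)).resolve_left h1
  have hp : ∀ i, V (m (J i)) * V (m (J (i + 1))) < 0 := fun i =>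
    mul_neg_of_same (hs i) (hs (i + 1)) (hJ2 i)
  refine ⟨fun i => m (J i), ?_, ?_, hp⟩
  · apply strictMono_int_of_lt_succ
    intro i
    have hlt : J i < J (i + 1) := hJ (by omega)
    have hle : m (J i) ≤ m (J (i + 1)) := by
      have e1 : m (J i) ≤ J i + 1 := by simp only [m]; split_ifs <;> omega
      have e2 : J (i + 1) ≤ m (J (i + 1)) := by simp only [m]; split_ifs <;> omega
      omega
    refine lt_of_le_of_ne hle fun he => ?_
    have := hp i
    rw [he] at this
    nlinarith [mul_self_nonneg (V (m (J (i+1))))]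
  · intro i
    simp only [m, hJ1, hV, hV']
    split_ifs <;> ring

lemma altZ_shift {N k : ℕ} {V : ℤ → ℝ} (hA : AltZ N k (fun j => V (j - 1))) : AltZ N k V := by
  obtain ⟨J, hJ, hJ1, hJ2⟩ := hA
  refine ⟨fun i => J i - 1, fun i j hij => ?_, fun i => ?_, hJ2⟩
  · have := hJ hij; simp only; omega
  · simp only [hJ1]; ring

lemma comb_sign {c x y : ℝ} (h0 : 0 ≤ c) (h1 : c ≤ 1) (h : (1 - c) * x + c * y ≠ 0) :
    0 < ((1 - c) * x + c * y) * x ∨ 0 < ((1 - c) * x + c * y) * y := by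
  by_contra hcon
  push Not at hcon
  obtain ⟨a1, a2⟩ := hcon
  have : 0 < ((1 - c) * x + c * y) * ((1 - c) * x + c * y) := mul_self_pos.mpr h
  nlinarith [mul_nonneg h0 (sub_nonneg.mpr a2), mul_nonneg (sub_nonneg.mpr h1) (sub_nonneg.mpr a1)]

/-- One step of the scheme. -/
def stepS (δ τ : ℝ) (c β V : ℤ → ℝ) (j : ℤ) : ℝ :=
  (1 + τ * β j) * ((1 - δ) * ((1 - c j) * V j + c j * V (j + 1)) +
    δ * ((1 - c (j - 1)) * V (j - 1) + c (j - 1) * V j))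

lemma stepS_periodic {δ τ : ℝ} {N : ℕ} {c β V : ℤ → ℝ} (hV : ∀ j, V (j + N) = V j)
    (hc : ∀ j, c (j + N) = c j) (hβ : ∀ j, β (j + N) = β j) (j : ℤ) :
    stepS δ τ c β V (j + N) = stepS δ τ c β V j := by
  unfold stepS
  have e1 : j + N + 1 = (j + 1) + N := by ring
  have e2 : j + N - 1 = (j - 1) + N := by ring
  rw [e1, e2, hV, hV, hV, hc, hc, hβ]

lemma stepS_alt {δ τ : ℝ} {N k : ℕ} {c β V : ℤ → ℝ} (hδ0 : 0 ≤ δ) (hδ1 : δ ≤ 1)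
    (hc0 : ∀ j, 0 ≤ c j) (hc1 : ∀ j, c j ≤ 1) (hβ0 : ∀ j, 0 < 1 + τ * β j)
    (hV : ∀ j, V (j + N) = V j)
    (hc : ∀ j, c (j + N) = c j) (hβ : ∀ j, β (j + N) = β j)
    (hA : AltZ N k (stepS δ τ c β V)) : AltZ N k V := by
  let A : ℤ → ℝ := fun j => (1 - c j) * V j + c j * V (j + 1)
  have hAper : ∀ j, A (j + N) = A j := by
    intro j
    simp only [A]
    have e1 : j + N + 1 = (j + 1) + N := by ring
    rw [e1, hV, hV, hc]
  have h1 : AltZ N k (fun j => A (j - 1)) := by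
    refine altZ_step ?_ (stepS_periodic hV hc hβ) ?_ hA
    · intro j
      have e2 : j + N - 1 = (j - 1) + N := by ring
      simp only [e2, hAper]
    · intro j hj
      have e3 : stepS δ τ c β V j = (1 + τ * β j) * ((1 - δ) * A j + δ * A (j - 1)) := by
        simp only [stepS, A, sub_add_cancel]
      rw [e3] at hj ⊢
      have hj' := right_ne_zero_of_mul hj
      simp only [add_sub_cancel_right]
      rcases comb_sign hδ0 hδ1 hj' with h | h
      · right; rw [mul_assoc]; exact mul_pos (hβ0 j) h
      · left; rw [mul_assoc]; exact mul_pos (hβ0 j) h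
  refine altZ_step hV hAper ?_ (altZ_shift h1)
  intro j hj
  exact comb_sign (hc0 j) (hc1 j) hj

lemma stepS_bound {δ τ B M : ℝ} {c β V : ℤ → ℝ} (hδ0 : 0 ≤ δ) (hδ1 : δ ≤ 1) (hτ : 0 ≤ τ)
    (hc0 : ∀ j, 0 ≤ c j) (hc1 : ∀ j, c j ≤ 1) (hβ0 : ∀ j, 0 < 1 + τ * β j) (hB : ∀ j, β j ≤ B)
    (hM : ∀ j, |V j| ≤ M) (j : ℤ) : |stepS δ τ c β V j| ≤ (1 + τ * B) * M := by
  have hcomb : ∀ c x y : ℝ, 0 ≤ c → c ≤ 1 → |x| ≤ M → |y| ≤ M → |(1 - c) * x + c * y| ≤ M := by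
    intro c x y h0 h1 hx hy
    rw [abs_le] at *
    constructor <;> nlinarith
  unfold stepS
  rw [abs_mul, abs_of_pos (hβ0 j)]
  have hM0 : 0 ≤ M := (abs_nonneg _).trans (hM 0)
  apply mul_le_mul _ _ (abs_nonneg _) _
  · have := hB j; nlinarith
  · exact hcomb δ _ _ hδ0 hδ1 (hcomb _ _ _ (hc0 _) (hc1 _) (hM _) (hM _))
      (hcomb _ _ _ (hc0 _) (hc1 _) (hM _) (hM _))
  · have := hβ0 j; have := hB j; nlinarith
end

section
lemma abs_frac_mul_le {P E M : ℝ} (h0 : 0 ≤ P) (h1 : P ≤ 1) (hE : |E| ≤ M) : |P * E| ≤ M := by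
  rw [abs_mul, abs_of_nonneg h0]; nlinarith [abs_nonneg E]

lemma abs_conv_sub_le {δ x y C : ℝ} (h0 : 0 ≤ δ) (h1 : δ ≤ 1) (hx : |x| ≤ C) (hy : |y| ≤ C) :
    |(1 - δ) * x - δ * y| ≤ C := by
  rw [abs_le] at *
  constructor <;> nlinarith

lemma step_consistency {v0 p q r a0 a1 b0 vp vm vn h τ lam δ ω C : ℝ}
    (h0 : 0 ≤ h) (hl : 0 < lam) (hτ : τ = lam * h ^ 2) (hτC : τ * C ≤ 1) (hC : 0 ≤ C)
    (hδ0 : 0 ≤ δ) (hδ1 : δ ≤ 1) (hδ : δ * (1 - δ) = lam)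
    (h1 : |vp - v0 - h * p - h ^ 2 / 2 * q| ≤ ω * h ^ 2)
    (h2 : |vm - v0 + h * p - h ^ 2 / 2 * q| ≤ ω * h ^ 2)
    (h3 : |vn - v0 - τ * r| ≤ ω * τ) (h4 : |a1 - a0| ≤ ω) (hr : r = q + a0 * p + b0 * v0)
    (ha0 : |a0| ≤ C) (ha1 : |a1| ≤ C) (hb0 : |b0| ≤ C) (hp : |p| ≤ C) (hq : |q| ≤ C)
    (hc00 : 0 ≤ δ + h * lam * a0) (hc01 : δ + h * lam * a0 ≤ 1)
    (hc10 : 0 ≤ δ + h * lam * a1) (hc11 : δ + h * lam * a1 ≤ 1) :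
    |(1 + τ * b0) * ((1 - δ) * ((1 - (δ + h * lam * a0)) * v0 + (δ + h * lam * a0) * vp) +
      δ * ((1 - (δ + h * lam * a1)) * vm + (δ + h * lam * a1) * v0)) - vn| ≤
      τ * (2 * (ω * C + h * (C * C) + 2 * ω / lam) + τ * (C * (C + C * C)) + ω) := by
  have hω : 0 ≤ ω := (abs_nonneg _).trans h4
  have hτ0 : 0 ≤ τ := by rw [hτ]; positivity
  set P := (1 - δ) * (δ + h * lam * a0) with hP
  set Q := δ * (1 - (δ + h * lam * a1)) with hQ
  set E1 := vp - v0 - h * p - h ^ 2 / 2 * q with hE1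
  set E2 := vm - v0 + h * p - h ^ 2 / 2 * q with hE2
  set G := q + a0 * p with hG
  set F := δ * (a1 - a0) * p + h / 2 * ((1 - δ) * a0 - δ * a1) * q with hF
  have key : (1 + τ * b0) * ((1 - δ) * ((1 - (δ + h * lam * a0)) * v0 + (δ + h * lam * a0) * vp) +
      δ * ((1 - (δ + h * lam * a1)) * vm + (δ + h * lam * a1) * v0)) - vn
      = (1 + τ * b0) * (τ * F + (P * E1 + Q * E2)) + τ * (τ * (b0 * G)) - (vn - v0 - τ * r) := by
    rw [hr, hF, hG, hE1, hE2, hP, hQ, hτ, ← hδ]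
    ring
  rw [key]
  have hP0 : 0 ≤ P := mul_nonneg (by linarith) hc00
  have hP1 : P ≤ 1 := mul_le_one₀ (by linarith) hc00 hc01
  have hQ0 : 0 ≤ Q := mul_nonneg hδ0 (by linarith)
  have hQ1 : Q ≤ 1 := mul_le_one₀ hδ1 (by linarith) (by linarith)
  have bF : |F| ≤ ω * C + h * (C * C) := by
    have e1 : |δ * (a1 - a0) * p| ≤ ω * C := by
      rw [abs_mul]
      exact mul_le_mul (abs_frac_mul_le hδ0 hδ1 h4) hp (abs_nonneg _) hω
    have e2 : |(1 - δ) * a0 - δ * a1| ≤ C := abs_conv_sub_le hδ0 hδ1 ha0 ha1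
    have e3 : |h / 2 * ((1 - δ) * a0 - δ * a1) * q| ≤ h * (C * C) := by
      rw [abs_mul, abs_mul, abs_of_nonneg (by positivity : 0 ≤ h / 2), mul_assoc]
      exact mul_le_mul (by linarith) (mul_le_mul e2 hq (abs_nonneg _) hC) (by positivity) h0
    exact (abs_add_le _ _).trans (add_le_add e1 e3)
  have bPQ : |P * E1 + Q * E2| ≤ τ * (2 * ω / lam) := by
    have e0 : τ * (2 * ω / lam) = ω * h ^ 2 + ω * h ^ 2 := by rw [hτ]; field_simp; ring
    rw [e0]
    refine (abs_add_le _ _).trans (add_le_add ?_ ?_)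
    · exact abs_frac_mul_le hP0 hP1 h1
    · exact abs_frac_mul_le hQ0 hQ1 h2
  have bG : |b0 * G| ≤ C * (C + C * C) := by
    rw [abs_mul]
    refine mul_le_mul hb0 ?_ (abs_nonneg _) hC
    refine (abs_add_le _ _).trans (add_le_add hq ?_)
    rw [abs_mul]; exact mul_le_mul ha0 hp (abs_nonneg _) hC
  have b1 : |1 + τ * b0| ≤ 2 := by
    have : |τ * b0| ≤ 1 := by
      rw [abs_mul, abs_of_nonneg hτ0]
      exact (mul_le_mul_of_nonneg_left hb0 hτ0).trans hτC
    rw [abs_le] at this ⊢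
    constructor <;> linarith [this.1, this.2]
  have b2 : |τ * F + (P * E1 + Q * E2)| ≤ τ * (ω * C + h * (C * C) + 2 * ω / lam) := by
    refine (abs_add_le _ _).trans ?_
    rw [abs_mul, abs_of_nonneg hτ0]
    have := mul_le_mul_of_nonneg_left bF hτ0
    linarith
  have b3 : |(1 + τ * b0) * (τ * F + (P * E1 + Q * E2))| ≤
      2 * (τ * (ω * C + h * (C * C) + 2 * ω / lam)) := by
    rw [abs_mul]
    exact mul_le_mul b1 b2 (abs_nonneg _) (by norm_num)
  have b4 : |τ * (τ * (b0 * G))| ≤ τ * (τ * (C * (C + C * C))) := by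
    rw [abs_mul, abs_mul, abs_of_nonneg hτ0]
    gcongr
  have := abs_sub ((1 + τ * b0) * (τ * F + (P * E1 + Q * E2)) + τ * (τ * (b0 * G))) (vn - v0 - τ * r)
  have := abs_add_le ((1 + τ * b0) * (τ * F + (P * E1 + Q * E2))) (τ * (τ * (b0 * G)))
  linarith

lemma stepS_sub {δ τ : ℝ} {c β V W : ℤ → ℝ} (j : ℤ) :
    stepS δ τ c β V j - stepS δ τ c β W j = stepS δ τ c β (fun j => V j - W j) j := by
  unfold stepS; ring

/-- The finite difference approximations. -/
noncomputable def schemeV (t1 δ lam : ℝ) (N : ℕ) (a b v : ℝ → ℝ → ℝ) : ℕ → ℤ → ℝ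
  | 0 => fun j => v t1 (j / N)
  | n + 1 => stepS δ (lam / N ^ 2) (fun j => δ + 1 / N * lam * a (t1 + n * (lam / N ^ 2)) (j / N))
      (fun j => b (t1 + n * (lam / N ^ 2)) (j / N)) (schemeV t1 δ lam N a b v n)

lemma grid_per {φ : ℝ → ℝ} (hφ : Function.Periodic φ 1) {N : ℕ} (hN : 0 < N) (j : ℤ) :
    φ (((j + N : ℤ) : ℝ) / N) = φ ((j : ℝ) / N) := by
  have : (((j + N : ℤ) : ℝ) / N) = (j : ℝ) / N + 1 := by
    have : (N : ℝ) ≠ 0 := by positivity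
    push_cast; field_simp
  rw [this, hφ]

lemma schemeV_per {T t1 δ lam : ℝ} {N : ℕ} {a b v vx vxx vt : ℝ → ℝ → ℝ} (hN : 0 < N)
    (S : Sol T a b v vx vxx vt) (n : ℕ) (j : ℤ) :
    schemeV t1 δ lam N a b v n (j + N) = schemeV t1 δ lam N a b v n j := by
  induction n generalizing j with
  | zero => exact grid_per (S.vper _) hN j
  | succ n ih =>
    refine stepS_periodic ih ?_ ?_ j
    · intro j; rw [grid_per (S.aper _) hN j]
    · intro j; rw [grid_per (S.bper _) hN j]

lemma scheme_err {T t1 t2 δ lam ω C ε : ℝ} {N : ℕ} {a b v vx vxx vt : ℝ → ℝ → ℝ} (hN : 0 < N)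
    (S : Sol T a b v vx vxx vt) (ht1 : 0 < t1) (ht2 : t2 < T) (hl : 0 < lam) (hC : 0 ≤ C)
    (hτC : lam / N ^ 2 * C < 1)
    (hδ0 : 0 ≤ δ) (hδ1 : δ ≤ 1) (hδ : δ * (1 - δ) = lam)
    (ba : ∀ t ∈ Icc t1 t2, ∀ x, |a t x| ≤ C) (bb : ∀ t ∈ Icc t1 t2, ∀ x, |b t x| ≤ C)
    (bx : ∀ t ∈ Icc t1 t2, ∀ x, |vx t x| ≤ C) (bxx : ∀ t ∈ Icc t1 t2, ∀ x, |vxx t x| ≤ C)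
    (hc0 : 1 / N * lam * C ≤ δ) (hc1 : δ + 1 / N * lam * C ≤ 1)
    (ma : ∀ t ∈ Icc t1 t2, ∀ x, |a t (x - 1 / N) - a t x| ≤ ω)
    (mxx : ∀ t ∈ Icc t1 t2, ∀ x x' : ℝ, |x - x'| ≤ 1 / (N : ℝ) → |vxx t x - vxx t x'| ≤ ω)
    (mt : ∀ t ∈ Icc t1 t2, ∀ t' ∈ Icc t1 t2, ∀ x, |t - t'| ≤ lam / N ^ 2 → |vt t x - vt t' x| ≤ ω)
    (hε : 2 * (ω * C + 1 / N * (C * C) + 2 * ω / lam) + lam / N ^ 2 * (C * (C + C * C)) + ω ≤ ε)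
    (n : ℕ) (hn : t1 + n * (lam / N ^ 2) ≤ t2) (j : ℤ) :
    |schemeV t1 δ lam N a b v n j - v (t1 + n * (lam / N ^ 2)) (j / N)| ≤
      n * (lam / N ^ 2) * ε * (1 + lam / N ^ 2 * C) ^ n := by
  have hN' : (0 : ℝ) < N := by exact_mod_cast hN
  set τ := lam / (N : ℝ) ^ 2 with hτ
  have hτ0 : 0 < τ := by positivity
  induction n generalizing j with
  | zero => simp [schemeV]
  | succ n ih =>
    have hn' : t1 + n * τ ≤ t2 := by push_cast at hn; nlinarith
    have hn0 : t1 ≤ t1 + n * τ := by have : 0 ≤ n * τ := by positivity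
                                     linarith
    set t := t1 + n * τ with ht
    have htm : t ∈ Icc t1 t2 := ⟨hn0, hn'⟩
    have etn : t1 + ((n + 1 : ℕ) : ℝ) * τ = t + τ := by rw [ht]; push_cast; ring
    rw [etn] at hn ⊢
    have htn : t + τ ∈ Icc t1 t2 := ⟨by linarith, hn⟩
    have hI : ∀ u ∈ uIcc t (t + τ), u ∈ Icc t1 t2 := fun u hu => by
      rw [uIcc_of_le (by linarith)] at hu
      exact ⟨hn0.trans hu.1, hu.2.trans hn⟩
    have hoo : ∀ u ∈ Icc t1 t2, u ∈ Ioo 0 T := fun u hu =>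
      ⟨ht1.trans_le hu.1, hu.2.trans_lt ht2⟩
    have ca : ∀ x, |1 / N * lam * a t x| ≤ 1 / N * lam * C := fun x => by
      rw [abs_mul, abs_of_nonneg (by positivity : 0 ≤ 1 / (N : ℝ) * lam)]
      exact mul_le_mul_of_nonneg_left (ba t htm x) (by positivity)
    have c0 : ∀ x, 0 ≤ δ + 1 / N * lam * a t x := fun x => by
      have := (abs_le.mp (ca x)).1; linarith
    have c1 : ∀ x, δ + 1 / N * lam * a t x ≤ 1 := fun x => by
      have := (abs_le.mp (ca x)).2; linarith
    have cb : ∀ x, 0 < 1 + τ * b t x := fun x => by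
      have := (abs_le.mp (bb t htm x)).1; nlinarith
    set c : ℤ → ℝ := fun j => δ + 1 / N * lam * a t (j / N) with hc
    set β : ℤ → ℝ := fun j => b t (j / N) with hβ
    have e1 : schemeV t1 δ lam N a b v (n + 1) j = stepS δ τ c β (schemeV t1 δ lam N a b v n) j := rfl
    have ehn : ((j + 1 : ℤ) : ℝ) / N = j / N + 1 / N := by push_cast; ring
    have ehm : ((j - 1 : ℤ) : ℝ) / N = j / N - 1 / N := by push_cast; ring
    have hpos1 : (0 : ℝ) ≤ 1 / N := by positivity
    have cons := step_consistency (v0 := v t (j / N)) (p := vx t (j / N)) (q := vxx t (j / N))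
      (r := vt t (j / N)) (a0 := a t (j / N)) (a1 := a t (j / N - 1 / N)) (b0 := b t (j / N))
      (vp := v t (j / N + 1 / N)) (vm := v t (j / N - 1 / N)) (vn := v (t + τ) (j / N))
      (h := 1 / N) (τ := τ) (lam := lam) (δ := δ) (ω := ω) (C := C) hpos1 hl
      (by rw [hτ]; field_simp) hτC.le hC hδ0 hδ1 hδ
      (by
        have := taylor2 (x := (j : ℝ) / N) (y := j / N + 1 / N) (c := vxx t (j / N)) (ω := ω)
          (S.hx t (hoo t htm)) (S.hxx t (hoo t htm)) (by
            intro z hz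
            apply mxx t htm
            have := abs_sub_left_of_mem_uIcc hz
            rwa [add_sub_cancel_left, abs_of_nonneg hpos1] at this)
        rwa [add_sub_cancel_left, sq_abs] at this)
      (by
        have := taylor2 (x := (j : ℝ) / N) (y := j / N - 1 / N) (c := vxx t (j / N)) (ω := ω)
          (S.hx t (hoo t htm)) (S.hxx t (hoo t htm)) (by
            intro z hz
            apply mxx t htm
            have := abs_sub_left_of_mem_uIcc hz
            rwa [sub_sub_cancel_left, abs_neg, abs_of_nonneg hpos1] at this)
        rw [sub_sub_cancel_left, sq_abs, neg_sq, neg_mul, sub_neg_eq_add] at this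
        exact this)
      (by
        have := taylor1 (f := fun s => v s (j / N)) (f' := fun s => vt s (j / N))
          (x := t) (y := t + τ) (c := vt t (j / N)) (ω := ω)
          (fun z hz => S.ht z (hoo z (hI z hz)) _) (by
            intro z hz
            apply mt z (hI z hz) t htm
            have := abs_sub_left_of_mem_uIcc hz
            rwa [add_sub_cancel_left, abs_of_pos hτ0] at this)
        rwa [add_sub_cancel_left, abs_of_pos hτ0] at this)
      (ma t htm _) (S.eq t (hoo t htm) _) (ba t htm _) (ba t htm _) (bb t htm _) (bx t htm _)
      (bxx t htm _) (c0 _) (c1 _) (c0 _) (c1 _)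
    have cons2 : |stepS δ τ c β (fun j => v t (j / N)) j - v (t + τ) (j / N)| ≤ τ * ε := by
      have : stepS δ τ c β (fun j => v t (j / N)) j = (1 + τ * b t (j / N)) * ((1 - δ) *
          ((1 - (δ + 1 / N * lam * a t (j / N))) * v t (j / N) + (δ + 1 / N * lam * a t (j / N)) *
          v t (j / N + 1 / N)) + δ * ((1 - (δ + 1 / N * lam * a t (j / N - 1 / N))) *
          v t (j / N - 1 / N) + (δ + 1 / N * lam * a t (j / N - 1 / N)) * v t (j / N))) := by
        simp only [stepS, hc, hβ, ehn, ehm]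
      rw [this]
      exact cons.trans (mul_le_mul_of_nonneg_left hε hτ0.le)
    have ih' := fun j => ih j hn'
    have bd := stepS_bound (δ := δ) (τ := τ) (B := C) (c := c) (β := β) hδ0 hδ1 hτ0.le
      (fun j => c0 _) (fun j => c1 _) (fun j => cb _) (fun j => (abs_le.mp (bb t htm _)).2) ih' j
    rw [e1]
    have tri : |stepS δ τ c β (schemeV t1 δ lam N a b v n) j - v (t + τ) (j / N)| ≤
        (1 + τ * C) * (n * τ * ε * (1 + τ * C) ^ n) + τ * ε := by
      have : stepS δ τ c β (schemeV t1 δ lam N a b v n) j - v (t + τ) (j / N) =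
        stepS δ τ c β (fun j => schemeV t1 δ lam N a b v n j - v t (j / N)) j +
        (stepS δ τ c β (fun j => v t (j / N)) j - v (t + τ) (j / N)) := by
        rw [← stepS_sub]; ring
      rw [this]
      exact (abs_add_le _ _).trans (add_le_add bd cons2)
    refine tri.trans ?_
    have hε0 : 0 ≤ τ * ε := (abs_nonneg _).trans cons2
    have hpw : 1 ≤ (1 + τ * C) ^ (n + 1) := one_le_pow₀ (by nlinarith)
    have := mul_le_mul_of_nonneg_left hpw hε0
    push_cast
    rw [pow_succ] at *
    nlinarith
end

section
open Filter Topology MeasureTheory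
open Set Filter Topology

lemma mul_pos_of_near {x V : ℝ} (h : |x - V| < |x|) : 0 < x * V := by
  have := sq_lt_sq.mpr h
  nlinarith [sq_nonneg V]

lemma scheme_alt {T t1 t2 δ lam C : ℝ} {N k : ℕ} {a b v vx vxx vt : ℝ → ℝ → ℝ} (hN : 0 < N)
    (S : Sol T a b v vx vxx vt) (hl : 0 < lam)
    (hτC : lam / N ^ 2 * C < 1)
    (hδ0 : 0 ≤ δ) (hδ1 : δ ≤ 1)
    (ba : ∀ t ∈ Icc t1 t2, ∀ x, |a t x| ≤ C) (bb : ∀ t ∈ Icc t1 t2, ∀ x, |b t x| ≤ C)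
    (hc0 : 1 / N * lam * C ≤ δ) (hc1 : δ + 1 / N * lam * C ≤ 1)
    (n : ℕ) (hn : t1 + n * (lam / N ^ 2) ≤ t2) (hA : AltZ N k (schemeV t1 δ lam N a b v n)) :
    AltZ N k (schemeV t1 δ lam N a b v 0) := by
  have hN' : (0 : ℝ) < N := by exact_mod_cast hN
  set τ := lam / (N : ℝ) ^ 2 with hτ
  have hτ0 : 0 < τ := by positivity
  induction n with
  | zero => exact hA
  | succ n ih =>
    have hn' : t1 + n * τ ≤ t2 := by push_cast at hn; nlinarith
    have hn0 : t1 ≤ t1 + n * τ := by have : 0 ≤ n * τ := by positivity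
                                     linarith
    set t := t1 + n * τ with ht
    have htm : t ∈ Icc t1 t2 := ⟨hn0, hn'⟩
    have ca : ∀ x, |1 / N * lam * a t x| ≤ 1 / N * lam * C := fun x => by
      rw [abs_mul, abs_of_nonneg (by positivity : 0 ≤ 1 / (N : ℝ) * lam)]
      exact mul_le_mul_of_nonneg_left (ba t htm x) (by positivity)
    have c0 : ∀ x, 0 ≤ δ + 1 / N * lam * a t x := fun x => by
      have := (abs_le.mp (ca x)).1; linarith
    have c1 : ∀ x, δ + 1 / N * lam * a t x ≤ 1 := fun x => by
      have := (abs_le.mp (ca x)).2; linarith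
    have cb : ∀ x, 0 < 1 + τ * b t x := fun x => by
      have := (abs_le.mp (bb t htm x)).1; nlinarith
    refine ih (hA := ?_) (hn := hn')
    refine stepS_alt (δ := δ) (τ := τ) hδ0 hδ1 (fun j => c0 (j / N)) (fun j => c1 (j / N))
      (fun j => cb (j / N)) (schemeV_per hN S n)
      (fun j => by rw [grid_per (S.aper _) hN j])
      (fun j => by rw [grid_per (S.bper _) hN j]) hA

set_option maxHeartbeats 800000 in
lemma scheme_mono {T t1 t2 : ℝ} {k : ℕ} {a b v vx vxx vt : ℝ → ℝ → ℝ}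
    (S : Sol T a b v vx vxx vt) (ht1 : 0 < t1) (ht2 : t2 < T) (h12 : t1 < t2) (hk : 0 < k)
    (hA : Alt k (v t2)) : Alt k (v t1) := by
  obtain ⟨X, hX, hX1, hX2⟩ := hA
  obtain ⟨Ca, hCa, ba⟩ := periodic_bdd ht1 ht2 S.aper S.ac
  obtain ⟨Cb, hCb, bb⟩ := periodic_bdd ht1 ht2 S.bper S.bc
  obtain ⟨Cx, hCx, bx⟩ := periodic_bdd ht1 ht2 S.vxper S.vxc
  obtain ⟨Cxx, hCxx, bxx⟩ := periodic_bdd ht1 ht2 S.vxxper S.vxxc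
  set C := Ca + Cb + Cx + Cxx with hC
  have hC0 : 0 < C := by positivity
  replace ba : ∀ t ∈ Icc t1 t2, ∀ x, |a t x| ≤ C := fun t ht x => (ba t ht x).trans (by linarith)
  replace bb : ∀ t ∈ Icc t1 t2, ∀ x, |b t x| ≤ C := fun t ht x => (bb t ht x).trans (by linarith)
  replace bx : ∀ t ∈ Icc t1 t2, ∀ x, |vx t x| ≤ C := fun t ht x => (bx t ht x).trans (by linarith)
  replace bxx : ∀ t ∈ Icc t1 t2, ∀ x, |vxx t x| ≤ C :=
    fun t ht x => (bxx t ht x).trans (by linarith)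
  obtain ⟨m, hm⟩ := exists_nat_gt (8 * (t2 - t1))
  have hm0 : (0 : ℝ) < m := by linarith
  set lam := (t2 - t1) / m with hlam
  have hl : 0 < lam := div_pos (by linarith) hm0
  have hl8 : lam < 1 / 8 := by rw [hlam, div_lt_iff₀ hm0]; linarith
  obtain ⟨δ, hδ0, hδ1, hδ⟩ : ∃ δ : ℝ, 0 < δ ∧ δ < 1 ∧ δ * (1 - δ) = lam := by
    have hs := Real.sq_sqrt (by linarith : 0 ≤ 1 - 4 * lam)
    have hs0 := Real.sqrt_nonneg (1 - 4 * lam)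
    refine ⟨(1 - Real.sqrt (1 - 4 * lam)) / 2, ?_, ?_, ?_⟩ <;> nlinarith
  obtain ⟨μ, hμ0, hμ⟩ : ∃ μ > 0, ∀ i, μ ≤ |v t2 (X i)| := by
    have hne : ∀ i, 0 < |v t2 (X i)| := fun i => abs_pos.mpr (fun h => by
      have := hX2 i; rw [h] at this; simp at this)
    obtain ⟨i0, -, hi0⟩ := Finset.exists_min_image (Finset.range k) (fun i => |v t2 (X i)|)
      ⟨0, Finset.mem_range.mpr hk⟩
    refine ⟨_, hne i0, fun i => ?_⟩
    have hper : ∀ n : ℤ, |v t2 (X (i + n * k))| = |v t2 (X i)| := by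
      intro n
      induction n using Int.induction_on with
      | zero => simp
      | succ n ih => rw [← ih, add_mul, one_mul, ← add_assoc, hX1, S.vper]
      | pred n ih =>
        rw [← ih, ← S.vper t2 (X (i + (-n - 1) * k)), ← hX1]; congr 3; ring
    have hk' : (0 : ℤ) < k := by exact_mod_cast hk
    have h1 := hper (-(i / k))
    rw [← h1]
    have e : i + -(i / k) * k = i % k := by
      have := Int.emod_add_mul_ediv i k; linarith
    rw [e]
    have h2 := Int.emod_nonneg i hk'.ne'
    have h3 := Int.emod_lt_of_pos i hk'
    have := hi0 (i % k).toNat (Finset.mem_range.mpr (by omega))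
    rwa [Int.toNat_of_nonneg h2] at this
  set ε := μ / (4 * (t2 - t1) * Real.exp (C * (t2 - t1))) with hε
  have hd : 0 < t2 - t1 := by linarith
  have hε0 : 0 < ε := by positivity
  set ω := ε / (2 * (2 * (C + 2 / lam) + 1)) with hω
  have hω0 : 0 < ω := by positivity
  obtain ⟨d1, hd1, ma⟩ := periodic_unif ht1 ht2 S.aper S.ac hω0
  obtain ⟨d2, hd2, mxx⟩ := periodic_unif ht1 ht2 S.vxxper S.vxxc hω0
  obtain ⟨d3, hd3, mt⟩ := periodic_unif ht1 ht2 S.vtper S.vtc hω0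
  obtain ⟨d4, hd4, mv⟩ := periodic_unif ht1 ht2 S.vper S.vc (by positivity : 0 < μ / 4)
  have T1 : Tendsto (fun N : ℕ => 1 / (N : ℝ)) atTop (𝓝 0) := tendsto_one_div_atTop_nhds_zero_nat
  have T2 : Tendsto (fun N : ℕ => lam / (N : ℝ) ^ 2) atTop (𝓝 0) := by
    have := (T1.pow 2).const_mul lam
    simp only [ne_eq, OfNat.ofNat_ne_zero, not_false_eq_true, zero_pow, mul_zero] at this
    refine this.congr fun N => ?_
    rw [div_pow, one_pow]; ring
  have E1 : ∀ᶠ N : ℕ in atTop, lam / (N : ℝ) ^ 2 * C < 1 := by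
    have := T2.mul_const C
    rw [zero_mul] at this
    exact this.eventually_lt_const (by norm_num)
  have T3 : Tendsto (fun N : ℕ => 1 / (N : ℝ) * lam * C) atTop (𝓝 0) := by
    simpa using (T1.mul_const lam).mul_const C
  have E2 := T3.eventually_lt_const hδ0
  have E3 := T3.eventually_lt_const (by linarith : 0 < 1 - δ)
  have E4 : ∀ᶠ N : ℕ in atTop, 2 * (ω * C + 1 / N * (C * C) + 2 * ω / lam)
      + lam / (N : ℝ) ^ 2 * (C * (C + C * C)) + ω < ε := by
    have t := ((((T1.mul_const (C * C)).const_add (ω * C)).add_const (2 * ω / lam)).const_mul 2).add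
      (T2.mul_const (C * (C + C * C)))
    have t := t.add_const ω
    refine t.eventually_lt_const ?_
    have : 2 * (ω * C + 2 * ω / lam) + ω = ε / 2 := by
      have : ω * (2 * (C + 2 / lam) + 1) = ε / 2 := by rw [hω]; field_simp
      rw [← this]; ring
    simp only [zero_mul, add_zero]
    rw [this]; linarith
  obtain ⟨N, e1, e2, e3, e4, e5, e6, e7, e8, hN⟩ := (E1.and <| E2.and <| E3.and <| E4.and <|
    (T1.eventually_lt_const hd1).and <| (T1.eventually_lt_const hd2).and <|
    (T2.eventually_lt_const hd3).and <| (T1.eventually_lt_const hd4).and <|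
    eventually_gt_atTop 0).exists
  have hN' : (0 : ℝ) < N := by exact_mod_cast hN
  have h1N : (0 : ℝ) < 1 / N := by positivity
  have htot : ((m * N ^ 2 : ℕ) : ℝ) * (lam / N ^ 2) = t2 - t1 := by
    rw [hlam]; push_cast; field_simp
  have hle : t1 + ((m * N ^ 2 : ℕ) : ℝ) * (lam / N ^ 2) = t2 := by rw [htot]; ring
  have err := scheme_err (δ := δ) (lam := lam) (ω := ω) (C := C) (ε := ε) hN S ht1 ht2 hl hC0.le e1
    hδ0.le hδ1.le hδ ba bb bx bxx e2.le (by linarith)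
    (fun t ht x => (ma t ht t ht _ _ (by simpa using hd1) (by
      rw [sub_sub_cancel_left, abs_neg, abs_of_pos h1N]; exact e5)).le)
    (fun t ht x x' hxx => (mxx t ht t ht _ _ (by simpa using hd2) (hxx.trans_lt e6)).le)
    (fun t ht t' ht' x htt => (mt t ht t' ht' x x (htt.trans_lt e7) (by simpa using hd3)).le)
    e4.le (m * N ^ 2) hle.le
  rw [hle, htot] at err
  have hbd : (t2 - t1) * ε * (1 + lam / (N : ℝ) ^ 2 * C) ^ (m * N ^ 2) ≤ μ / 4 := by
    have p1 : (1 + lam / (N : ℝ) ^ 2 * C) ^ (m * N ^ 2) ≤ Real.exp (C * (t2 - t1)) := by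
      have : C * (t2 - t1) = ((m * N ^ 2 : ℕ) : ℝ) * (lam / N ^ 2 * C) := by rw [← htot]; ring
      rw [this, Real.exp_nat_mul]
      have hp : 0 < lam / (N : ℝ) ^ 2 * C := by positivity
      gcongr
      linarith [Real.add_one_le_exp (lam / (N : ℝ) ^ 2 * C)]
    calc _ ≤ (t2 - t1) * ε * Real.exp (C * (t2 - t1)) := by gcongr
      _ = μ / 4 := by rw [hε]; field_simp
  -- grid points
  have hJ : ∀ i, 0 < v t2 (X i) * schemeV t1 δ lam N a b v (m * N ^ 2) ⌊N * X i⌋ := by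
    intro i
    have f1 := Int.floor_le (N * X i)
    have f2 := Int.lt_floor_add_one (N * X i)
    have g1 : |X i - (⌊N * X i⌋ : ℝ) / N| < d4 := by
      have : |X i - (⌊N * X i⌋ : ℝ) / N| ≤ 1 / N := by
        have e : X i - (⌊N * X i⌋ : ℝ) / N = (N * X i - ⌊N * X i⌋) / N := by field_simp
        rw [e, abs_div, abs_of_pos hN', abs_of_nonneg (by linarith)]
        gcongr; linarith
      exact this.trans_lt e8
    have htm : t2 ∈ Icc t1 t2 := ⟨h12.le, le_rfl⟩
    have g2 := mv t2 htm t2 htm _ _ (by simpa using hd4) g1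
    have g3 := (err ⌊N * X i⌋).trans hbd
    have g4 := hμ i
    set V := schemeV t1 δ lam N a b v (m * N ^ 2) ⌊N * X i⌋
    set y := v t2 ((⌊N * X i⌋ : ℝ) / N)
    set x := v t2 (X i)
    have g5 : |x - V| < |x| := by
      have : x - V = (x - y) - (V - y) := by ring
      rw [this]
      have := abs_sub (x - y) (V - y)
      linarith
    exact mul_pos_of_near g5
  have hJ' : ∀ i, schemeV t1 δ lam N a b v (m * N ^ 2) ⌊N * X i⌋ *
      schemeV t1 δ lam N a b v (m * N ^ 2) ⌊N * X (i + 1)⌋ < 0 := fun i =>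
    mul_neg_of_same (hJ i) (hJ (i + 1)) (hX2 i)
  have hAZ : AltZ N k (schemeV t1 δ lam N a b v (m * N ^ 2)) := by
    refine ⟨fun i => ⌊N * X i⌋, ?_, ?_, hJ'⟩
    · apply strictMono_int_of_lt_succ
      intro i
      have hlt : X i < X (i + 1) := hX (by omega)
      refine lt_of_le_of_ne (Int.floor_le_floor (by gcongr)) fun he => ?_
      have := hJ' i
      rw [he] at this
      nlinarith [mul_self_nonneg (schemeV t1 δ lam N a b v (m * N ^ 2) ⌊N * X (i + 1)⌋)]
    · intro i
      simp only [hX1]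
      have : (N : ℝ) * (X i + 1) = N * X i + (N : ℕ) := by ring
      rw [this, Int.floor_add_natCast]
  obtain ⟨J, j1, j2, j3⟩ := scheme_alt hN S hl e1 hδ0.le hδ1.le ba bb e2.le (by linarith)
    (m * N ^ 2) hle.le hAZ
  refine ⟨fun i => (J i : ℝ) / N, fun i j hij => ?_, fun i => ?_, j3⟩
  · have := j1 hij
    simp only
    gcongr
  · simp only [j2]; push_cast; field_simp
end

section
open Filter Topology MeasureTheory
/-- The Gaussian weight. -/
noncomputable def gam (y : ℝ) : ℝ := Real.exp (-(y ^ 2) / 4)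

lemma gam_pos (y : ℝ) : 0 < gam y := Real.exp_pos _

lemma gam_cont : Continuous gam := by unfold gam; fun_prop

lemma gam_deriv (y : ℝ) : HasDerivAt gam (-(y / 2) * gam y) y := by
  have h1 : HasDerivAt (fun y : ℝ => -(y ^ 2) / 4) (-(y / 2)) y := by
    have := ((hasDerivAt_pow 2 y).neg).div_const 4
    exact this.congr_deriv (by push_cast; ring)
  exact h1.exp.congr_deriv (by unfold gam; ring)

/-- Continuous functions of at most exponential growth. -/
@[fun_prop]
def EG (f : ℝ → ℝ) : Prop := Continuous f ∧ ∃ C k : ℝ, ∀ y, |f y| ≤ C * Real.exp (k * |y|)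

lemma EG.cont {f : ℝ → ℝ} (h : EG f) : Continuous f := h.1

lemma EG.nf {f : ℝ → ℝ} (h : EG f) :
    ∃ C k : ℝ, 0 ≤ C ∧ 0 ≤ k ∧ ∀ y, |f y| ≤ C * Real.exp (k * |y|) := by
  obtain ⟨_, C, k, h⟩ := h
  refine ⟨|C|, |k|, abs_nonneg _, abs_nonneg _, fun y => (h y).trans ?_⟩
  have h1 : C ≤ |C| := le_abs_self _
  have h2 : k * |y| ≤ |k| * |y| := mul_le_mul_of_nonneg_right (le_abs_self _) (abs_nonneg _)
  have := Real.exp_le_exp.mpr h2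
  calc C * Real.exp (k * |y|) ≤ |C| * Real.exp (k * |y|) :=
        mul_le_mul_of_nonneg_right h1 (Real.exp_pos _).le
    _ ≤ _ := mul_le_mul_of_nonneg_left this (abs_nonneg _)

@[fun_prop]
lemma EG.mul {f g : ℝ → ℝ} (hf : EG f) (hg : EG g) : EG (fun y => f y * g y) := by
  obtain ⟨C, k, hC, hk, h⟩ := hf.nf
  obtain ⟨C', k', hC', hk', h'⟩ := hg.nf
  refine ⟨hf.1.mul hg.1, C * C', k + k', fun y => ?_⟩
  rw [abs_mul, add_mul, Real.exp_add]
  calc |f y| * |g y| ≤ (C * Real.exp (k * |y|)) * (C' * Real.exp (k' * |y|)) :=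
        mul_le_mul (h y) (h' y) (abs_nonneg _) (by positivity)
    _ = _ := by ring

@[fun_prop]
lemma EG.add {f g : ℝ → ℝ} (hf : EG f) (hg : EG g) : EG (fun y => f y + g y) := by
  obtain ⟨C, k, hC, hk, h⟩ := hf.nf
  obtain ⟨C', k', hC', hk', h'⟩ := hg.nf
  refine ⟨hf.1.add hg.1, C + C', k + k', fun y => ?_⟩
  have e1 : Real.exp (k * |y|) ≤ Real.exp ((k + k') * |y|) := by
    apply Real.exp_le_exp.mpr; nlinarith [abs_nonneg y]
  have e2 : Real.exp (k' * |y|) ≤ Real.exp ((k + k') * |y|) := by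
    apply Real.exp_le_exp.mpr; nlinarith [abs_nonneg y]
  calc |f y + g y| ≤ |f y| + |g y| := abs_add_le _ _
    _ ≤ C * Real.exp (k * |y|) + C' * Real.exp (k' * |y|) := add_le_add (h y) (h' y)
    _ ≤ C * Real.exp ((k + k') * |y|) + C' * Real.exp ((k + k') * |y|) := by gcongr
    _ = _ := by ring

@[fun_prop]
lemma EG.const (c : ℝ) : EG (fun _ => c) :=
  ⟨continuous_const, |c|, 0, fun y => by simp⟩

lemma EG.of_bdd {f : ℝ → ℝ} (hf : Continuous f) {C : ℝ} (h : ∀ y, |f y| ≤ C) : EG f :=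
  ⟨hf, C, 0, fun y => by simpa using h y⟩

@[fun_prop]
lemma EG.id : EG (fun y => y) :=
  ⟨continuous_id, 1, 1, fun y => by
    have := Real.add_one_le_exp (1 * |y|); linarith⟩

@[fun_prop]
lemma EG.abs {f : ℝ → ℝ} (hf : EG f) : EG (fun y => |f y|) := by
  obtain ⟨h, C, k, hk⟩ := hf
  exact ⟨h.abs, C, k, fun y => by rw [abs_abs]; exact hk y⟩

@[fun_prop]
lemma EG.neg {f : ℝ → ℝ} (hf : EG f) : EG (fun y => - f y) := by
  obtain ⟨h, C, k, hk⟩ := hf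
  exact ⟨h.neg, C, k, fun y => by rw [abs_neg]; exact hk y⟩

@[fun_prop]
lemma EG.sub {f g : ℝ → ℝ} (hf : EG f) (hg : EG g) : EG (fun y => f y - g y) := by
  simpa [sub_eq_add_neg] using hf.add hg.neg

lemma EG.cmul {f : ℝ → ℝ} (hf : EG f) (c : ℝ) : EG (fun y => c * f y) := (EG.const c).mul hf

@[fun_prop]
lemma EG.sq {f : ℝ → ℝ} (hf : EG f) : EG (fun y => f y ^ 2) := by
  simpa [pow_two] using hf.mul hf

@[fun_prop]
lemma EG.divc {f : ℝ → ℝ} (hf : EG f) (c : ℝ) : EG (fun y => f y / c) := by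
  simpa [div_eq_mul_inv] using hf.mul (EG.const c⁻¹)

lemma exp_lin_gam_le (k y : ℝ) :
    Real.exp (k * |y|) * gam y ≤ Real.exp (2 * k ^ 2) * Real.exp (-(1 / 8) * y ^ 2) := by
  unfold gam
  rw [← Real.exp_add, ← Real.exp_add]
  apply Real.exp_le_exp.mpr
  nlinarith [sq_nonneg (|y| - 4 * k), sq_abs y]

lemma EG.int {f : ℝ → ℝ} (hf : EG f) : Integrable (fun y => f y * gam y) := by
  obtain ⟨C, k, hC, hk, h⟩ := hf.nf
  refine Integrable.mono' (((integrable_exp_neg_mul_sq (by norm_num : (0 : ℝ) < 1 / 8)).const_mul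
    (Real.exp (2 * k ^ 2))).const_mul C) (hf.1.mul gam_cont).aestronglyMeasurable
    (Eventually.of_forall fun y => ?_)
  rw [Real.norm_eq_abs, abs_mul, abs_of_pos (gam_pos y)]
  calc |f y| * gam y ≤ C * Real.exp (k * |y|) * gam y :=
        mul_le_mul_of_nonneg_right (h y) (gam_pos y).le
    _ = C * (Real.exp (k * |y|) * gam y) := by ring
    _ ≤ _ := mul_le_mul_of_nonneg_left (exp_lin_gam_le k y) hC

/-- The Gaussian integral. -/
noncomputable def GI (f : ℝ → ℝ) : ℝ := ∫ y, f y * gam y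

lemma GI_add {f g : ℝ → ℝ} (hf : EG f) (hg : EG g) : GI (fun y => f y + g y) = GI f + GI g := by
  unfold GI
  rw [← integral_add hf.int hg.int]
  congr 1; ext y; ring

lemma GI_sub {f g : ℝ → ℝ} (hf : EG f) (hg : EG g) : GI (fun y => f y - g y) = GI f - GI g := by
  unfold GI
  rw [← integral_sub hf.int hg.int]
  congr 1; ext y; ring

lemma GI_cmul (c : ℝ) (f : ℝ → ℝ) : GI (fun y => c * f y) = c * GI f := by
  unfold GI
  rw [← integral_const_mul]
  congr 1; ext y; ring

lemma GI_neg (f : ℝ → ℝ) : GI (fun y => - f y) = - GI f := by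
  unfold GI
  rw [← integral_neg]
  congr 1; ext y; ring

lemma GI_mono {f g : ℝ → ℝ} (hf : EG f) (hg : EG g) (h : ∀ y, f y ≤ g y) : GI f ≤ GI g :=
  integral_mono hf.int hg.int fun y => mul_le_mul_of_nonneg_right (h y) (gam_pos y).le

lemma GI_nonneg {f : ℝ → ℝ} (h : ∀ y, 0 ≤ f y) : 0 ≤ GI f :=
  integral_nonneg fun y => mul_nonneg (h y) (gam_pos y).le

lemma GI_abs_le {f : ℝ → ℝ} : |GI f| ≤ GI (fun y => |f y|) := by
  unfold GI
  refine (abs_integral_le_integral_abs).trans (le_of_eq ?_)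
  congr 1; ext y; rw [abs_mul, abs_of_pos (gam_pos y)]

lemma GI_ext {f g : ℝ → ℝ} (h : ∀ y, f y = g y) : GI f = GI g := by
  have : f = g := funext h
  rw [this]

lemma GI_cs {f g : ℝ → ℝ} (hf : EG f) (hg : EG g) :
    GI (fun y => f y * g y) ^ 2 ≤ GI (fun y => f y ^ 2) * GI (fun y => g y ^ 2) := by
  have key : ∀ x : ℝ, 0 ≤ GI (fun y => f y ^ 2) * (x * x) + (2 * GI (fun y => f y * g y)) * x
      + GI (fun y => g y ^ 2) := by
    intro x
    have h0 : 0 ≤ GI (fun y => (x * f y + g y) ^ 2) := GI_nonneg fun y => sq_nonneg _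
    have e : GI (fun y => (x * f y + g y) ^ 2) = GI (fun y => ((x * x) * f y ^ 2 +
        (2 * x) * (f y * g y)) + g y ^ 2) := GI_ext fun y => by ring
    rw [e, GI_add ((hf.sq.cmul _).add ((hf.mul hg).cmul _)) hg.sq,
      GI_add (hf.sq.cmul _) ((hf.mul hg).cmul _), GI_cmul, GI_cmul] at h0
    linarith
  have := discrim_le_zero key
  unfold discrim at this
  nlinarith

lemma GI_cs_abs {f g : ℝ → ℝ} (hf : EG f) (hg : EG g) :
    |GI (fun y => f y * g y)| ≤ √(GI (fun y => f y ^ 2)) * √(GI (fun y => g y ^ 2)) := by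
  rw [← Real.sqrt_mul (GI_nonneg fun y => sq_nonneg _)]
  exact Real.abs_le_sqrt (GI_cs hf hg)

lemma GI_pos {f : ℝ → ℝ} (hf : EG f) (h : ∀ y, 0 ≤ f y) {y0 : ℝ} (h0 : f y0 ≠ 0) : 0 < GI f := by
  unfold GI
  have hc : Continuous (fun y => f y * gam y) := hf.1.mul gam_cont
  rw [integral_pos_iff_support_of_nonneg (fun y => mul_nonneg (h y) (gam_pos y).le) hf.int]
  exact hc.isOpen_support.measure_pos _ ⟨y0, mul_ne_zero h0 (gam_pos y0).ne'⟩

lemma GI_ibp {p q χ χ' : ℝ → ℝ} (hp : EG p) (hq : EG q) (hχ : EG χ) (hχ' : EG χ')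
    (dp : ∀ y, HasDerivAt p (q y) y) (dχ : ∀ y, HasDerivAt χ (χ' y) y) :
    GI (fun y => (q y - y / 2 * p y) * χ y) = - GI (fun y => p y * χ' y) := by
  have hy : EG (fun y => y / 2 * p y) := by
    have := (EG.id.cmul (1 / 2)).mul hp
    refine (funext fun y => ?_ : (fun y => y / 2 * p y) = _) ▸ this
    ring
  have h1 : EG (fun y => (q y - y / 2 * p y) * χ y) := (hq.sub hy).mul hχ
  have h2 : EG (fun y => p y * χ' y) := hp.mul hχ'
  have h3 : EG (fun y => p y * χ y) := hp.mul hχ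
  have := integral_eq_zero_of_hasDerivAt_of_integrable (f := fun y => p y * χ y * gam y)
    (f' := fun y => ((q y - y / 2 * p y) * χ y + p y * χ' y) * gam y)
    (fun y => (((dp y).mul (dχ y)).mul (gam_deriv y)).congr_deriv (by simp only [Pi.mul_apply]; ring))
    (h1.add h2).int h3.int
  have e := GI_add h1 h2
  unfold GI at *
  linarith
end

section
open Filter Topology MeasureTheory
lemma tight {φ p : ℝ → ℝ} (hφ : EG φ) (hp : EG p) (d : ∀ y, HasDerivAt φ (p y) y) :
    GI (fun y => y ^ 2 * φ y ^ 2) ≤ 4 * GI (fun y => φ y ^ 2) + 16 * GI (fun y => p y ^ 2) := by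
  -- integrate the derivative of `y φ² γ`
  have h1 := integral_eq_zero_of_hasDerivAt_of_integrable (f := fun y => y * φ y ^ 2 * gam y)
    (f' := fun y => ((φ y ^ 2 + 2 * (y * φ y * p y)) - 1 / 2 * (y ^ 2 * φ y ^ 2)) * gam y)
    (fun y => ((((hasDerivAt_id y).mul ((d y).pow 2)).mul (gam_deriv y)).congr_deriv (by
      simp only [Pi.mul_apply, Pi.pow_apply, id]; push_cast; ring)))
    (EG.int (by fun_prop)) (EG.int (by fun_prop))
  have h2 : GI (fun y => (φ y ^ 2 + 2 * (y * φ y * p y)) - 1 / 2 * (y ^ 2 * φ y ^ 2)) = 0 := h1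
  rw [GI_sub (by fun_prop) (by fun_prop), GI_add (by fun_prop) (by fun_prop), GI_cmul, GI_cmul] at h2
  have h3 : GI (fun y => y * φ y * p y) ≤ GI (fun y => 1 / 8 * (y ^ 2 * φ y ^ 2) + 2 * p y ^ 2) := by
    apply GI_mono (by fun_prop) (by fun_prop)
    intro y
    nlinarith [sq_nonneg (y * φ y - 4 * p y)]
  rw [GI_add (by fun_prop) (by fun_prop), GI_cmul, GI_cmul] at h3
  linarith

/-- total mass -/
noncomputable def G0 : ℝ := GI (fun _ => 1)

lemma G0_pos : 0 < G0 := GI_pos (by fun_prop) (fun _ => by norm_num) (y0 := 0) (by norm_num)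

lemma gam_lb {L y : ℝ} (h : |y| ≤ L) : Real.exp (-(L ^ 2) / 4) ≤ gam y := by
  unfold gam
  apply Real.exp_le_exp.mpr
  have := sq_le_sq' (abs_le.mp h).1 (abs_le.mp h).2
  linarith

lemma setint_le_GI {f : ℝ → ℝ} (hf : EG f) (h0 : ∀ y, 0 ≤ f y) {L a b : ℝ} (hab : a ≤ b)
    (ha : -L ≤ a) (hb : b ≤ L) :
    Real.exp (-(L ^ 2) / 4) * ∫ y in a..b, f y ≤ GI f := by
  rw [intervalIntegral.integral_of_le hab, ← integral_const_mul]
  calc ∫ y in Ioc a b, Real.exp (-(L ^ 2) / 4) * f y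
      ≤ ∫ y in Ioc a b, f y * gam y := by
        apply setIntegral_mono_on
        · exact ((hf.1.const_mul _).integrableOn_Icc (a := a) (b := b)).mono_set Ioc_subset_Icc_self
        · exact hf.int.integrableOn
        · exact measurableSet_Ioc
        · intro y hy
          have : |y| ≤ L := abs_le.mpr ⟨by linarith [hy.1], by linarith [hy.2]⟩
          rw [mul_comm]
          exact mul_le_mul_of_nonneg_left (gam_lb this) (h0 y)
    _ ≤ GI f := setIntegral_le_integral hf.int
        (Eventually.of_forall fun y => mul_nonneg (h0 y) (gam_pos y).le)

lemma lemmaJ (K : ℝ) (hK : 0 ≤ K) : ∃ L ℓ c : ℝ, 0 < L ∧ 0 < ℓ ∧ ℓ ≤ 1 ∧ 0 < c ∧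
    ∀ φ p : ℝ → ℝ, EG φ → EG p → (∀ y, HasDerivAt φ (p y) y) →
      0 < GI (fun y => φ y ^ 2) → GI (fun y => p y ^ 2) ≤ K * GI (fun y => φ y ^ 2) →
      ∃ y1 e : ℝ, |y1| ≤ L ∧ |e| = 1 ∧
        ∀ y, |y - y1| ≤ ℓ → c * √(GI (fun y => φ y ^ 2)) ≤ e * φ y := by
  have hG := G0_pos
  set L := √(2 * (4 + 16 * K)) with hL
  have hL2 : L ^ 2 = 2 * (4 + 16 * K) := Real.sq_sqrt (by positivity)
  have hL0 : 0 < L := Real.sqrt_pos.mpr (by positivity)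
  set c := √(1 / (4 * G0)) with hc
  have hc2 : c ^ 2 = 1 / (4 * G0) := Real.sq_sqrt (by positivity)
  have hc0 : 0 < c := Real.sqrt_pos.mpr (by positivity)
  set A := Real.exp ((L + 1) ^ 2 / 4) * K + 1 with hA
  have hA0 : 0 < A := by positivity
  set ℓ := min 1 (c ^ 2 / (8 * A)) with hℓ
  have hℓ0 : 0 < ℓ := lt_min one_pos (by positivity)
  have hℓ1 : ℓ ≤ 1 := min_le_left _ _
  have hℓA : ℓ * A ≤ c ^ 2 / 8 := by
    have : ℓ ≤ c ^ 2 / (8 * A) := min_le_right _ _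
    rw [le_div_iff₀ (by positivity)] at this
    linarith
  refine ⟨L, ℓ, c / 2, hL0, hℓ0, hℓ1, by positivity, fun φ p hφ hp d hE hD => ?_⟩
  set E := GI (fun y => φ y ^ 2) with hEdef
  set D := GI (fun y => p y ^ 2) with hDdef
  have hs : √E ^ 2 = E := Real.sq_sqrt hE.le
  have hs0 : 0 < √E := Real.sqrt_pos.mpr hE
  obtain ⟨y1, hy1, hy1'⟩ : ∃ y1, |y1| ≤ L ∧ c * √E ≤ |φ y1| := by
    by_contra hcon
    push Not at hcon
    have hle : E ≤ GI (fun y => c ^ 2 * E * 1 + 1 / L ^ 2 * (y ^ 2 * φ y ^ 2)) := by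
      apply GI_mono (by fun_prop) (by fun_prop)
      intro y
      by_cases hy : |y| ≤ L
      · have h1 : |φ y| ^ 2 ≤ (c * √E) ^ 2 := by
          have := hcon y hy
          gcongr
        rw [sq_abs, mul_pow, hs] at h1
        have : 0 ≤ 1 / L ^ 2 * (y ^ 2 * φ y ^ 2) := by positivity
        linarith
      · have h1 : L ^ 2 ≤ y ^ 2 := by
          rw [← sq_abs y]; push Not at hy; gcongr
        have h2 : φ y ^ 2 ≤ 1 / L ^ 2 * (y ^ 2 * φ y ^ 2) := by
          rw [← mul_assoc]
          have : 1 ≤ 1 / L ^ 2 * y ^ 2 := by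
            rw [one_div, inv_mul_eq_div, le_div_iff₀ (by positivity)]; linarith
          nlinarith [sq_nonneg (φ y)]
        have : 0 ≤ c ^ 2 * E * 1 := by positivity
        linarith
    rw [GI_add (by fun_prop) (by fun_prop), GI_cmul, GI_cmul] at hle
    have ht := tight hφ hp d
    have e1 : c ^ 2 * E * G0 = E / 4 := by rw [hc2]; field_simp
    have e2 : 1 / L ^ 2 * GI (fun y => y ^ 2 * φ y ^ 2) ≤ E / 2 := by
      rw [one_div, inv_mul_eq_div, div_le_iff₀ (by positivity), hL2]
      nlinarith
    have e3 : GI (fun _ => 1) = G0 := rfl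
    rw [e3] at hle
    linarith
  -- Hölder bound
  have hold : ∀ y, |y - y1| ≤ ℓ → |φ y - φ y1| ≤ c / 2 * √E := by
    intro y hy
    set α := 1 / (c * √E) * (2 * ℓ) with hα
    have hα0 : 0 < α := by positivity
    have main : ∀ a b : ℝ, a ≤ b → b - a ≤ ℓ → -(L + 1) ≤ a → b ≤ L + 1 →
        |φ b - φ a| ≤ c / 2 * √E := by
      intro a b hab hba ha hb
      have f1 : ∫ y in a..b, p y = φ b - φ a :=
        intervalIntegral.integral_eq_sub_of_hasDerivAt (fun y _ => d y) (hp.1.intervalIntegrable _ _)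
      have f2 : |∫ y in a..b, p y| ≤ ∫ y in a..b, |p y| :=
        intervalIntegral.abs_integral_le_integral_abs hab
      have f3 : ∫ y in a..b, |p y| ≤ ∫ y in a..b, (α * p y ^ 2 + 1 / (4 * α)) := by
        apply intervalIntegral.integral_mono_on hab (hp.1.abs.intervalIntegrable _ _)
        · exact Continuous.intervalIntegrable (((hp.1.pow 2).const_mul α).add continuous_const) _ _
        · intro y _
          have : 0 ≤ α * (|p y| - 1 / (2 * α)) ^ 2 := by positivity
          have e : α * (|p y| - 1 / (2 * α)) ^ 2 = α * p y ^ 2 + 1 / (4 * α) - |p y| := by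
            rw [← sq_abs (p y)]; field_simp; ring
          linarith
      have f4 : ∫ y in a..b, (α * p y ^ 2 + 1 / (4 * α)) =
          α * (∫ y in a..b, p y ^ 2) + (b - a) * (1 / (4 * α)) := by
        rw [intervalIntegral.integral_add, intervalIntegral.integral_const_mul,
          intervalIntegral.integral_const, smul_eq_mul]
        · exact Continuous.intervalIntegrable ((hp.1.pow 2).const_mul α) _ _
        · exact intervalIntegrable_const
      have f5 := setint_le_GI (f := fun y => p y ^ 2) (by fun_prop) (fun y => sq_nonneg _) hab ha hb
      have f6 : ∫ y in a..b, p y ^ 2 ≤ A * E := by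
        have e : (∫ y in a..b, p y ^ 2) = Real.exp ((L + 1) ^ 2 / 4) *
            (Real.exp (-((L + 1) ^ 2) / 4) * ∫ y in a..b, p y ^ 2) := by
          rw [← mul_assoc, ← Real.exp_add, neg_div, add_neg_cancel, Real.exp_zero, one_mul]
        rw [e]
        calc _ ≤ Real.exp ((L + 1) ^ 2 / 4) * (K * E) :=
              mul_le_mul_of_nonneg_left (f5.trans hD) (Real.exp_pos _).le
          _ ≤ A * E := by rw [hA]; nlinarith
      have f7 : (b - a) * (1 / (4 * α)) ≤ ℓ * (1 / (4 * α)) := by gcongr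
      have f8 : ℓ * (1 / (4 * α)) = c * √E / 8 := by rw [hα]; field_simp; ring
      have f9 : α * (A * E) ≤ c * √E / 2 - c * √E / 8 := by
        have e : α * (A * E) = 2 * (ℓ * A) * √E / c := by
          rw [hα]; field_simp; rw [hs]
        have e2 : 2 * (ℓ * A) * √E / c ≤ 2 * (c ^ 2 / 8) * √E / c := by gcongr
        have e3 : 2 * (c ^ 2 / 8) * √E / c = c * √E / 4 := by field_simp; ring
        have : 0 < c * √E := by positivity
        rw [e]; linarith
      rw [f1] at f2
      have := mul_le_mul_of_nonneg_left f6 hα0.le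
      linarith
    have hy2 := abs_le.mp hy
    have hy3 := abs_le.mp hy1
    rcases le_total y1 y with h | h
    · exact main y1 y h (by linarith) (by linarith) (by linarith)
    · rw [abs_sub_comm]
      exact main y y1 h (by linarith) (by linarith) (by linarith)
  rcases le_total 0 (φ y1) with h | h
  · refine ⟨y1, 1, hy1, by simp, fun y hy => ?_⟩
    rw [abs_of_nonneg h] at hy1'
    have := (abs_le.mp (hold y hy)).1
    linarith
  · refine ⟨y1, -1, hy1, by simp, fun y hy => ?_⟩
    rw [abs_of_nonpos h] at hy1'
    have := (abs_le.mp (hold y hy)).2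
    linarith
end

section
open Filter Topology MeasureTheory
lemma mgf_inj_aux {ν : Measure ℝ} {h : ℝ → ℝ} (hm : Measurable h)
    (hi : ∀ t : ℝ, Integrable (fun y => Real.exp (t * y) * h y) ν) (t : ℝ) :
    Integrable (fun y => Real.exp (t * y)) (ν.withDensity fun y => ENNReal.ofReal (h y)) ∧
    ∫ y, Real.exp (t * y) ∂(ν.withDensity fun y => ENNReal.ofReal (h y))
      = ∫ y, max (h y) 0 * Real.exp (t * y) ∂ν := by
  constructor
  · rw [integrable_withDensity_iff_integrable_smul' (by fun_prop) (by simp)]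
    simp only [ENNReal.toReal_ofReal', smul_eq_mul]
    have := (hi t).pos_part
    refine this.congr (Eventually.of_forall fun y => ?_)
    simp only
    rw [mul_comm (Real.exp _) (h y), max_mul_of_nonneg _ _ (Real.exp_pos _).le, zero_mul]
  · rw [integral_withDensity_eq_integral_toReal_smul (by fun_prop) (by simp)]
    simp only [ENNReal.toReal_ofReal', smul_eq_mul]

open ProbabilityTheory in
lemma mgf_inj {ν : Measure ℝ} [IsFiniteMeasure ν] {h : ℝ → ℝ} (hm : Measurable h)
    (hi : ∀ t : ℝ, Integrable (fun y => Real.exp (t * y) * h y) ν) (t0 : ℝ)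
    (hz : ∀ᶠ t in 𝓝 t0, ∫ y, Real.exp (t * y) * h y ∂ν = 0) : h =ᵐ[ν] 0 := by
  have hi' : ∀ t : ℝ, Integrable (fun y => Real.exp (t * y) * (fun y => - h y) y) ν := fun t => by
    simpa using (hi t).neg
  have A := mgf_inj_aux hm hi
  have A' := mgf_inj_aux hm.neg hi'
  set ν1 := ν.withDensity fun y => ENNReal.ofReal (h y) with hν1
  set ν2 := ν.withDensity fun y => ENNReal.ofReal ((-h) y) with hν2
  have h0 : Integrable h ν := by simpa using hi 0
  have : IsFiniteMeasure ν1 := isFiniteMeasure_withDensity_ofReal h0.2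
  have : IsFiniteMeasure ν2 := isFiniteMeasure_withDensity_ofReal (f := -h) h0.neg.2
  have e1 : integrableExpSet id ν1 = univ := by
    ext t; simpa [integrableExpSet] using (A t).1
  have e2 : integrableExpSet id ν2 = univ := by
    ext t; simpa [integrableExpSet] using (A' t).1
  have hX : AnalyticOnNhd ℂ (complexMGF id ν1) univ := by
    have := analyticOnNhd_complexMGF (X := id) (μ := ν1)
    simpa [e1] using this
  have hY : AnalyticOnNhd ℂ (complexMGF id ν2) univ := by
    have := analyticOnNhd_complexMGF (X := id) (μ := ν2)
    simpa [e2] using this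
  have hmgf : ∀ᶠ t in 𝓝 t0, mgf id ν1 t = mgf id ν2 t := by
    filter_upwards [hz] with t ht
    unfold mgf
    simp only [id]
    rw [(A t).2, (A' t).2, ← sub_eq_zero, ← integral_sub]
    · refine Eq.trans ?_ ht
      congr 1; ext y
      rcases le_total (h y) 0 with hy | hy
      · rw [max_eq_right hy, max_eq_left (by simpa using hy)]; simp; ring
      · rw [max_eq_left hy, max_eq_right (by simpa using hy)]; ring
    · have := (A t).1
      rw [integrable_withDensity_iff_integrable_smul' (by fun_prop) (by simp)] at this
      simpa only [ENNReal.toReal_ofReal', smul_eq_mul] using this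
    · have := (A' t).1
      rw [integrable_withDensity_iff_integrable_smul' (hm.neg.ennreal_ofReal) (by simp)] at this
      simpa only [ENNReal.toReal_ofReal', smul_eq_mul] using this
  have hE : EqOn (complexMGF id ν1) (complexMGF id ν2) univ := by
    refine AnalyticOnNhd.eqOn_of_preconnected_of_frequently_eq hX hY isPreconnected_univ
      (z₀ := (t0 : ℂ)) (mem_univ _) ?_
    have h_real : ∃ᶠ (x : ℝ) in 𝓝[≠] t0, complexMGF id ν1 x = complexMGF id ν2 x := by
      refine Eventually.frequently ?_
      filter_upwards [mem_nhdsWithin_of_mem_nhds hmgf] with y hy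
      rw [complexMGF_ofReal, complexMGF_ofReal, hy]
    rw [frequently_iff_seq_forall] at h_real ⊢
    obtain ⟨xs, hx_tendsto, hx_eq⟩ := h_real
    refine ⟨fun n ↦ xs n, ?_, fun n ↦ ?_⟩
    · rw [tendsto_nhdsWithin_iff] at hx_tendsto ⊢
      constructor
      · exact (Complex.continuous_ofReal.tendsto t0).comp hx_tendsto.1
      · simpa using hx_tendsto.2
    · simp [hx_eq]
  have hν : ν1 = ν2 := Measure.ext_of_complexMGF_id_eq (funext fun z => hE (mem_univ z))
  rw [hν1, hν2, withDensity_eq_iff (by fun_prop) (hm.neg.ennreal_ofReal.aemeasurable)] at hν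
  · filter_upwards [hν] with y hy
    rcases lt_trichotomy (h y) 0 with h1 | h1 | h1
    · rw [ENNReal.ofReal_of_nonpos h1.le, eq_comm, ENNReal.ofReal_eq_zero] at hy
      simp at hy; linarith
    · simpa using h1
    · rw [ENNReal.ofReal_of_nonpos (p := (-h) y) (by simpa using h1.le), ENNReal.ofReal_eq_zero] at hy
      linarith
  · have := measure_ne_top ν1 univ
    rwa [hν1, withDensity_apply _ MeasurableSet.univ, setLIntegral_univ] at this
end

section
open Filter Topology MeasureTheory
/-- The Gaussian measure with density `gam`. -/
noncomputable def gmu : Measure ℝ := volume.withDensity fun y => ENNReal.ofReal (gam y)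

lemma gmu_int_iff {f : ℝ → ℝ} : Integrable f gmu ↔ Integrable (fun y => f y * gam y) := by
  unfold gmu
  rw [integrable_withDensity_iff_integrable_smul' (gam_cont.measurable.ennreal_ofReal) (by simp)]
  simp only [ENNReal.toReal_ofReal (gam_pos _).le, smul_eq_mul, mul_comm]

lemma gmu_integral (f : ℝ → ℝ) : ∫ y, f y ∂gmu = GI f := by
  unfold gmu GI
  rw [integral_withDensity_eq_integral_toReal_smul (gam_cont.measurable.ennreal_ofReal) (by simp)]
  simp only [ENNReal.toReal_ofReal (gam_pos _).le, smul_eq_mul, mul_comm]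

instance gmu_fin : IsFiniteMeasure gmu := by
  have : Integrable (fun _ : ℝ => (1 : ℝ)) gmu := by
    rw [gmu_int_iff]; exact (EG.const 1).int
  have := (integrable_const_iff (μ := gmu) (c := (1 : ℝ))).mp this
  simpa using this

lemma EG.memLp {f : ℝ → ℝ} (hf : EG f) : MemLp f 2 gmu := by
  rw [memLp_two_iff_integrable_sq hf.cont.aestronglyMeasurable, gmu_int_iff]
  exact hf.sq.int

/-- The translation kernel: `psi c y * gam y = gam (y - c)`. -/
noncomputable def psi (c y : ℝ) : ℝ := Real.exp (c * y / 2 - c ^ 2 / 4)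

lemma psi_gam (c y : ℝ) : psi c y * gam y = gam (y - c) := by
  unfold psi gam
  rw [← Real.exp_add]; congr 1; ring

lemma EG.expl (k : ℝ) : EG (fun y => Real.exp (k * y)) :=
  ⟨by fun_prop, 1, |k|, fun y => by
    rw [Real.abs_exp, one_mul]
    apply Real.exp_le_exp.mpr
    rw [← abs_mul]; exact le_abs_self _⟩

lemma psi_eq (c y : ℝ) : psi c y = Real.exp (-(c ^ 2) / 4) * Real.exp ((c / 2) * y) := by
  unfold psi; rw [← Real.exp_add]; congr 1; ring

@[fun_prop]
lemma EG.psi (c : ℝ) : EG (psi c) := by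
  have := (EG.expl (c / 2)).cmul (Real.exp (-(c ^ 2) / 4))
  exact (funext fun y => psi_eq c y : _root_.psi c = _) ▸ this

lemma inner_gmu {f g : ℝ → ℝ} (hf : MemLp f 2 gmu) (hg : MemLp g 2 gmu) :
    inner ℝ (hf.toLp f) (hg.toLp g) = GI (fun y => f y * g y) := by
  rw [L2.inner_def, ← gmu_integral]
  apply integral_congr_ae
  filter_upwards [hf.coeFn_toLp, hg.coeFn_toLp] with y h1 h2
  rw [h1, h2]; simp [mul_comm]

/-- The span of kernels. -/
noncomputable def kspan (I : Set ℝ) : Submodule ℝ (Lp ℝ 2 gmu) :=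
  Submodule.span ℝ {x | ∃ c ∈ I, x = (EG.psi c).memLp.toLp (psi c)}

lemma kspan_dense {I : Set ℝ} {c0 : ℝ} (hI : I ∈ 𝓝 c0) : (kspan I).topologicalClosure = ⊤ := by
  rw [Submodule.topologicalClosure_eq_top_iff, Submodule.eq_bot_iff]
  intro h hh
  rw [Submodule.mem_orthogonal] at hh
  have hm : Measurable (h : ℝ → ℝ) := (Lp.stronglyMeasurable h).measurable
  have hmem : MemLp (h : ℝ → ℝ) 2 gmu := Lp.memLp h
  have key : (h : ℝ → ℝ) =ᵐ[gmu] 0 := by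
    refine mgf_inj hm (fun t => (EG.expl t).memLp.integrable_mul hmem) (c0 / 2) ?_
    have : Tendsto (fun t : ℝ => 2 * t) (𝓝 (c0 / 2)) (𝓝 c0) := by
      have : Continuous fun t : ℝ => 2 * t := by fun_prop
      have := this.tendsto (c0 / 2)
      rwa [mul_div_cancel₀ _ (by norm_num : (2 : ℝ) ≠ 0)] at this
    filter_upwards [this hI] with t ht
    have h1 := hh ((EG.psi (2 * t)).memLp.toLp (psi (2 * t))) (Submodule.subset_span ⟨2 * t, ht, rfl⟩)
    have h2 : h = hmem.toLp h := (Lp.toLp_coeFn h hmem).symm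
    rw [h2, inner_gmu, ← gmu_integral] at h1
    have : ∫ y, psi (2 * t) y * h y ∂gmu
        = Real.exp (-((2 * t) ^ 2) / 4) * ∫ y, Real.exp (t * y) * h y ∂gmu := by
      rw [← integral_const_mul]
      congr 1; ext y; rw [psi_eq, mul_div_cancel_left₀ _ (by norm_num : (2 : ℝ) ≠ 0)]; ring
    rw [this] at h1
    exact (mul_eq_zero.mp h1).resolve_left (Real.exp_pos _).ne'
  exact (Lp.eq_zero_iff_ae_eq_zero).mpr key

lemma kspan_prop {I : Set ℝ} {x : Lp ℝ 2 gmu} (hx : x ∈ kspan I) :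
    ∃ M : ℝ, 0 ≤ M ∧ ∀ φ (hφ : EG φ) δ, 0 ≤ δ → (∀ c ∈ I, |GI (fun y => φ y * psi c y)| ≤ δ) →
      |inner ℝ (hφ.memLp.toLp φ) x| ≤ M * δ := by
  unfold kspan at hx
  induction hx using Submodule.span_induction with
  | mem x hx =>
    obtain ⟨c, hc, rfl⟩ := hx
    refine ⟨1, by norm_num, fun φ hφ δ hδ h => ?_⟩
    rw [inner_gmu, one_mul]; exact h c hc
  | zero => exact ⟨0, le_rfl, fun φ hφ δ hδ h => by simp⟩
  | add x y _ _ hx hy =>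
    obtain ⟨M, hM, h1⟩ := hx
    obtain ⟨M', hM', h2⟩ := hy
    refine ⟨M + M', by positivity, fun φ hφ δ hδ h => ?_⟩
    rw [inner_add_right, add_mul]
    exact (abs_add_le _ _).trans (add_le_add (h1 φ hφ δ hδ h) (h2 φ hφ δ hδ h))
  | smul r x _ hx =>
    obtain ⟨M, hM, h1⟩ := hx
    refine ⟨|r| * M, by positivity, fun φ hφ δ hδ h => ?_⟩
    rw [inner_smul_right, abs_mul, mul_assoc]
    exact mul_le_mul_of_nonneg_left (h1 φ hφ δ hδ h) (abs_nonneg _)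

lemma kdense {I : Set ℝ} {c0 : ℝ} (hI : I ∈ 𝓝 c0) {f : ℝ → ℝ} (hf : MemLp f 2 gmu) {ε : ℝ}
    (hε : 0 < ε) : ∃ M : ℝ, 0 ≤ M ∧ ∀ φ (_ : EG φ) δ, 0 ≤ δ →
      (∀ c ∈ I, |GI (fun y => φ y * psi c y)| ≤ δ) →
      |GI (fun y => φ y * f y)| ≤ M * δ + ε * √(GI fun y => φ y ^ 2) := by
  have h1 : hf.toLp f ∈ (kspan I).topologicalClosure := by rw [kspan_dense hI]; trivial
  rw [← SetLike.mem_coe, Submodule.topologicalClosure_coe, Metric.mem_closure_iff] at h1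
  obtain ⟨x, hx, hd⟩ := h1 ε hε
  obtain ⟨M, hM, h⟩ := kspan_prop hx
  refine ⟨M, hM, fun φ hφ δ hδ hc => ?_⟩
  have h2 := h φ hφ δ hδ hc
  rw [← inner_gmu hφ.memLp hf]
  have e : inner ℝ (hφ.memLp.toLp φ) (hf.toLp f) = inner ℝ (hφ.memLp.toLp φ) x
      + inner ℝ (hφ.memLp.toLp φ) (hf.toLp f - x) := by rw [inner_sub_right]; ring
  have h3 := abs_real_inner_le_norm (hφ.memLp.toLp φ) (hf.toLp f - x)
  have h4 : ‖hφ.memLp.toLp φ‖ = √(GI fun y => φ y ^ 2) := by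
    rw [← Real.sqrt_sq (norm_nonneg (hφ.memLp.toLp φ)), ← real_inner_self_eq_norm_sq, inner_gmu]
    congr 1; exact GI_ext fun y => by ring
  rw [dist_eq_norm] at hd
  rw [e]
  refine (abs_add_le _ _).trans (add_le_add h2 (h3.trans ?_))
  rw [h4, mul_comm]
  exact mul_le_mul_of_nonneg_right hd.le (Real.sqrt_nonneg _)
end

section
open Filter Topology MeasureTheory
/-- cell indicator -/
noncomputable def cell (a b : ℝ) : ℝ → ℝ := (Ioc a b).indicator fun _ => 1

lemma cell_memLp (a b : ℝ) : MemLp (cell a b) 2 gmu := by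
  unfold cell
  exact (memLp_const (1 : ℝ)).indicator measurableSet_Ioc

lemma cell_GI (φ : ℝ → ℝ) {a b : ℝ} (hab : a ≤ b) :
    GI (fun y => φ y * cell a b y) = ∫ y in a..b, φ y * gam y := by
  rw [intervalIntegral.integral_of_le hab, ← integral_indicator measurableSet_Ioc]
  unfold GI cell
  congr 1; ext y
  by_cases h : y ∈ Ioc a b
  · simp [h]
  · simp [h]

lemma lemmaW (K : ℝ) (hK : 0 ≤ K) {I : Set ℝ} {c0 : ℝ} (hI : I ∈ 𝓝 c0) : ∃ δ : ℝ, 0 < δ ∧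
    ∀ φ p : ℝ → ℝ, EG φ → EG p → (∀ y, HasDerivAt φ (p y) y) → 0 < GI (fun y => φ y ^ 2) →
    GI (fun y => p y ^ 2) ≤ K * GI (fun y => φ y ^ 2) →
    ∃ c ∈ I, δ * √(GI fun y => φ y ^ 2) < |GI (fun y => φ y * psi c y)| := by
  obtain ⟨L, ℓ, c, hL, hℓ, hℓ1, hc, H⟩ := lemmaJ K hK
  set κ := c * Real.exp (-((L + 1) ^ 2) / 4) * (ℓ / 2) with hκ
  have hκ0 : 0 < κ := by positivity
  set A : ℕ → ℝ := fun j => -L + j * (ℓ / 2) with hA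
  have := fun j : ℕ => kdense hI (cell_memLp (A j) (A (j + 1))) (ε := κ / 2) (by positivity)
  choose M hM0 hM using this
  set N := ⌊2 * L / (ℓ / 2)⌋₊ + 1 with hN
  set MM := ∑ j ∈ Finset.range N, M j with hMM
  have hMM0 : 0 ≤ MM := Finset.sum_nonneg fun j _ => hM0 j
  refine ⟨κ / (4 * (1 + MM)), by positivity, fun φ p hφ hp d hE hD => ?_⟩
  by_contra hcon
  push Not at hcon
  obtain ⟨y1, e, hy1, he, h1⟩ := H φ p hφ hp d hE hD
  set s := √(GI fun y => φ y ^ 2) with hs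
  have hs0 : 0 < s := Real.sqrt_pos.mpr hE
  have hy := abs_le.mp hy1
  set j := ⌊(y1 + L) / (ℓ / 2)⌋₊ with hj
  have hl2 : 0 < ℓ / 2 := by positivity
  have hnn : 0 ≤ (y1 + L) / (ℓ / 2) := div_nonneg (by linarith) hl2.le
  have hj1 : A j ≤ y1 := by
    have := Nat.floor_le hnn
    rw [le_div_iff₀ hl2, ← hj] at this
    simp only [hA]; linarith
  have hj2 : y1 ≤ A (j + 1) := by
    have := (Nat.lt_floor_add_one ((y1 + L) / (ℓ / 2))).le
    rw [div_le_iff₀ hl2, ← hj] at this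
    simp only [hA]; push_cast; linarith
  have hstep : A (j + 1) = A j + ℓ / 2 := by simp only [hA]; push_cast; ring
  have hjN : j < N := by
    rw [hN, Nat.lt_succ_iff]
    apply Nat.floor_le_floor
    gcongr; linarith
  have hMj : M j ≤ MM := Finset.single_le_sum (f := M) (fun i _ => hM0 i) (Finset.mem_range.mpr hjN)
  have h2 := hM j φ hφ (κ / (4 * (1 + MM)) * s) (by positivity) hcon
  rw [cell_GI φ (by linarith : A j ≤ A (j + 1))] at h2
  have hconst : ∫ y in (A j)..(A (j + 1)), c * s * Real.exp (-((L + 1) ^ 2) / 4) = κ * s := by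
    rw [intervalIntegral.integral_const, hstep, smul_eq_mul, hκ]; ring
  have hcont : Continuous fun y => e * (φ y * gam y) := by
    have := hφ.cont; have := gam_cont; fun_prop
  have h3 : κ * s ≤ e * ∫ y in (A j)..(A (j + 1)), φ y * gam y := by
    rw [← hconst, ← intervalIntegral.integral_const_mul]
    apply intervalIntegral.integral_mono_on (by linarith) (by simp) (hcont.intervalIntegrable _ _)
    intro y hy'
    have hd : |y - y1| ≤ ℓ := abs_le.mpr ⟨by linarith [hy'.1], by linarith [hy'.2]⟩
    have g1 := h1 y hd
    have g2 : Real.exp (-((L + 1) ^ 2) / 4) ≤ gam y := by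
      apply gam_lb
      have := abs_le.mp hd
      exact abs_le.mpr ⟨by linarith, by linarith⟩
    rw [← mul_assoc]
    exact mul_le_mul g1 g2 (Real.exp_pos _).le ((by positivity : 0 ≤ c * s).trans g1)
  have h4 : e * ∫ y in (A j)..(A (j + 1)), φ y * gam y ≤ |∫ y in (A j)..(A (j + 1)), φ y * gam y| := by
    refine (le_abs_self _).trans ?_
    rw [abs_mul, he, one_mul]
  have h5 : M j * (κ / (4 * (1 + MM)) * s) ≤ κ / 4 * s := by
    have : M j * (κ / (4 * (1 + MM)) * s) = (M j / (1 + MM)) * (κ / 4 * s) := by field_simp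
    rw [this]
    have h6 : M j / (1 + MM) ≤ 1 := by rw [div_le_one (by positivity)]; linarith
    have : 0 ≤ κ / 4 * s := by positivity
    nlinarith
  have : 0 < κ * s := by positivity
  linarith
end

section
open Filter Topology MeasureTheory
/-- A solution in similarity variables. -/
structure Sim (s1 B C : ℝ) (w p q r : ℝ → ℝ → ℝ) : Prop where
  B0 : 0 ≤ B
  C0 : 0 ≤ C
  dw : ∀ s, s1 < s → ∀ y, HasDerivAt (w s) (p s y) y
  dp : ∀ s, s1 < s → ∀ y, HasDerivAt (p s) (q s y) y
  ds : ∀ s, s1 < s → ∀ y, HasDerivAt (fun s => w s y) (r s y) s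
  cq : ∀ s, s1 < s → Continuous (q s)
  cr : ∀ s, s1 < s → Continuous (r s)
  cps : ∀ s, s1 < s → ∀ y, ContinuousAt (fun s => p s y) s
  cqs : ∀ s, s1 < s → ∀ y, ContinuousAt (fun s => q s y) s
  bw : ∀ s, s1 < s → ∀ y, |w s y| ≤ C
  bp : ∀ s, s1 < s → ∀ y, |p s y| ≤ C
  bq : ∀ s, s1 < s → ∀ y, |q s y| ≤ C
  br : ∀ s, s1 < s → ∀ y, |r s y| ≤ C * (1 + |y|)
  eqn : ∀ s, s1 < s → ∀ y, |r s y - (q s y - y / 2 * p s y)| ≤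
    B * Real.exp (-s / 2) * (|w s y| + |p s y|)

section
variable {s1 B C : ℝ} {w p q r : ℝ → ℝ → ℝ}

/-- energy -/
noncomputable def En (w : ℝ → ℝ → ℝ) (s : ℝ) : ℝ := GI fun y => w s y ^ 2
/-- drift part -/
noncomputable def gg (p q : ℝ → ℝ → ℝ) (s y : ℝ) : ℝ := q s y - y / 2 * p s y

lemma En_nonneg (w : ℝ → ℝ → ℝ) (s : ℝ) : 0 ≤ En w s := GI_nonneg fun _ => sq_nonneg _

namespace Sim
variable (S : Sim s1 B C w p q r) {s : ℝ} (hs : s1 < s)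
include S hs

lemma ew : EG (w s) := EG.of_bdd (continuous_iff_continuousAt.mpr fun y => (S.dw s hs y).continuousAt) (S.bw s hs)
lemma ep : EG (p s) := EG.of_bdd (continuous_iff_continuousAt.mpr fun y => (S.dp s hs y).continuousAt) (S.bp s hs)
lemma eq' : EG (q s) := EG.of_bdd (S.cq s hs) (S.bq s hs)
lemma er : EG (r s) := by
  refine ⟨S.cr s hs, C, 1, fun y => (S.br s hs y).trans ?_⟩
  have := Real.add_one_le_exp (1 * |y|)
  exact mul_le_mul_of_nonneg_left (by linarith) S.C0
lemma eg : EG (gg p q s) := by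
  have := S.ep hs; have := S.eq' hs
  unfold gg; fun_prop

lemma derivE : HasDerivAt (En w) (2 * GI (fun y => r s y * w s y)) s := by
  have hε : 0 < s - s1 := by linarith
  have key := hasDerivAt_integral_of_dominated_loc_of_deriv_le (μ := volume)
    (F := fun σ y => w σ y ^ 2 * gam y) (F' := fun σ y => (2 * (r σ y * w σ y)) * gam y)
    (x₀ := s) (s := Metric.ball s (s - s1)) (bound := fun y => (2 * (C * (1 + |y|) * C)) * gam y)
    (Metric.ball_mem_nhds s hε) ?_ ?_ ?_ ?_ ?_ ?_
  · have h := key.2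
    have e : (∫ y, (2 * (r s y * w s y)) * gam y) = 2 * GI (fun y => r s y * w s y) := by
      rw [← GI_cmul]; rfl
    rw [e] at h
    exact h
  · filter_upwards [lt_mem_nhds hs] with σ hσ
    exact (S.ew hσ).sq.int.aestronglyMeasurable
  · exact (S.ew hs).sq.int
  · have := S.er hs; have := S.ew hs
    exact (EG.int (f := fun y => 2 * (r s y * w s y)) (by fun_prop)).aestronglyMeasurable
  · refine Eventually.of_forall fun y σ hσ => ?_
    have hσ' : s1 < σ := by
      have := abs_lt.mp (mem_ball_iff_norm.mp hσ); linarith [this.1]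
    rw [Real.norm_eq_abs, abs_mul, abs_of_pos (gam_pos y), abs_mul, abs_mul, abs_of_pos (by norm_num : (0:ℝ) < 2)]
    have h1 := S.br σ hσ' y
    have h2 := S.bw σ hσ' y
    have := S.C0
    have := gam_pos y
    gcongr
  · exact EG.int (f := fun y => 2 * (C * (1 + |y|) * C)) (by fun_prop)
  · refine Eventually.of_forall fun y σ hσ => ?_
    have hσ' : s1 < σ := by
      have := abs_lt.mp (mem_ball_iff_norm.mp hσ); linarith [this.1]
    have := ((S.ds σ hσ' y).pow 2).mul_const (gam y)
    exact this.congr_deriv (by push_cast; ring)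

lemma derivM : HasDerivAt (fun s => GI (w s)) (GI (r s)) s := by
  have hε : 0 < s - s1 := by linarith
  have key := hasDerivAt_integral_of_dominated_loc_of_deriv_le (μ := volume)
    (F := fun σ y => w σ y * gam y) (F' := fun σ y => r σ y * gam y)
    (x₀ := s) (s := Metric.ball s (s - s1)) (bound := fun y => (C * (1 + |y|)) * gam y)
    (Metric.ball_mem_nhds s hε) ?_ ?_ ?_ ?_ ?_ ?_
  · exact key.2
  · filter_upwards [lt_mem_nhds hs] with σ hσ
    exact (S.ew hσ).int.aestronglyMeasurable
  · exact (S.ew hs).int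
  · exact (S.er hs).int.aestronglyMeasurable
  · refine Eventually.of_forall fun y σ hσ => ?_
    have hσ' : s1 < σ := by
      have := abs_lt.mp (mem_ball_iff_norm.mp hσ); linarith [this.1]
    rw [Real.norm_eq_abs, abs_mul, abs_of_pos (gam_pos y)]
    exact mul_le_mul_of_nonneg_right (S.br σ hσ' y) (gam_pos y).le
  · exact EG.int (f := fun y => C * (1 + |y|)) (by fun_prop)
  · refine Eventually.of_forall fun y σ hσ => ?_
    have hσ' : s1 < σ := by
      have := abs_lt.mp (mem_ball_iff_norm.mp hσ); linarith [this.1]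
    exact (S.ds σ hσ' y).mul_const (gam y)

lemma slope_bd {σ : ℝ} (hσ : s1 < σ) (y : ℝ) : |slope (fun s => w s y) s σ| ≤ C * (1 + |y|) := by
  have h : ‖w σ y - w s y‖ ≤ C * (1 + |y|) * ‖σ - s‖ :=
    (convex_Ioi s1).norm_image_sub_le_of_norm_hasDerivWithin_le (f := fun s => w s y)
      (fun x hx => (S.ds x hx y).hasDerivWithinAt) (fun x hx => S.br x hx y) hs hσ
  rw [slope_def_field, abs_div]
  rw [Real.norm_eq_abs, Real.norm_eq_abs] at h
  have := S.C0
  exact div_le_of_le_mul₀ (abs_nonneg _) (by positivity) h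

lemma gg_bd (y : ℝ) : |gg p q s y| ≤ C * (1 + |y|) := by
  unfold gg
  refine (abs_sub _ _).trans ?_
  rw [abs_mul, abs_div, abs_of_pos (by norm_num : (0:ℝ) < 2)]
  have h1 := S.bq s hs y
  have h2 := S.bp s hs y
  have h3 : |y| / 2 * |p s y| ≤ |y| / 2 * C := mul_le_mul_of_nonneg_left h2 (by positivity)
  have := mul_nonneg S.C0 (abs_nonneg y)
  nlinarith

lemma D_diff {σ : ℝ} (hσ : s1 < σ) : En p σ - En p s =
    - GI (fun y => (w σ y - w s y) * (gg p q σ y + gg p q s y)) := by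
  have a1 := S.ew hs; have a2 := S.ew hσ; have a3 := S.ep hs; have a4 := S.ep hσ
  have a5 := S.eq' hs; have a6 := S.eq' hσ
  have := GI_ibp (p := fun y => p σ y + p s y) (q := fun y => q σ y + q s y)
    (χ := fun y => w σ y - w s y) (χ' := fun y => p σ y - p s y) (by fun_prop) (by fun_prop)
    (by fun_prop) (by fun_prop) (fun y => (S.dp σ hσ y).add (S.dp s hs y))
    (fun y => (S.dw σ hσ y).sub (S.dw s hs y))
  unfold En
  rw [← GI_sub a4.sq a3.sq]
  rw [GI_ext (g := fun y => (p σ y + p s y) * (p σ y - p s y)) (fun y => by ring),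
    eq_comm, GI_ext (g := fun y => (q σ y + q s y - y / 2 * (p σ y + p s y)) * (w σ y - w s y))
    (fun y => by unfold gg; ring), this, neg_neg]

lemma derivD : HasDerivAt (En p) (-(2 * GI (fun y => r s y * gg p q s y))) s := by
  rw [hasDerivAt_iff_tendsto_slope]
  have key : Tendsto (fun σ => ∫ y, (slope (fun s => w s y) s σ * (gg p q σ y + gg p q s y)) * gam y)
      (𝓝[≠] s) (𝓝 (∫ y, (r s y * (gg p q s y + gg p q s y)) * gam y)) := by
    have hev : ∀ᶠ σ in 𝓝[≠] s, s1 < σ := mem_nhdsWithin_of_mem_nhds (lt_mem_nhds hs)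
    refine tendsto_integral_filter_of_dominated_convergence
      (fun y => (C * (1 + |y|) * (C * (1 + |y|) + C * (1 + |y|))) * gam y) ?_ ?_ ?_ ?_
    · filter_upwards [hev] with σ hσ
      have a1 := S.ew hs; have a2 := S.ew hσ; have a3 := S.eg hs; have a4 := S.eg hσ
      simp only [slope_def_field]
      exact (EG.int (f := fun y => (w σ y - w s y) / (σ - s) * (gg p q σ y + gg p q s y))
        (by fun_prop)).aestronglyMeasurable
    · filter_upwards [hev] with σ hσ
      refine Eventually.of_forall fun y => ?_
      rw [Real.norm_eq_abs, abs_mul, abs_of_pos (gam_pos y), abs_mul]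
      have h1 := S.slope_bd hs hσ y
      have h2 := (abs_add_le _ _).trans (add_le_add (S.gg_bd hσ y) (S.gg_bd hs y))
      have := S.C0
      have := gam_pos y
      gcongr
    · exact EG.int (f := fun y => C * (1 + |y|) * (C * (1 + |y|) + C * (1 + |y|))) (by fun_prop)
    · refine Eventually.of_forall fun y => ?_
      have h1 := hasDerivAt_iff_tendsto_slope.mp (S.ds s hs y)
      have h2 : ContinuousAt (fun σ => gg p q σ y) s := by
        unfold gg
        have := S.cps s hs y; have := S.cqs s hs y
        fun_prop
      have h3 : Tendsto (fun σ => gg p q σ y) (𝓝[≠] s) (𝓝 (gg p q s y)) :=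
        h2.tendsto.mono_left nhdsWithin_le_nhds
      exact (h1.mul (h3.add_const _)).mul_const _
  have e : -(2 * GI (fun y => r s y * gg p q s y)) =
      -(∫ y, (r s y * (gg p q s y + gg p q s y)) * gam y) := by
    rw [← GI_cmul]
    congr 1
    exact GI_ext fun y => by ring
  rw [e]
  refine (key.neg).congr' ?_
  filter_upwards [mem_nhdsWithin_of_mem_nhds (lt_mem_nhds hs)] with σ hσ
  rw [slope_def_field, S.D_diff hs hσ, neg_div, neg_inj, div_eq_inv_mul, ← GI_cmul]
  refine GI_ext fun y => ?_
  rw [slope_def_field]; ring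

lemma GI_gw : GI (fun y => gg p q s y * w s y) = - En p s := by
  rw [show (fun y => gg p q s y * w s y) = fun y => (q s y - y / 2 * p s y) * w s y from rfl,
    GI_ibp (S.ep hs) (S.eq' hs) (S.ew hs) (S.ep hs) (S.dp s hs) (S.dw s hs)]
  unfold En; congr 1; exact GI_ext fun y => by ring

end Sim
end
end

section
open Filter Topology MeasureTheory
section
variable {s1 B C : ℝ} {w p q r : ℝ → ℝ → ℝ}

/-- perturbation -/
noncomputable def ff (p q r : ℝ → ℝ → ℝ) (s y : ℝ) : ℝ := r s y - gg p q s y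

/-- regularised frequency -/
noncomputable def Lam (w p : ℝ → ℝ → ℝ) (ε s : ℝ) : ℝ := En p s / (En w s + ε)

/-- residual -/
noncomputable def Res (w p q : ℝ → ℝ → ℝ) (ε s : ℝ) : ℝ :=
  GI fun y => (gg p q s y + Lam w p ε s * w s y) ^ 2

/-- corrected frequency -/
noncomputable def QQ (B : ℝ) (w p : ℝ → ℝ → ℝ) (ε s : ℝ) : ℝ :=
  (1 + Lam w p ε s) * Real.exp (2 * B ^ 2 * Real.exp (-s))

lemma expdecay_deriv (c k s : ℝ) :
    HasDerivAt (fun s => Real.exp (c * Real.exp (-(k * s)))) (Real.exp (c * Real.exp (-(k * s))) *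
      (c * (Real.exp (-(k * s)) * (-k)))) s := by
  have h : HasDerivAt (fun s : ℝ => -(k * s)) (-k) s := by
    exact ((hasDerivAt_id s).const_mul k).neg.congr_deriv (by simp)
  exact (h.exp.const_mul c).exp

lemma exp_half_sq (s : ℝ) : Real.exp (-s / 2) ^ 2 = Real.exp (-s) := by
  rw [← Real.exp_nat_mul]; congr 1; push_cast; ring

namespace Sim
variable (S : Sim s1 B C w p q r) {s : ℝ} (hs : s1 < s)
include S hs

lemma ef : EG (ff p q r s) := by
  have := S.er hs; have := S.eg hs
  unfold ff; fun_prop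

lemma f_bd (y : ℝ) : |ff p q r s y| ≤ B * Real.exp (-s / 2) * (|w s y| + |p s y|) := S.eqn s hs y

lemma f_sq : GI (fun y => ff p q r s y ^ 2) ≤ 2 * B ^ 2 * Real.exp (-s) * (En w s + En p s) := by
  have a1 := S.ew hs; have a2 := S.ep hs; have a3 := S.ef hs
  unfold En
  rw [← GI_add a1.sq a2.sq, ← GI_cmul]
  refine GI_mono (by fun_prop) (by fun_prop) fun y => ?_
  have h := S.f_bd hs y
  have h2 : ff p q r s y ^ 2 ≤ (B * Real.exp (-s / 2) * (|w s y| + |p s y|)) ^ 2 := by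
    rw [← sq_abs (ff p q r s y)]
    exact pow_le_pow_left₀ (abs_nonneg _) h 2
  refine h2.trans ?_
  rw [mul_pow, mul_pow, exp_half_sq]
  have h3 : (|w s y| + |p s y|) ^ 2 ≤ 2 * (w s y ^ 2 + p s y ^ 2) := by
    rw [← sq_abs (w s y), ← sq_abs (p s y)]
    nlinarith [sq_nonneg (|w s y| - |p s y|)]
  have h4 : 0 ≤ B ^ 2 * Real.exp (-s) := by positivity
  calc B ^ 2 * Real.exp (-s) * (|w s y| + |p s y|) ^ 2
      ≤ B ^ 2 * Real.exp (-s) * (2 * (w s y ^ 2 + p s y ^ 2)) := mul_le_mul_of_nonneg_left h3 h4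
    _ = _ := by ring

lemma fw_bd : |2 * GI (fun y => ff p q r s y * w s y)| ≤
    B * Real.exp (-s / 2) * (3 * En w s + En p s) := by
  have a1 := S.ew hs; have a2 := S.ep hs; have a3 := S.ef hs
  unfold En
  rw [← GI_cmul, ← GI_cmul, ← GI_add (by fun_prop) (by fun_prop), ← GI_cmul]
  refine GI_abs_le.trans (GI_mono (by fun_prop) (by fun_prop) fun y => ?_)
  have h := S.f_bd hs y
  have hb : 0 ≤ B * Real.exp (-s / 2) := mul_nonneg S.B0 (Real.exp_pos _).le
  rw [abs_mul, abs_mul, abs_of_pos (by norm_num : (0:ℝ) < 2)]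
  have h1 : |ff p q r s y| * |w s y| ≤ B * Real.exp (-s / 2) * (|w s y| + |p s y|) * |w s y| :=
    mul_le_mul_of_nonneg_right h (abs_nonneg _)
  have h3 : 2 * ((|w s y| + |p s y|) * |w s y|) ≤ 3 * w s y ^ 2 + p s y ^ 2 := by
    rw [← sq_abs (w s y), ← sq_abs (p s y)]
    nlinarith [sq_nonneg (|w s y| - |p s y|)]
  have := mul_le_mul_of_nonneg_left h3 hb
  linarith

lemma fw_bd' : 2 * GI (fun y => ff p q r s y * w s y) ≤
    2 * En p s + (2 * B * Real.exp (-s / 2) + B ^ 2 / 2 * Real.exp (-s)) * En w s := by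
  have a1 := S.ew hs; have a2 := S.ep hs; have a3 := S.ef hs
  unfold En
  rw [← GI_cmul, ← GI_cmul, ← GI_cmul, ← GI_add (by fun_prop) (by fun_prop)]
  refine (GI_mono (by fun_prop) (by fun_prop) fun y => ?_)
  have h := S.f_bd hs y
  set b := Real.exp (-s / 2) with hb
  have hb2 : Real.exp (-s) = b ^ 2 := (exp_half_sq s).symm
  rw [hb2]
  have h1 : |ff p q r s y| * |w s y| ≤ B * b * (|w s y| + |p s y|) * |w s y| :=
    mul_le_mul_of_nonneg_right h (abs_nonneg _)
  have h0 : ff p q r s y * w s y ≤ |ff p q r s y| * |w s y| := by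
    rw [← abs_mul]; exact le_abs_self _
  rw [← sq_abs (w s y), ← sq_abs (p s y)]
  nlinarith [sq_nonneg (2 * |p s y| - B * b * |w s y|)]

lemma derivE' : HasDerivAt (En w) (-(2 * En p s) + 2 * GI (fun y => ff p q r s y * w s y)) s := by
  refine (S.derivE hs).congr_deriv ?_
  have a1 := S.ew hs; have a2 := S.eg hs; have a3 := S.ef hs
  have h : GI (fun y => r s y * w s y) = GI (fun y => gg p q s y * w s y)
      + GI (fun y => ff p q r s y * w s y) := by
    rw [← GI_add (by fun_prop) (by fun_prop)]
    exact GI_ext fun y => by unfold ff; ring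
  rw [h, S.GI_gw hs]; ring

lemma Lam_nonneg {ε : ℝ} (h : 0 < En w s + ε) : 0 ≤ Lam w p ε s :=
  div_nonneg (En_nonneg _ _) h.le

lemma derivQ {ε : ℝ} (hε : 0 ≤ ε) (hE : 0 < En w s + ε) : ∃ d, HasDerivAt (QQ B w p ε) d s ∧
    d ≤ - (Res w p q ε s / (En w s + ε)) := by
  have a1 := S.ew hs; have a2 := S.eg hs; have a3 := S.ef hs
  set Λ := Lam w p ε s with hΛ
  have hΛ0 : 0 ≤ Λ := S.Lam_nonneg hs hE
  have hΛE : Λ * (En w s + ε) = En p s := by rw [hΛ]; unfold Lam; field_simp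
  have dE := (S.derivE' hs).add_const ε
  have dD := S.derivD hs
  have dL : HasDerivAt (Lam w p ε) _ s := dD.div dE hE.ne'
  have dX := expdecay_deriv (2 * B ^ 2) 1 s
  simp only [one_mul] at dX
  have dQ : HasDerivAt (QQ B w p ε) _ s := (dL.const_add 1).mul dX
  refine ⟨_, dQ, ?_⟩
  set X := Real.exp (2 * B ^ 2 * Real.exp (-s)) with hX
  have hX1 : 1 ≤ X := by
    rw [hX]; apply Real.one_le_exp; positivity
  set Ee := En w s + ε with hEe
  have e1 : GI (fun y => r s y * gg p q s y) = GI (fun y => gg p q s y ^ 2) +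
      GI (fun y => ff p q r s y * gg p q s y) := by
    rw [← GI_add (by fun_prop) (by fun_prop)]
    exact GI_ext fun y => by unfold ff; ring
  have e2 : Res w p q ε s = GI (fun y => gg p q s y ^ 2) - 2 * Λ * En p s + Λ ^ 2 * En w s := by
    have : Res w p q ε s = GI (fun y => gg p q s y ^ 2 + ((2 * Λ) * (gg p q s y * w s y) +
        Λ ^ 2 * w s y ^ 2)) := GI_ext fun y => by rw [← hΛ]; ring
    rw [this, GI_add (by fun_prop) (by fun_prop), GI_add (by fun_prop) (by fun_prop), GI_cmul,
      GI_cmul, S.GI_gw hs]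
    unfold En; ring
  have e3 : -(2 * (GI (fun y => ff p q r s y * gg p q s y) + Λ * GI (fun y => ff p q r s y * w s y)))
      ≤ Res w p q ε s + GI (fun y => ff p q r s y ^ 2) := by
    have h1 : GI (fun y => ff p q r s y * gg p q s y) + Λ * GI (fun y => ff p q r s y * w s y)
       = GI (fun y => ff p q r s y * (gg p q s y + Λ * w s y)) := by
      rw [← GI_cmul, ← GI_add (by fun_prop) (by fun_prop)]
      exact GI_ext fun y => by ring
    have h2 : Res w p q ε s + GI (fun y => ff p q r s y ^ 2) =
      GI (fun y => (gg p q s y + Λ * w s y) ^ 2 + ff p q r s y ^ 2) := by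
      rw [GI_add (by fun_prop) (by fun_prop)]; rfl
    rw [h1, h2, ← GI_cmul, ← GI_neg]
    refine GI_mono (by fun_prop) (by fun_prop) fun y => ?_
    nlinarith [sq_nonneg (gg p q s y + Λ * w s y + ff p q r s y)]
  have e4 := S.f_sq hs
  have hP : 0 ≤ Res w p q ε s := GI_nonneg fun y => sq_nonneg _
  have hD : 0 ≤ En p s := En_nonneg _ _
  set P := Res w p q ε s
  set a := Real.exp (-s) with ha
  have ha0 : 0 < a := Real.exp_pos _
  have hnum : ∀ L' : ℝ, L' = (-(2 * GI fun y => r s y * gg p q s y) * Ee -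
      En p s * (-(2 * En p s) + 2 * GI fun y => ff p q r s y * w s y)) / Ee ^ 2 →
      L' ≤ -(P / Ee) + 2 * B ^ 2 * a * (1 + Λ) := by
    intro L' hL'
    have hL2 : L' * Ee = -(2 * GI fun y => r s y * gg p q s y) - Λ * (-(2 * En p s) +
        2 * GI fun y => ff p q r s y * w s y) := by
      rw [hL', ← hΛE]; field_simp
    have hL3 : L' * Ee ≤ -P + 2 * B ^ 2 * a * (1 + Λ) * Ee := by
      rw [hL2, e1]
      have h5 : Λ ^ 2 * En w s ≤ Λ * En p s := by
        rw [← hΛE]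
        have : 0 ≤ Λ ^ 2 * ε := by positivity
        rw [hEe]; linarith
      have h6 : 2 * B ^ 2 * a * (En w s + En p s) ≤ 2 * B ^ 2 * a * ((1 + Λ) * Ee) := by
        apply mul_le_mul_of_nonneg_left _ (by positivity)
        have : (1 + Λ) * Ee = Ee + Λ * Ee := by ring
        rw [this, hΛE, hEe]; linarith
      linarith
    have : -(P / Ee) + 2 * B ^ 2 * a * (1 + Λ) = (-P + 2 * B ^ 2 * a * (1 + Λ) * Ee) / Ee := by
      field_simp
    rw [this, le_div_iff₀ hE]; exact hL3
  have hfin := hnum _ rfl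
  have hPE : 0 ≤ P / Ee := div_nonneg hP hE.le
  set L' := (-(2 * GI fun y => r s y * gg p q s y) * Ee -
      En p s * (-(2 * En p s) + 2 * GI fun y => ff p q r s y * w s y)) / Ee ^ 2
  have : L' * X + (1 + Λ) * (X * (2 * B ^ 2 * (a * -1))) = X * (L' - 2 * B ^ 2 * a * (1 + Λ)) := by ring
  rw [this]
  have h7 : X * (L' - 2 * B ^ 2 * a * (1 + Λ)) ≤ X * (-(P / Ee)) :=
    mul_le_mul_of_nonneg_left (by linarith) (by linarith)
  nlinarith

end Sim
end
end

section
open Filter Topology MeasureTheory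
lemma mono_le {f : ℝ → ℝ} {a b : ℝ} (hab : a ≤ b)
    (h : ∀ x ∈ Icc a b, ∃ d, HasDerivAt f d x ∧ 0 ≤ d) : f a ≤ f b := by
  have := monotoneOn_of_deriv_nonneg (convex_Icc a b) (f := f)
    (fun x hx => by
      obtain ⟨d, hd, _⟩ := h x hx
      exact hd.continuousAt.continuousWithinAt)
    (fun x hx => by
      obtain ⟨d, hd, _⟩ := h x (interior_subset hx)
      exact hd.differentiableAt.differentiableWithinAt)
    (fun x hx => by
      obtain ⟨d, hd, h0⟩ := h x (interior_subset hx)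
      rw [hd.deriv]; exact h0)
  exact this (left_mem_Icc.mpr hab) (right_mem_Icc.mpr hab) hab

lemma anti_le {f : ℝ → ℝ} {a b : ℝ} (hab : a ≤ b)
    (h : ∀ x ∈ Icc a b, ∃ d, HasDerivAt f d x ∧ d ≤ 0) : f b ≤ f a := by
  have := mono_le (f := fun x => - f x) hab fun x hx => by
    obtain ⟨d, hd, h0⟩ := h x hx
    exact ⟨-d, hd.neg, by linarith⟩
  linarith

lemma exp_lower {f : ℝ → ℝ} {a b k : ℝ} (hab : a ≤ b)
    (h : ∀ x ∈ Icc a b, ∃ d, HasDerivAt f d x ∧ -k * f x ≤ d) :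
    f a * Real.exp (-k * (b - a)) ≤ f b := by
  have := mono_le (f := fun x => f x * Real.exp (k * (x - a))) hab fun x hx => by
    obtain ⟨d, hd, h0⟩ := h x hx
    have h2 : HasDerivAt (fun x => Real.exp (k * (x - a))) (Real.exp (k * (x - a)) * (k * 1)) x :=
      (((hasDerivAt_id x).sub_const a).const_mul k).exp
    refine ⟨_, hd.mul h2, ?_⟩
    have := Real.exp_pos (k * (x - a))
    nlinarith
  simp only [sub_self, mul_zero, Real.exp_zero, mul_one] at this
  have e : Real.exp (-k * (b - a)) = (Real.exp (k * (b - a)))⁻¹ := by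
    rw [← Real.exp_neg]; congr 1; ring
  rw [e, ← div_eq_mul_inv, div_le_iff₀ (Real.exp_pos _)]
  exact this

section
variable {s1 B C : ℝ} {w p q r : ℝ → ℝ → ℝ}

namespace Sim

lemma Q_anti (S : Sim s1 B C w p q r) {ε a b : ℝ} (ha : s1 < a) (hab : a ≤ b) (hε : 0 ≤ ε)
    (hE : ∀ x ∈ Icc a b, 0 < En w x + ε) : QQ B w p ε b ≤ QQ B w p ε a :=
  anti_le hab fun x hx => by
    obtain ⟨d, hd, h⟩ := S.derivQ (lt_of_lt_of_le ha hx.1) hε (hE x hx)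
    refine ⟨d, hd, h.trans (neg_nonpos.mpr (div_nonneg (GI_nonneg fun y => sq_nonneg _) (hE x hx).le))⟩

lemma freq_bound (S : Sim s1 B C w p q r) {a K : ℝ} (ha : s1 < a) (hK : En p a ≤ K * En w a)
    (hK0 : 0 ≤ K) {s : ℝ} (hs : a ≤ s) :
    En p s ≤ ((1 + K) * Real.exp (2 * B ^ 2 * Real.exp (-a))) * En w s := by
  have key : ∀ ε > 0, En p s ≤ ((1 + K) * Real.exp (2 * B ^ 2 * Real.exp (-a))) * (En w s + ε) := by
    intro ε hε
    have hpos : ∀ x, 0 < En w x + ε := fun x => by linarith [En_nonneg w x]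
    have h := S.Q_anti ha hs hε.le (fun x _ => hpos x)
    unfold QQ at h
    have h1 : Lam w p ε a ≤ K := by
      unfold Lam
      rw [div_le_iff₀ (hpos a)]
      nlinarith [En_nonneg w a]
    have h2 : 1 ≤ Real.exp (2 * B ^ 2 * Real.exp (-s)) := Real.one_le_exp (by positivity)
    have h3 : 0 ≤ Lam w p ε s := div_nonneg (En_nonneg _ _) (hpos s).le
    have h4 : Lam w p ε s ≤ (1 + K) * Real.exp (2 * B ^ 2 * Real.exp (-a)) := by
      have : (1 + Lam w p ε a) * Real.exp (2 * B ^ 2 * Real.exp (-a)) ≤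
        (1 + K) * Real.exp (2 * B ^ 2 * Real.exp (-a)) := by gcongr
      nlinarith
    unfold Lam at h4
    rwa [div_le_iff₀ (hpos s)] at h4
  set A := (1 + K) * Real.exp (2 * B ^ 2 * Real.exp (-a))
  have hA : 0 < A := by positivity
  refine le_of_forall_pos_le_add fun δ hδ => ?_
  have := key (δ / A) (by positivity)
  rw [mul_add, mul_div_cancel₀ _ hA.ne'] at this
  exact this

lemma E_lower (S : Sim s1 B C w p q r) {a b K : ℝ} (ha : s1 < a) (hab : a ≤ b)
    (hD : ∀ x ∈ Icc a b, En p x ≤ K * En w x) :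
    En w a * Real.exp (-(2 * K + B * Real.exp (-a / 2) * (3 + K)) * (b - a)) ≤ En w b := by
  refine exp_lower hab fun x hx => ⟨_, S.derivE' (lt_of_lt_of_le ha hx.1), ?_⟩
  have h1 := (abs_le.mp (S.fw_bd (lt_of_lt_of_le ha hx.1))).1
  have h2 := hD x hx
  have h3 : Real.exp (-x / 2) ≤ Real.exp (-a / 2) := Real.exp_le_exp.mpr (by linarith [hx.1])
  have h4 := En_nonneg w x
  have h5 := En_nonneg p x
  have h6 : B * Real.exp (-x / 2) * (3 * En w x + En p x) ≤
      B * Real.exp (-a / 2) * (3 * En w x + K * En w x) := by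
    have := S.B0
    gcongr
  linarith

lemma E_pos (S : Sim s1 B C w p q r) {a s : ℝ} (ha : s1 < a) (hE : 0 < En w a) (hs : a ≤ s) :
    0 < En w s := by
  have hK : En p a ≤ (En p a / En w a) * En w a := by rw [div_mul_cancel₀ _ hE.ne']
  have := S.E_lower ha hs (fun x hx => S.freq_bound ha hK (div_nonneg (En_nonneg _ _) hE.le) hx.1)
  exact lt_of_lt_of_le (mul_pos hE (Real.exp_pos _)) this

lemma E_le (S : Sim s1 B C w p q r) {a s : ℝ} (ha : s1 < a) (hs : a ≤ s) :
    En w s ≤ En w a * Real.exp (4 * B * Real.exp (-a / 2) + B ^ 2 / 2 * Real.exp (-a)) := by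
  have key := anti_le (f := fun x => En w x * (Real.exp (4 * B * Real.exp (-(1 / 2 * x))) *
    Real.exp (B ^ 2 / 2 * Real.exp (-(1 * x))))) hs fun x hx => by
      have hx1 := lt_of_lt_of_le ha hx.1
      refine ⟨_, (S.derivE' hx1).mul ((expdecay_deriv (4 * B) (1 / 2) x).mul
        (expdecay_deriv (B ^ 2 / 2) 1 x)), ?_⟩
      have h1 := S.fw_bd' hx1
      have e1 : -(1 / 2 * x) = -x / 2 := by ring
      rw [e1, one_mul]
      set X := Real.exp (4 * B * Real.exp (-x / 2))
      set Y := Real.exp (B ^ 2 / 2 * Real.exp (-x))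
      have hX : 0 < X * Y := mul_pos (Real.exp_pos _) (Real.exp_pos _)
      have : (-(2 * En p x) + 2 * GI fun y => ff p q r x y * w x y) * (X * Y) +
          En w x * (X * (4 * B * (Real.exp (-x / 2) * -(1 / 2))) * Y +
          X * (Y * (B ^ 2 / 2 * (Real.exp (-x) * -1)))) =
          (X * Y) * ((2 * GI fun y => ff p q r x y * w x y) - (2 * En p x +
          (2 * B * Real.exp (-x / 2) + B ^ 2 / 2 * Real.exp (-x)) * En w x)) := by ring
      refine le_trans (le_of_eq this) ?_
      exact mul_nonpos_of_nonneg_of_nonpos hX.le (by linarith)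
  have e : ∀ x : ℝ, Real.exp (4 * B * Real.exp (-(1 / 2 * x))) *
    Real.exp (B ^ 2 / 2 * Real.exp (-(1 * x))) =
      Real.exp (4 * B * Real.exp (-x / 2) + B ^ 2 / 2 * Real.exp (-x)) := by
    intro x
    rw [← Real.exp_add, one_mul]
    congr 5; ring
  simp only [e] at key
  refine le_trans ?_ key
  have hB := S.B0
  have : 1 ≤ Real.exp (4 * B * Real.exp (-s / 2) + B ^ 2 / 2 * Real.exp (-s)) :=
    Real.one_le_exp (by positivity)
  nlinarith [En_nonneg w s]

lemma res_small (S : Sim s1 B C w p q r) {a : ℝ} (ha : s1 < a) (hE : 0 < En w a) {η : ℝ}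
    (hη : 0 < η) : ∃ A, a ≤ A ∧ ∀ s, A ≤ s → ∃ ξ ∈ Ioo s (s + 1),
      Res w p q 0 ξ < η * En w ξ := by
  have hpos : ∀ s, a ≤ s → 0 < En w s + 0 := fun s hs => by simpa using S.E_pos ha hE hs
  have hanti : AntitoneOn (QQ B w p 0) (Ici a) := fun x hx y _ hxy =>
    S.Q_anti (lt_of_lt_of_le ha hx) hxy le_rfl fun z hz => hpos z (le_trans hx hz.1)
  have hnn : ∀ s, a ≤ s → 0 ≤ QQ B w p 0 s := fun s hs => by
    unfold QQ
    have : 0 ≤ Lam w p 0 s := div_nonneg (En_nonneg _ _) (hpos s hs).le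
    positivity
  obtain ⟨A, hA, hAi⟩ : ∃ A, a ≤ A ∧ QQ B w p 0 A < sInf (QQ B w p 0 '' Ici a) + η := by
    obtain ⟨_, ⟨A, hA, rfl⟩, h⟩ := exists_lt_of_csInf_lt (s := QQ B w p 0 '' Ici a)
      ⟨_, a, self_mem_Ici, rfl⟩ (lt_add_of_pos_right _ hη)
    exact ⟨A, hA, h⟩
  refine ⟨A, hA, fun s hs => ?_⟩
  have hbdd : BddBelow (QQ B w p 0 '' Ici a) := ⟨0, by rintro _ ⟨x, hx, rfl⟩; exact hnn x hx⟩
  have h1 : QQ B w p 0 s ≤ QQ B w p 0 A := hanti hA (hA.trans hs) hs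
  have h2 : sInf (QQ B w p 0 '' Ici a) ≤ QQ B w p 0 (s + 1) :=
    csInf_le hbdd ⟨s + 1, by simp only [mem_Ici]; linarith, rfl⟩
  have hd : ∀ x ∈ Icc s (s + 1), ∃ d, HasDerivAt (QQ B w p 0) d x ∧
      d ≤ - (Res w p q 0 x / (En w x + 0)) := fun x hx =>
    S.derivQ (by linarith [hx.1]) le_rfl (hpos x (by linarith [hx.1]))
  choose! d hd1 hd2 using hd
  obtain ⟨ξ, hξ, he⟩ := exists_hasDerivAt_eq_slope (QQ B w p 0) d (by linarith : s < s + 1)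
    (fun x hx => (hd1 x hx).continuousAt.continuousWithinAt)
    (fun x hx => hd1 x (Ioo_subset_Icc_self hx))
  refine ⟨ξ, hξ, ?_⟩
  have h3 := hd2 ξ (Ioo_subset_Icc_self hξ)
  rw [he, add_sub_cancel_left, div_one, add_zero] at h3
  have h4 := hpos ξ (by linarith [hξ.1])
  rw [add_zero] at h4
  have : Res w p q 0 ξ / En w ξ < η := by linarith
  rwa [div_lt_iff₀ h4] at this

end Sim
end
end

section
open Filter Topology MeasureTheory
/-- similarity transform -/
noncomputable def wS (v : ℝ → ℝ → ℝ) (t0 x0 s y : ℝ) : ℝ :=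
  v (t0 - Real.exp (-s)) (x0 + Real.exp (-s / 2) * y)
/-- first derivative -/
noncomputable def pS (vx : ℝ → ℝ → ℝ) (t0 x0 s y : ℝ) : ℝ :=
  Real.exp (-s / 2) * vx (t0 - Real.exp (-s)) (x0 + Real.exp (-s / 2) * y)
/-- second derivative -/
noncomputable def qS (vxx : ℝ → ℝ → ℝ) (t0 x0 s y : ℝ) : ℝ :=
  Real.exp (-s) * vxx (t0 - Real.exp (-s)) (x0 + Real.exp (-s / 2) * y)
/-- time derivative -/
noncomputable def rS (vt vx : ℝ → ℝ → ℝ) (t0 x0 s y : ℝ) : ℝ :=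
  Real.exp (-s) * vt (t0 - Real.exp (-s)) (x0 + Real.exp (-s / 2) * y)
   - 1 / 2 * Real.exp (-s / 2) * y * vx (t0 - Real.exp (-s)) (x0 + Real.exp (-s / 2) * y)

section
variable {T : ℝ} {a b v vx vxx vt : ℝ → ℝ → ℝ}

lemma cAt {g : ℝ → ℝ → ℝ} (h : ContinuousOn (fun p : ℝ × ℝ => g p.1 p.2) (Ioo 0 T ×ˢ (univ : Set ℝ)))
    {t : ℝ} (ht : t ∈ Ioo 0 T) (x : ℝ) : ContinuousAt (fun p : ℝ × ℝ => g p.1 p.2) (t, x) :=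
  h.continuousAt ((isOpen_Ioo.prod isOpen_univ).mem_nhds ⟨ht, mem_univ _⟩)

lemma Sol.fderiv (S : Sol T a b v vx vxx vt) {t : ℝ} (ht : t ∈ Ioo 0 T) (x : ℝ) :
    HasFDerivAt (fun p : ℝ × ℝ => v p.1 p.2)
      ((ContinuousLinearMap.toSpanSingleton ℝ (vt t x)).coprod
        (ContinuousLinearMap.toSpanSingleton ℝ (vx t x))) (t, x) := by
  have hop : ∀ᶠ z : ℝ × ℝ in 𝓝 (t, x), z.1 ∈ Ioo 0 T :=
    continuous_fst.continuousAt.eventually (isOpen_Ioo.mem_nhds ht)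
  have hcl : Continuous (fun c : ℝ => ContinuousLinearMap.toSpanSingleton ℝ c) := by
    exact (ContinuousLinearMap.toSpanSingletonLE ℝ ℝ ℝ).toLinearMap.continuous_of_finiteDimensional
  have := hasStrictFDerivAt_uncurry_coprod (𝕜 := ℝ) (u := (t, x)) (f := v)
    (f₁ := fun t x => ContinuousLinearMap.toSpanSingleton ℝ (vt t x))
    (f₂ := fun t x => ContinuousLinearMap.toSpanSingleton ℝ (vx t x))
    (by filter_upwards [hop] with z hz; exact (S.ht z.1 hz z.2).hasFDerivAt)
    (by filter_upwards [hop] with z hz; exact (S.hx z.1 hz z.2).hasFDerivAt)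
    (hcl.continuousAt.comp (cAt S.vtc ht x))
    (hcl.continuousAt.comp (cAt S.vxc ht x))
  exact this.hasFDerivAt

lemma tt_mem {t0 tl : ℝ} (h0 : 0 < tl) (h1 : tl < t0) {s : ℝ} (hs : -Real.log (t0 - tl) < s) :
    tl < t0 - Real.exp (-s) := by
  have : Real.exp (-s) < t0 - tl := by
    rw [← Real.exp_log (by linarith : 0 < t0 - tl)]
    exact Real.exp_lt_exp.mpr (by linarith)
  linarith

lemma sim_of_sol (S : Sol T a b v vx vxx vt) {t0 tl : ℝ} (h0 : 0 < tl) (h1 : tl < t0) (hT : t0 < T) :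
    ∃ B C, ∀ x0, Sim (-Real.log (t0 - tl)) B C (wS v t0 x0) (pS vx t0 x0) (qS vxx t0 x0)
      (rS vt vx t0 x0) := by
  obtain ⟨C1, hC1, b1⟩ := periodic_bdd h0 hT S.vper S.vc
  obtain ⟨C2, hC2, b2⟩ := periodic_bdd h0 hT S.vxper S.vxc
  obtain ⟨C3, hC3, b3⟩ := periodic_bdd h0 hT S.vxxper S.vxxc
  obtain ⟨C4, hC4, b4⟩ := periodic_bdd h0 hT S.vtper S.vtc
  obtain ⟨C5, hC5, b5⟩ := periodic_bdd h0 hT S.aper S.ac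
  obtain ⟨C6, hC6, b6⟩ := periodic_bdd h0 hT S.bper S.bc
  set M := C1 + C2 + C3 + C4 + C5 + C6 with hM
  set k := 1 + (t0 - tl) with hk
  have hk1 : 1 ≤ k := by linarith
  have hM0 : 0 < M := by positivity
  have hexp : ∀ s, -Real.log (t0 - tl) < s → Real.exp (-s) ≤ k ∧ Real.exp (-s / 2) ≤ k := by
    intro s hs
    have h2 := tt_mem h0 h1 hs
    have h3 : Real.exp (-s) ≤ k := by linarith
    refine ⟨h3, ?_⟩
    have h4 := exp_half_sq s
    have := Real.exp_pos (-s / 2)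
    nlinarith
  have hmem : ∀ s, -Real.log (t0 - tl) < s → t0 - Real.exp (-s) ∈ Icc tl t0 := fun s hs =>
    ⟨(tt_mem h0 h1 hs).le, by linarith [Real.exp_pos (-s)]⟩
  have hmem' : ∀ s, -Real.log (t0 - tl) < s → t0 - Real.exp (-s) ∈ Ioo 0 T := fun s hs =>
    ⟨h0.trans_le (hmem s hs).1, (hmem s hs).2.trans_lt hT⟩
  have hkM : M ≤ k * M := by nlinarith
  refine ⟨k * M, k * M, fun x0 => ?_⟩
  have hlin : ∀ s y : ℝ, HasDerivAt (fun y => x0 + Real.exp (-s / 2) * y) (Real.exp (-s / 2)) y := by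
    intro s y
    simpa using ((hasDerivAt_id y).const_mul (Real.exp (-s / 2))).const_add x0
  refine ⟨by positivity, by positivity, ?_, ?_, ?_, ?_, ?_, ?_, ?_, ?_, ?_, ?_, ?_, ?_⟩
  · intro s hs y
    have := (S.hx _ (hmem' s hs) (x0 + Real.exp (-s / 2) * y)).comp y (hlin s y)
    exact this.congr_deriv (by unfold pS; ring)
  · intro s hs y
    have := ((S.hxx _ (hmem' s hs) (x0 + Real.exp (-s / 2) * y)).comp y (hlin s y)).const_mul
      (Real.exp (-s / 2))
    refine this.congr_deriv ?_
    unfold qS; rw [← exp_half_sq]; ring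
  · intro s hs y
    have e1 : HasDerivAt (fun s => t0 - Real.exp (-s)) (Real.exp (-s)) s := by
      have := ((hasDerivAt_id s).neg.exp).const_sub t0
      exact this.congr_deriv (by simp)
    have e2 : HasDerivAt (fun s => x0 + Real.exp (-s / 2) * y) (-(1 / 2 * Real.exp (-s / 2) * y)) s := by
      have := ((((hasDerivAt_id s).neg.div_const 2).exp).mul_const y).const_add x0
      exact this.congr_deriv (by simp; ring)
    have e3 : HasDerivAt (fun s => ((t0 - Real.exp (-s), x0 + Real.exp (-s / 2) * y) : ℝ × ℝ))
      (Real.exp (-s), -(1 / 2 * Real.exp (-s / 2) * y)) s := e1.prodMk e2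
    have := (S.fderiv (hmem' s hs) (x0 + Real.exp (-s / 2) * y)).comp_hasDerivAt s e3
    refine this.congr_deriv ?_
    unfold rS
    simp [ContinuousLinearMap.toSpanSingleton_apply]
    ring
  · intro s hs
    unfold qS
    refine continuous_const.mul (continuous_iff_continuousAt.mpr fun y => ?_)
    exact (cAt S.vxxc (hmem' s hs) _).comp (f := fun y => ((t0 - Real.exp (-s),
      x0 + Real.exp (-s / 2) * y) : ℝ × ℝ)) (by fun_prop)
  · intro s hs
    unfold rS
    have c1 : Continuous fun y => vt (t0 - Real.exp (-s)) (x0 + Real.exp (-s / 2) * y) :=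
      continuous_iff_continuousAt.mpr fun y => (cAt S.vtc (hmem' s hs) _).comp
        (f := fun y => ((t0 - Real.exp (-s), x0 + Real.exp (-s / 2) * y) : ℝ × ℝ)) (by fun_prop)
    have c2 : Continuous fun y => vx (t0 - Real.exp (-s)) (x0 + Real.exp (-s / 2) * y) :=
      continuous_iff_continuousAt.mpr fun y => (cAt S.vxc (hmem' s hs) _).comp
        (f := fun y => ((t0 - Real.exp (-s), x0 + Real.exp (-s / 2) * y) : ℝ × ℝ)) (by fun_prop)
    exact (continuous_const.mul c1).sub ((continuous_const.mul continuous_id).mul c2)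
  · intro s hs y
    unfold pS
    have := (cAt S.vxc (hmem' s hs) _).comp (f := fun s => ((t0 - Real.exp (-s),
      x0 + Real.exp (-s / 2) * y) : ℝ × ℝ)) (x := s) (by fun_prop)
    exact ContinuousAt.mul (by fun_prop) this
  · intro s hs y
    unfold qS
    have := (cAt S.vxxc (hmem' s hs) _).comp (f := fun s => ((t0 - Real.exp (-s),
      x0 + Real.exp (-s / 2) * y) : ℝ × ℝ)) (x := s) (by fun_prop)
    exact ContinuousAt.mul (by fun_prop) this
  · intro s hs y
    exact (b1 _ (hmem s hs) _).trans (by linarith)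
  · intro s hs y
    unfold pS
    rw [abs_mul, abs_of_pos (Real.exp_pos _)]
    exact mul_le_mul (hexp s hs).2 ((b2 _ (hmem s hs) _).trans (by linarith)) (abs_nonneg _) (by linarith)
  · intro s hs y
    unfold qS
    rw [abs_mul, abs_of_pos (Real.exp_pos _)]
    exact mul_le_mul (hexp s hs).1 ((b3 _ (hmem s hs) _).trans (by linarith)) (abs_nonneg _) (by linarith)
  · intro s hs y
    unfold rS
    refine (abs_sub _ _).trans ?_
    rw [abs_mul, abs_mul, abs_mul, abs_mul, abs_of_pos (Real.exp_pos _), abs_of_pos (Real.exp_pos _),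
      abs_of_pos (by norm_num : (0:ℝ) < 1 / 2)]
    have g1 : Real.exp (-s) * |vt (t0 - Real.exp (-s)) (x0 + Real.exp (-s / 2) * y)| ≤ k * M :=
      mul_le_mul (hexp s hs).1 ((b4 _ (hmem s hs) _).trans (by linarith)) (abs_nonneg _) (by linarith)
    have g2 : Real.exp (-s / 2) * |vx (t0 - Real.exp (-s)) (x0 + Real.exp (-s / 2) * y)| ≤ k * M :=
      mul_le_mul (hexp s hs).2 ((b2 _ (hmem s hs) _).trans (by linarith)) (abs_nonneg _) (by linarith)
    have g3 := mul_le_mul_of_nonneg_left g2 (abs_nonneg y)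
    have : 0 ≤ |y| * (k * M) := by positivity
    nlinarith
  · intro s hs y
    unfold rS qS pS wS
    rw [S.eq _ (hmem' s hs)]
    have hh := exp_half_sq s
    have hle := (hexp s hs).2
    have ba := b5 _ (hmem s hs) (x0 + Real.exp (-s / 2) * y)
    have bb := b6 _ (hmem s hs) (x0 + Real.exp (-s / 2) * y)
    set V := v (t0 - Real.exp (-s)) (x0 + Real.exp (-s / 2) * y)
    set Vx := vx (t0 - Real.exp (-s)) (x0 + Real.exp (-s / 2) * y)
    set Vxx := vxx (t0 - Real.exp (-s)) (x0 + Real.exp (-s / 2) * y)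
    set A := a (t0 - Real.exp (-s)) (x0 + Real.exp (-s / 2) * y)
    set Bb := b (t0 - Real.exp (-s)) (x0 + Real.exp (-s / 2) * y)
    set e := Real.exp (-s / 2) with he
    have he0 : 0 < e := Real.exp_pos _
    have : Real.exp (-s) * (Vxx + A * Vx + Bb * V) - 1 / 2 * e * y * Vx -
        (Real.exp (-s) * Vxx - y / 2 * (e * Vx)) = e * (A * (e * Vx) + Bb * (e * V)) := by
      rw [← hh]; ring
    rw [this, abs_mul, abs_of_pos he0]
    have i1 : |A * (e * Vx)| ≤ k * M * |e * Vx| := by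
      rw [abs_mul A]
      exact mul_le_mul_of_nonneg_right (by linarith) (abs_nonneg _)
    have i2 : |Bb * (e * V)| ≤ k * M * |V| := by
      rw [abs_mul, abs_mul, abs_of_pos he0, ← mul_assoc]
      refine mul_le_mul_of_nonneg_right ?_ (abs_nonneg _)
      rw [mul_comm k M]
      exact mul_le_mul (by linarith) hle he0.le hM0.le
    calc e * |A * (e * Vx) + Bb * (e * V)| ≤ e * (k * M * |e * Vx| + k * M * |V|) :=
          mul_le_mul_of_nonneg_left ((abs_add_le _ _).trans (add_le_add i1 i2)) he0.le
      _ = _ := by ring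

end
end

section
open Filter Topology MeasureTheory
section
variable {T : ℝ} {a b v vx vxx vt : ℝ → ℝ → ℝ}

lemma tt_log {t0 t : ℝ} (h : t < t0) : t0 - Real.exp (-(-Real.log (t0 - t))) = t := by
  rw [neg_neg, Real.exp_log (by linarith)]; ring

lemma En_wS_pos {s1 B C : ℝ} {w p q r : ℝ → ℝ → ℝ} (S : Sim s1 B C w p q r) {s : ℝ} (hs : s1 < s)
    {y : ℝ} (hy : w s y ≠ 0) : 0 < En w s :=
  GI_pos (S.ew hs).sq (fun _ => sq_nonneg _) (y0 := y) (pow_ne_zero 2 hy)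

lemma wS_ne {t0 x0 s x : ℝ} (h : v (t0 - Real.exp (-s)) x ≠ 0) : ∃ y, wS v t0 x0 s y ≠ 0 := by
  refine ⟨(x - x0) / Real.exp (-s / 2), ?_⟩
  unfold wS
  rw [mul_div_cancel₀ _ (Real.exp_pos _).ne', add_sub_cancel]
  exact h

lemma nonvanish (S : Sol T a b v vx vxx vt) {t : ℝ} (ht : t ∈ Ioo 0 T) {x : ℝ} (hx : v t x ≠ 0)
    {t' : ℝ} (ht' : t' ∈ Ioo 0 T) : ∃ x, v t' x ≠ 0 := by
  by_contra hcon
  push Not at hcon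
  set t0 := (max t t' + T) / 2 with ht0
  set tl := min t t' / 2 with htl
  have hm : 0 < min t t' := lt_min ht.1 ht'.1
  have hM : max t t' < T := max_lt ht.2 ht'.2
  have e1 := min_le_left t t'; have e2 := min_le_right t t'
  have e3 := le_max_left t t'; have e4 := le_max_right t t'
  obtain ⟨B, C, hsim⟩ := sim_of_sol S (t0 := t0) (tl := tl) (by linarith) (by linarith) (by linarith)
  have R := hsim 0
  have f1 : -Real.log (t0 - tl) < -Real.log (t0 - t) := by
    apply neg_lt_neg; apply Real.log_lt_log <;> linarith
  have f2 : -Real.log (t0 - tl) < -Real.log (t0 - t') := by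
    apply neg_lt_neg; apply Real.log_lt_log <;> linarith
  have g1 : 0 < En (wS v t0 0) (-Real.log (t0 - t)) := by
    obtain ⟨y, hy⟩ := wS_ne (v := v) (t0 := t0) (x0 := 0) (s := -Real.log (t0 - t)) (x := x)
      (by rw [tt_log (by linarith)]; exact hx)
    exact En_wS_pos R f1 hy
  have g2 : En (wS v t0 0) (-Real.log (t0 - t')) = 0 := by
    unfold En
    have : ∀ y, wS v t0 0 (-Real.log (t0 - t')) y ^ 2 = 0 * 1 := fun y => by
      unfold wS; rw [tt_log (by linarith), hcon]; norm_num
    rw [GI_ext this, GI_cmul]; simp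
  rcases le_total t t' with h | h
  · have := R.E_pos f1 g1 (s := -Real.log (t0 - t'))
      (by apply neg_le_neg; apply Real.log_le_log <;> linarith)
    linarith
  · have := R.E_le f2 (s := -Real.log (t0 - t))
      (by apply neg_le_neg; apply Real.log_le_log <;> linarith)
    rw [g2, zero_mul] at this
    linarith
end
end

section
open Filter Topology MeasureTheory
/-- three alternating points in `(-b,b)` -/
def Trip (φ : ℝ → ℝ) (b : ℝ) : Prop :=
  ∃ p q r, -b < p ∧ p < q ∧ q < r ∧ r < b ∧ φ p * φ q < 0 ∧ φ q * φ r < 0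

lemma sign_aux {φ : ℝ → ℝ} {b : ℝ}
    (h : ∀ n p, -b < n → n < b → -b < p → p < b → φ n < 0 → 0 < φ p → p < n) :
    ∃ η, ∀ y, -b < y → y < b → 0 ≤ -1 * (y - η) * φ y := by
  by_cases hP : ∃ p, -b < p ∧ p < b ∧ 0 < φ p
  · obtain ⟨p0, hp0⟩ := hP
    set P := {p | -b < p ∧ p < b ∧ 0 < φ p} with hPd
    have hbdd : BddAbove P := ⟨b, fun p hp => hp.2.1.le⟩
    refine ⟨sSup P, fun y hy1 hy2 => ?_⟩
    rcases lt_trichotomy y (sSup P) with hlt | heq | hgt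
    · obtain ⟨p, hp, hyp⟩ := exists_lt_of_lt_csSup ⟨p0, hp0⟩ hlt
      have : 0 ≤ φ y := by
        by_contra hn
        push Not at hn
        have := h y p hy1 hy2 hp.1 hp.2.1 hn hp.2.2
        linarith
      nlinarith
    · rw [heq]; simp
    · have : φ y ≤ 0 := by
        by_contra hn
        push Not at hn
        have := le_csSup hbdd (show y ∈ P from ⟨hy1, hy2, hn⟩)
        linarith
      nlinarith
  · push Not at hP
    refine ⟨-b, fun y hy1 hy2 => ?_⟩
    have := hP y hy1 hy2
    nlinarith

lemma sign_struct {φ : ℝ → ℝ} {b : ℝ} (h : ¬ Trip φ b) :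
    ∃ σ η : ℝ, |σ| = 1 ∧ ∀ y, -b < y → y < b → 0 ≤ σ * (y - η) * φ y := by
  by_cases hA : ∀ n p, -b < n → n < b → -b < p → p < b → φ n < 0 → 0 < φ p → p < n
  · obtain ⟨η, h⟩ := sign_aux hA
    exact ⟨-1, η, by simp, h⟩
  · push Not at hA
    obtain ⟨n2, p2, a1, a2, a3, a4, a5, a6, a7⟩ := hA
    have hlt : n2 < p2 := lt_of_le_of_ne a7 (fun e => by rw [e] at a5; linarith)
    obtain ⟨η, h⟩ := sign_aux (φ := fun y => - φ y) (b := b) (fun n p h1 h2 h3 h4 h5 h6 => by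
      simp only [Left.neg_neg_iff, Left.neg_pos_iff] at h5 h6
      by_contra hn
      push Not at hn
      have hlt2 : n < p := lt_of_le_of_ne hn (fun e => by rw [e] at h5; linarith)
      -- phi n > 0, phi p < 0, n < p; phi n2 < 0 < phi p2, n2 < p2
      apply h
      rcases lt_or_ge n2 n with hc | hc
      · exact ⟨n2, n, p, a1, hc, hlt2, h4, by nlinarith, by nlinarith⟩
      · have hc' : n < n2 := lt_of_le_of_ne hc (fun e => by rw [e] at h5; linarith)
        exact ⟨n, n2, p2, h1, hc', hlt, a4, by nlinarith, by nlinarith⟩)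
    exact ⟨1, η, by simp, fun y h1 h2 => by have := h y h1 h2; linarith⟩

lemma sign3 (K : ℝ) (hK : 0 ≤ K) : ∃ κ c3 : ℝ, 0 < κ ∧ 0 < c3 ∧
    ∀ φ p : ℝ → ℝ, EG φ → EG p → (∀ y, HasDerivAt φ (p y) y) → 0 < GI (fun y => φ y ^ 2) →
    GI (fun y => p y ^ 2) ≤ K * GI (fun y => φ y ^ 2) → ∀ b, 0 < b → ¬ Trip φ b →
    κ * √(GI fun y => φ y ^ 2) ≤ |GI φ| + |GI fun y => y * φ y| + c3 / b ^ 2 * √(GI fun y => φ y ^ 2) := by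
  obtain ⟨L, ℓ, c, hL, hℓ, hℓ1, hc, H⟩ := lemmaJ K hK
  set G3 := √(GI fun y => (y ^ 2 * (1 + |y|)) ^ 2) with hG3
  have hG30 : 0 < G3 := Real.sqrt_pos.mpr (GI_pos (by fun_prop) (fun _ => sq_nonneg _) (y0 := 1) (by norm_num))
  set κ0 := (ℓ / 2) / (1 + L) with hκ0
  have hκ00 : 0 < κ0 := by positivity
  have hκ01 : κ0 ≤ 1 := by rw [hκ0, div_le_one (by positivity)]; linarith
  have hκL : κ0 * (1 + L) = ℓ / 2 := by rw [hκ0]; field_simp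
  refine ⟨Real.exp (-((L + 1) ^ 2) / 4) * (ℓ / 2 * (κ0 * c)), 2 * G3, by positivity, by positivity,
    fun φ p hφ hp d hE hD b hb hT => ?_⟩
  obtain ⟨y1, e, hy1, he, h1⟩ := H φ p hφ hp d hE hD
  obtain ⟨σ, η, hσ, hs⟩ := sign_struct hT
  set s := √(GI fun y => φ y ^ 2) with hsd
  have hs0 : 0 < s := Real.sqrt_pos.mpr hE
  have hy := abs_le.mp hy1
  have hη1 : 0 < 1 + |η| := by positivity
  -- upper bound
  have up : GI (fun y => |y - η| * |φ y|) ≤ (1 + |η|) * (|GI φ| + |GI fun y => y * φ y| +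
      (2 * G3) / b ^ 2 * s) := by
    have i1 : GI (fun y => |y - η| * |φ y|) ≤ GI (fun y => σ * (y * φ y - η * φ y) +
        (2 * (1 + |η|) / b ^ 2) * ((y ^ 2 * (1 + |y|)) * |φ y|)) := by
      refine GI_mono (by fun_prop) (by fun_prop) fun y => ?_
      have j0 : |y - η| ≤ (1 + |η|) * (1 + |y|) := by
        have := abs_sub y η
        nlinarith [abs_nonneg y, abs_nonneg η, mul_nonneg (abs_nonneg y) (abs_nonneg η)]
      have j1 : |σ * (y - η) * φ y| = |y - η| * |φ y| := by rw [abs_mul, abs_mul, hσ, one_mul]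
      have j2 : σ * (y * φ y - η * φ y) = σ * (y - η) * φ y := by ring
      rw [j2, ← j1]
      by_cases hyb : -b < y ∧ y < b
      · rw [abs_of_nonneg (hs y hyb.1 hyb.2)]
        have : 0 ≤ (2 * (1 + |η|) / b ^ 2) * ((y ^ 2 * (1 + |y|)) * |φ y|) := by positivity
        linarith
      · have j3 : b ^ 2 ≤ y ^ 2 := by
          rw [not_and_or, not_lt, not_lt] at hyb
          rcases hyb with h | h <;> nlinarith
        have j4 : (2 * (1 + |η|) / b ^ 2) * ((y ^ 2 * (1 + |y|)) * |φ y|)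
            = 2 * (y ^ 2 / b ^ 2) * (((1 + |η|) * (1 + |y|)) * |φ y|) := by field_simp
        have j5 : 1 ≤ y ^ 2 / b ^ 2 := by rw [le_div_iff₀ (by positivity)]; linarith
        have j6 : |σ * (y - η) * φ y| ≤ ((1 + |η|) * (1 + |y|)) * |φ y| := by
          rw [j1]; exact mul_le_mul_of_nonneg_right j0 (abs_nonneg _)
        have j7 := neg_abs_le (σ * (y - η) * φ y)
        have j8 : 0 ≤ ((1 + |η|) * (1 + |y|)) * |φ y| := by positivity
        rw [j4]
        have j9 : ((1 + |η|) * (1 + |y|)) * |φ y| ≤ (y ^ 2 / b ^ 2) * (((1 + |η|) * (1 + |y|)) * |φ y|) :=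
          le_mul_of_one_le_left j8 j5
        linarith
    have i2 : GI (fun y => σ * (y * φ y - η * φ y) +
        (2 * (1 + |η|) / b ^ 2) * ((y ^ 2 * (1 + |y|)) * |φ y|)) =
        σ * ((GI fun y => y * φ y) - η * GI φ) + (2 * (1 + |η|) / b ^ 2) *
          GI (fun y => (y ^ 2 * (1 + |y|)) * |φ y|) := by
      rw [GI_add (by fun_prop) (by fun_prop), GI_cmul, GI_cmul, GI_sub (by fun_prop) (by fun_prop), GI_cmul]
    have i3 : GI (fun y => (y ^ 2 * (1 + |y|)) * |φ y|) ≤ G3 * s := by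
      have := (le_abs_self _).trans (GI_cs_abs (f := fun y => y ^ 2 * (1 + |y|)) (g := fun y => |φ y|)
        (by fun_prop) (by fun_prop))
      simp only [sq_abs (φ _)] at this
      exact this
    have i4 : σ * ((GI fun y => y * φ y) - η * GI φ) ≤ (1 + |η|) * (|GI φ| + |GI fun y => y * φ y|) := by
      have k1 : σ * ((GI fun y => y * φ y) - η * GI φ) ≤ |(GI fun y => y * φ y) - η * GI φ| := by
        refine (le_abs_self _).trans ?_
        rw [abs_mul, hσ, one_mul]
      have k2 := abs_sub (GI fun y => y * φ y) (η * GI φ)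
      rw [abs_mul] at k2
      nlinarith [abs_nonneg η, abs_nonneg (GI φ), abs_nonneg (GI fun y => y * φ y),
        mul_nonneg (abs_nonneg η) (abs_nonneg (GI fun y => y * φ y))]
    have i5 := mul_le_mul_of_nonneg_left i3 (by positivity : 0 ≤ 2 * (1 + |η|) / b ^ 2)
    have i6 : 2 * (1 + |η|) / b ^ 2 * (G3 * s) = (1 + |η|) * ((2 * G3) / b ^ 2 * s) := by ring
    rw [i2] at i1
    rw [i6] at i5
    linarith
  -- lower bound
  have low : ∃ α β, β = α + ℓ / 2 ∧ y1 - ℓ ≤ α ∧ β ≤ y1 + ℓ ∧ ∀ y ∈ Icc α β, κ0 * (1 + |η|) ≤ |y - η| := by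
    have hgen : ∀ y, ℓ / 2 + |y1 - η| ≤ |y - η| → κ0 * (1 + |η|) ≤ |y - η| := by
      intro y hy'
      have : |η| ≤ L + |y1 - η| := by
        have := abs_sub_abs_le_abs_sub η y1
        rw [abs_sub_comm η y1] at this; linarith
      have h2 : κ0 * |y1 - η| ≤ |y1 - η| := mul_le_of_le_one_left (abs_nonneg _) hκ01
      have h3 : κ0 * (1 + |η|) ≤ κ0 * (1 + L + |y1 - η|) := mul_le_mul_of_nonneg_left (by linarith) hκ00.le
      linarith
    rcases le_total η y1 with hle | hle
    · refine ⟨y1 + ℓ / 2, y1 + ℓ, by ring, by linarith, le_rfl, fun y hy' => hgen y ?_⟩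
      rw [abs_of_nonneg (by linarith), abs_of_nonneg (by linarith [hy'.1])]
      linarith [hy'.1]
    · refine ⟨y1 - ℓ, y1 - ℓ / 2, by ring, le_rfl, by linarith, fun y hy' => hgen y ?_⟩
      rw [abs_of_nonpos (by linarith), abs_of_nonpos (by linarith [hy'.2])]
      linarith [hy'.2]
  obtain ⟨α, β, hβ, hα1, hβ1, hlow⟩ := low
  have l1 := setint_le_GI (f := fun y => |y - η| * |φ y|) (by fun_prop) (fun y => by positivity)
    (L := L + 1) (a := α) (b := β) (by linarith) (by linarith) (by linarith)
  have hcφ := hφ.cont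
  have l2 : (ℓ / 2) * (κ0 * (1 + |η|) * (c * s)) ≤ ∫ y in α..β, |y - η| * |φ y| := by
    have : ∫ y in α..β, κ0 * (1 + |η|) * (c * s) = (ℓ / 2) * (κ0 * (1 + |η|) * (c * s)) := by
      rw [intervalIntegral.integral_const, hβ, smul_eq_mul]; ring
    rw [← this]
    apply intervalIntegral.integral_mono_on (by linarith) (by simp)
      (Continuous.intervalIntegrable (by fun_prop) _ _)
    intro y hy'
    have m1 := hlow y hy'
    have m2 : c * s ≤ |φ y| := by
      refine (h1 y (abs_le.mpr ⟨by linarith [hy'.1], by linarith [hy'.2]⟩)).trans ?_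
      refine (le_abs_self _).trans ?_
      rw [abs_mul, he, one_mul]
    exact mul_le_mul m1 m2 (by positivity) (abs_nonneg _)
  have l3 := mul_le_mul_of_nonneg_left l2 (Real.exp_pos (-((L + 1) ^ 2) / 4)).le
  have l4 : (1 + |η|) * (Real.exp (-((L + 1) ^ 2) / 4) * (ℓ / 2 * (κ0 * c)) * s) ≤
      (1 + |η|) * (|GI φ| + |GI fun y => y * φ y| + (2 * G3) / b ^ 2 * s) := by
    refine le_trans (le_of_eq ?_) (l3.trans (l1.trans up))
    ring
  exact le_of_mul_le_mul_left l4 hη1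
end

section
open Filter Topology MeasureTheory
lemma tend_exp_neg (k : ℝ) (hk : 0 < k) (c : ℝ) : Tendsto (fun s => c * Real.exp (-(k * s))) atTop (𝓝 0) := by
  have h1 : Tendsto (fun s : ℝ => -(k * s)) atTop atBot :=
    tendsto_neg_atTop_atBot.comp (tendsto_id.const_mul_atTop hk)
  simpa using (Real.tendsto_exp_atBot.comp h1).const_mul c

lemma ev_ge {P : ℝ → Prop} (h : ∀ᶠ s in atTop, P s) (a : ℝ) : ∃ A, a ≤ A ∧ ∀ s, A ≤ s → P s := by
  obtain ⟨A, hA⟩ := eventually_atTop.mp h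
  exact ⟨max a A, le_max_left _ _, fun s hs => hA s ((le_max_right _ _).trans hs)⟩

namespace Sim
variable {s1 B C : ℝ} {w p q r : ℝ → ℝ → ℝ}

lemma E_quad (S : Sim s1 B C w p q r) {A : ℝ}
    (hq : ∀ s, s1 < s → ∀ y, |w s y| ≤ A * Real.exp (-s) * (1 + y ^ 2)) {s : ℝ} (hs : s1 < s) :
    En w s ≤ A ^ 2 * Real.exp (-s) ^ 2 * GI (fun y => (1 + y ^ 2) ^ 2) := by
  have a1 := S.ew hs
  unfold En
  rw [← GI_cmul]
  refine GI_mono (by fun_prop) (by fun_prop) fun y => ?_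
  rw [← sq_abs (w s y)]
  calc |w s y| ^ 2 ≤ (A * Real.exp (-s) * (1 + y ^ 2)) ^ 2 := pow_le_pow_left₀ (abs_nonneg _) (hq s hs y) 2
    _ = _ := by ring

lemma lam_large (S : Sim s1 B C w p q r) {a A : ℝ} (ha : s1 < a) (hE : 0 < En w a)
    (hq : ∀ s, s1 < s → ∀ y, |w s y| ≤ A * Real.exp (-s) * (1 + y ^ 2)) :
    ∃ A0, a ≤ A0 ∧ ∀ s, A0 ≤ s → 0.7 * En w s ≤ En p s := by
  have h1 : ∀ᶠ s in atTop, Real.exp (2 * B ^ 2 * Real.exp (-(1 * s))) < 1.02 := by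
    have := (Real.continuous_exp.tendsto 0).comp (tend_exp_neg 1 one_pos (2 * B ^ 2))
    rw [Real.exp_zero] at this
    exact this.eventually (gt_mem_nhds (by norm_num))
  have h2 : ∀ᶠ s in atTop, B * Real.exp (-(1 / 2 * s)) < 0.02 :=
    (tend_exp_neg (1 / 2) (by norm_num) B).eventually (gt_mem_nhds (by norm_num))
  obtain ⟨A0, hA0, H⟩ := ev_ge (h1.and h2) a
  refine ⟨A0, hA0, fun a' ha' => ?_⟩
  by_contra hcon
  push Not at hcon
  have haa : a ≤ a' := hA0.trans ha'
  have ha1 : s1 < a' := ha.trans_le haa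
  obtain ⟨H1, H2⟩ := H a' ha'
  rw [one_mul] at H1
  have e2 : -(1 / 2 * a') = -a' / 2 := by ring
  rw [e2] at H2
  have Ep : ∀ s, a ≤ s → 0 < En w s := fun s hs => S.E_pos ha hE hs
  have Ea := Ep a' haa
  have hD : ∀ x, a' ≤ x → En p x ≤ 0.75 * En w x := by
    intro x hx
    have Ex := Ep x (haa.trans hx)
    have hQ := S.Q_anti ha1 hx le_rfl (ε := 0) (fun z hz => by simpa using Ep z (haa.trans hz.1))
    unfold QQ Lam at hQ
    rw [add_zero, add_zero] at hQ
    have hl : En p a' / En w a' < 0.7 := by rw [div_lt_iff₀ Ea]; exact hcon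
    have hl0 : 0 ≤ En p x / En w x := div_nonneg (En_nonneg _ _) Ex.le
    have hl0' : 0 ≤ En p a' / En w a' := div_nonneg (En_nonneg _ _) Ea.le
    have hexp : 1 ≤ Real.exp (2 * B ^ 2 * Real.exp (-x)) := Real.one_le_exp (by positivity)
    have : En p x / En w x ≤ 0.75 := by
      have i1 : (1 + En p x / En w x) ≤ (1 + En p x / En w x) * Real.exp (2 * B ^ 2 * Real.exp (-x)) :=
        le_mul_of_one_le_right (by linarith) hexp
      have i2 : (1 + En p a' / En w a') * Real.exp (2 * B ^ 2 * Real.exp (-a')) ≤ 1.7 * 1.02 :=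
        mul_le_mul (by linarith) H1.le (Real.exp_pos _).le (by norm_num)
      linarith
    rwa [div_le_iff₀ Ex] at this
  have hlow : ∀ b, a' ≤ b → En w a' * Real.exp (-(1.6 * (b - a'))) ≤ En w b := by
    intro b hb
    refine le_trans ?_ (S.E_lower ha1 hb (K := 0.75) fun x hx => hD x hx.1)
    refine mul_le_mul_of_nonneg_left (Real.exp_le_exp.mpr ?_) Ea.le
    have : 0 ≤ (b - a') * (0.1 - B * Real.exp (-a' / 2) * (3 + 0.75)) :=
      mul_nonneg (by linarith) (by linarith)
    linarith
  have hup : ∀ b, a' ≤ b → En w a' * Real.exp (1.6 * a') ≤ (A ^ 2 * GI (fun y => (1 + y ^ 2) ^ 2)) * Real.exp (-(0.4 * b)) := by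
    intro b hb
    have h := (hlow b hb).trans (S.E_quad hq (ha1.trans_le hb))
    have e : Real.exp (-(1.6 * (b - a'))) = Real.exp (1.6 * a') * Real.exp (-(1.6 * b)) := by
      rw [← Real.exp_add]; congr 1; ring
    have e' : Real.exp (-b) ^ 2 = Real.exp (-(0.4 * b)) * Real.exp (-(1.6 * b)) := by
      rw [← Real.exp_nat_mul, ← Real.exp_add]; congr 1; push_cast; ring
    rw [e, e'] at h
    refine le_of_mul_le_mul_right (a := Real.exp (-(1.6 * b))) ?_ (Real.exp_pos _)
    linarith
  have hpos : 0 < En w a' * Real.exp (1.6 * a') := by positivity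
  obtain ⟨b, hb, hb'⟩ := ev_ge ((tend_exp_neg 0.4 (by norm_num) (A ^ 2 * GI (fun y => (1 + y ^ 2) ^ 2))).eventually (gt_mem_nhds hpos)) a'
  exact absurd (hup b hb) (not_le.mpr (hb' b le_rfl))

lemma GI_gg (S : Sim s1 B C w p q r) {s : ℝ} (hs : s1 < s) : GI (gg p q s) = 0 := by
  have := GI_ibp (S.ep hs) (S.eq' hs) (EG.const 1) (EG.const 0) (S.dp s hs) (fun y => hasDerivAt_const y 1)
  have e : GI (fun y => p s y * 0) = 0 := by simp [GI]
  rw [e, neg_zero] at this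
  rw [← this]
  exact GI_ext fun y => by unfold gg; ring

lemma GI_ggy (S : Sim s1 B C w p q r) {s : ℝ} (hs : s1 < s) :
    GI (fun y => gg p q s y * y) = - (1 / 2 * GI (fun y => y * w s y)) := by
  have h1 := GI_ibp (S.ep hs) (S.eq' hs) EG.id (EG.const 1) (S.dp s hs) (fun y => hasDerivAt_id y)
  have h2 := GI_ibp (S.ew hs) (S.ep hs) (EG.const 1) (EG.const 0) (S.dw s hs) (fun y => hasDerivAt_const y 1)
  have e : GI (fun y => w s y * 0) = 0 := by simp [GI]
  rw [e, neg_zero] at h2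
  have a1 := S.ew hs; have a2 := S.ep hs
  have h3 : GI (fun y => p s y * 1) = 1 / 2 * GI (fun y => y * w s y) := by
    rw [← GI_cmul]
    have : GI (fun y => (p s y - y / 2 * w s y) * 1) = GI (fun y => p s y * 1) - GI (fun y => 1 / 2 * (y * w s y)) := by
      rw [← GI_sub (by fun_prop) (by fun_prop)]
      exact GI_ext fun y => by ring
    linarith
  rw [← h3, ← h1]; rfl

lemma moments (S : Sim s1 B C w p q r) {s : ℝ} (hs : s1 < s) (hE : 0 < En w s)
    (hl : 0.7 * En w s ≤ En p s) :
    |GI (w s)| ≤ 5 * √(Res w p q 0 s) * √G0 ∧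
    |GI (fun y => y * w s y)| ≤ 5 * √(Res w p q 0 s) * √(GI fun y => y ^ 2) := by
  have a1 := S.ew hs; have a2 := S.eg hs
  set Λ := Lam w p 0 s with hΛ
  have hΛ7 : 0.7 ≤ Λ := by rw [hΛ, Lam, add_zero, le_div_iff₀ hE]; exact hl
  have ek : EG (fun y => gg p q s y + Λ * w s y) := by fun_prop
  have c0 := GI_cs_abs ek (EG.const 1)
  have c1 := GI_cs_abs ek EG.id
  have e0 : GI (fun y => (gg p q s y + Λ * w s y) * 1) = Λ * GI (w s) := by
    have : GI (fun y => gg p q s y + Λ * w s y) = GI (gg p q s) + GI (fun y => Λ * w s y) :=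
      GI_add a2 (by fun_prop)
    rw [S.GI_gg hs, GI_cmul, zero_add] at this
    rw [← this]; exact GI_ext fun y => by ring
  have e1 : GI (fun y => (gg p q s y + Λ * w s y) * y) = (Λ - 1 / 2) * GI (fun y => y * w s y) := by
    have : GI (fun y => gg p q s y * y + Λ * (y * w s y)) = GI (fun y => gg p q s y * y) + GI (fun y => Λ * (y * w s y)) :=
      GI_add (by fun_prop) (by fun_prop)
    rw [S.GI_ggy hs, GI_cmul] at this
    have e : GI (fun y => (gg p q s y + Λ * w s y) * y) = GI (fun y => gg p q s y * y + Λ * (y * w s y)) :=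
      GI_ext fun y => by ring
    rw [e, this]; ring
  rw [e0, abs_mul, abs_of_pos (by linarith)] at c0
  rw [e1, abs_mul, abs_of_pos (by linarith)] at c1
  have g0 : GI (fun _ => (1:ℝ) ^ 2) = G0 := by unfold G0; exact GI_ext fun _ => by norm_num
  rw [g0] at c0
  have r0 : GI (fun y => (gg p q s y + Λ * w s y) ^ 2) = Res w p q 0 s := rfl
  rw [r0] at c0 c1
  have n0 := abs_nonneg (GI (w s))
  have n1 := abs_nonneg (GI (fun y => y * w s y))
  constructor
  · have : 0.2 * |GI (w s)| ≤ Λ * |GI (w s)| := mul_le_mul_of_nonneg_right (by linarith) n0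
    linarith
  · have : 0.2 * |GI (fun y => y * w s y)| ≤ (Λ - 1 / 2) * |GI (fun y => y * w s y)| :=
      mul_le_mul_of_nonneg_right (by linarith) n1
    linarith

lemma three_alt (S : Sim s1 B C w p q r) {a A : ℝ} (ha : s1 < a) (hE : 0 < En w a)
    (hq : ∀ s, s1 < s → ∀ y, |w s y| ≤ A * Real.exp (-s) * (1 + y ^ 2)) {ε : ℝ} (hε : 0 < ε) (A0 : ℝ) :
    ∃ s, A0 < s ∧ a < s ∧ Trip (w s) (ε * Real.exp (s / 2)) := by
  obtain ⟨A1, hA1, hlam⟩ := S.lam_large ha hE hq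
  set K0 := En p a / En w a with hK0
  have hK0' : 0 ≤ K0 := div_nonneg (En_nonneg _ _) hE.le
  set K := (1 + K0) * Real.exp (2 * B ^ 2 * Real.exp (-a)) with hK
  have hK' : 0 ≤ K := by positivity
  have hfr : ∀ s, a ≤ s → En p s ≤ K * En w s := fun s hs =>
    S.freq_bound ha (by rw [hK0, div_mul_cancel₀ _ hE.ne']) hK0' hs
  obtain ⟨κ, c3, hκ, hc3, H⟩ := sign3 K hK'
  set G := 5 * √G0 + 5 * √(GI fun y => y ^ 2) + 1 with hG
  have hGp : 0 < G := by positivity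
  obtain ⟨A2, hA2, hres⟩ := S.res_small ha hE (η := (κ / (2 * G)) ^ 2) (by positivity)
  have h3 : ∀ᶠ s in atTop, c3 / ε ^ 2 * Real.exp (-(1 * s)) < κ / 2 :=
    (tend_exp_neg 1 one_pos _).eventually (gt_mem_nhds (by positivity))
  obtain ⟨A3, hA3, h3⟩ := ev_ge h3 (max A0 (max A1 A2))
  obtain ⟨ξ, hξ, hR⟩ := hres A3 ((le_max_right _ _).trans ((le_max_right _ _).trans hA3))
  have hξ3 : A3 ≤ ξ := hξ.1.le
  have hξ1 : A1 ≤ ξ := ((le_max_left _ _).trans ((le_max_right _ _).trans hA3)).trans hξ3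
  refine ⟨ξ, ((le_max_left _ _).trans hA3).trans_lt hξ.1, ?_, ?_⟩
  · exact (hA1.trans ((le_max_left _ _).trans ((le_max_right _ _).trans hA3))).trans_lt hξ.1
  by_contra hT
  have haξ : a ≤ ξ := hA1.trans hξ1
  have hsξ : s1 < ξ := ha.trans_le haξ
  have Eξ := S.E_pos ha hE haξ
  have h := H (w ξ) (p ξ) (S.ew hsξ) (S.ep hsξ) (S.dw ξ hsξ) Eξ (hfr ξ haξ) _ (by positivity) hT
  obtain ⟨m0, m1⟩ := S.moments hsξ Eξ (hlam ξ hξ1)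
  have hE' : GI (fun y => w ξ y ^ 2) = En w ξ := rfl
  rw [hE'] at h
  set e := √(En w ξ) with he
  have hep : 0 < e := Real.sqrt_pos.mpr Eξ
  have hR' : √(Res w p q 0 ξ) ≤ κ / (2 * G) * e := by
    rw [he, ← Real.sqrt_sq (by positivity : 0 ≤ κ / (2 * G)), ← Real.sqrt_mul (by positivity)]
    exact Real.sqrt_le_sqrt hR.le
  have hb : c3 / (ε * Real.exp (ξ / 2)) ^ 2 < κ / 2 := by
    have := h3 ξ hξ3
    have e1 : Real.exp (ξ / 2) ^ 2 = (Real.exp (-(1 * ξ)))⁻¹ := by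
      rw [← Real.exp_nat_mul, ← Real.exp_neg]; congr 1; push_cast; ring
    rw [mul_pow, e1]
    convert this using 1
    field_simp
  have hb' : c3 / (ε * Real.exp (ξ / 2)) ^ 2 * e < κ / 2 * e := mul_lt_mul_of_pos_right hb hep
  have hsum : 5 * √(Res w p q 0 ξ) * √G0 + 5 * √(Res w p q 0 ξ) * √(GI fun y => y ^ 2) ≤ κ / 2 * e := by
    have i1 : 5 * √(Res w p q 0 ξ) * √G0 + 5 * √(Res w p q 0 ξ) * √(GI fun y => y ^ 2) ≤ √(Res w p q 0 ξ) * G := by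
      have := Real.sqrt_nonneg (Res w p q 0 ξ)
      rw [hG]; linarith
    have i2 : √(Res w p q 0 ξ) * G ≤ κ / (2 * G) * e * G := mul_le_mul_of_nonneg_right hR' hGp.le
    have i3 : κ / (2 * G) * e * G = κ / 2 * e := by field_simp
    linarith
  linarith

end Sim
end

section
open Filter Topology MeasureTheory
section
variable {T : ℝ} {a b v vx vxx vt : ℝ → ℝ → ℝ}

lemma quad_decay (S : Sol T a b v vx vxx vt) {t0 tl x0 : ℝ} (h0 : 0 < tl) (h1 : tl < t0) (hT : t0 < T)
    (hv : v t0 x0 = 0) (hvx : vx t0 x0 = 0) :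
    ∃ A, ∀ s, -Real.log (t0 - tl) < s → ∀ y, |wS v t0 x0 s y| ≤ A * Real.exp (-s) * (1 + y ^ 2) := by
  obtain ⟨C3, hC3, b3⟩ := periodic_bdd h0 hT S.vxxper S.vxxc
  obtain ⟨C4, hC4, b4⟩ := periodic_bdd h0 hT S.vtper S.vtc
  have ht0 : t0 ∈ Ioo 0 T := ⟨by linarith, hT⟩
  refine ⟨C3 + C4, fun s hs y => ?_⟩
  have hmem := tt_mem h0 h1 hs
  have hep := Real.exp_pos (-s)
  unfold wS
  set X := x0 + Real.exp (-s / 2) * y with hX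
  have i1 := taylor1 (f := fun t => v t X) (f' := fun t => vt t X) (x := t0) (y := t0 - Real.exp (-s)) (c := 0) (ω := C4)
    (fun z hz => by
      rw [uIcc_of_ge (by linarith)] at hz
      exact S.ht z ⟨by linarith [hz.1], by linarith [hz.2]⟩ X)
    (fun z hz => by
      rw [uIcc_of_ge (by linarith)] at hz
      rw [sub_zero]
      exact b4 z ⟨by linarith [hz.1], by linarith [hz.2]⟩ X)
  have i2 := taylor2 (f := v t0) (f' := vx t0) (f'' := vxx t0) (x := x0) (y := X) (c := 0) (ω := C3)
    (S.hx t0 ht0) (S.hxx t0 ht0) (fun z _ => by rw [sub_zero]; exact b3 t0 ⟨h1.le, le_rfl⟩ z)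
  rw [hv, hvx] at i2
  have e1 : X - x0 = Real.exp (-s / 2) * y := by rw [hX]; ring
  have e2 : |X - x0| ^ 2 = Real.exp (-s) * y ^ 2 := by rw [sq_abs, e1, mul_pow, exp_half_sq]
  have e3 : |t0 - Real.exp (-s) - t0| = Real.exp (-s) := by
    rw [show t0 - Real.exp (-s) - t0 = -Real.exp (-s) by ring, abs_neg, abs_of_pos hep]
  rw [e2] at i2
  rw [e3] at i1
  simp only [mul_zero, sub_zero] at i1 i2
  have i3 : |v (t0 - Real.exp (-s)) X| ≤ C4 * Real.exp (-s) + C3 * (Real.exp (-s) * y ^ 2) := by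
    have := abs_add_le (v (t0 - Real.exp (-s)) X - v t0 X) (v t0 X)
    rw [sub_add_cancel] at this
    linarith
  have : 0 ≤ C3 * Real.exp (-s) + C4 * Real.exp (-s) * y ^ 2 := by positivity
  linarith

lemma drop (S : Sol T a b v vx vxx vt) {t0 x0 : ℝ} (ht0 : t0 ∈ Ioo 0 T)
    (hnt : ∀ t ∈ Ioo 0 T, ∃ x, v t x ≠ 0)
    (hv : v t0 x0 = 0) (hvx : vx t0 x0 = 0) {ε : ℝ} (hε : 0 < ε) :
    ∃ t, t0 - ε < t ∧ 0 < t ∧ t < t0 ∧ ∃ p q r, x0 - ε < p ∧ p < q ∧ q < r ∧ r < x0 + ε ∧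
      v t p * v t q < 0 ∧ v t q * v t r < 0 := by
  set tl := t0 / 2 with htl
  have h0 : 0 < tl := by have := ht0.1; positivity
  have h1 : tl < t0 := by linarith
  obtain ⟨B, C, hsim⟩ := sim_of_sol S h0 h1 ht0.2
  obtain ⟨A, hA⟩ := quad_decay S h0 h1 ht0.2 hv hvx
  have R := hsim x0
  set a' := -Real.log (t0 - tl) + 1 with ha'
  have ha : -Real.log (t0 - tl) < a' := by linarith
  have hta := tt_mem h0 h1 ha
  obtain ⟨x, hx⟩ := hnt (t0 - Real.exp (-a')) ⟨by linarith, by linarith [Real.exp_pos (-a'), ht0.2]⟩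
  obtain ⟨y, hy⟩ := wS_ne (x0 := x0) hx
  obtain ⟨s, hs, has, p, q, r, hp, hpq, hqr, hr, s1, s2⟩ := R.three_alt ha (En_wS_pos R ha hy) hA hε (-Real.log ε)
  have hs1 : -Real.log (t0 - tl) < s := ha.trans has
  have hts := tt_mem h0 h1 hs1
  have hes := Real.exp_pos (-s)
  have hse : Real.exp (-s) < ε := by
    rw [← Real.exp_log hε]
    exact Real.exp_lt_exp.mpr (by linarith)
  have hk := Real.exp_pos (-s / 2)
  have hkk : Real.exp (-s / 2) * (ε * Real.exp (s / 2)) = ε := by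
    rw [mul_left_comm, ← Real.exp_add]; simp [show -s / 2 + s / 2 = 0 by ring]
  refine ⟨t0 - Real.exp (-s), by linarith, by linarith, by linarith, x0 + Real.exp (-s / 2) * p,
    x0 + Real.exp (-s / 2) * q, x0 + Real.exp (-s / 2) * r, ?_, ?_, ?_, ?_, s1, s2⟩
  · have := mul_lt_mul_of_pos_left hp hk; linarith
  · have := mul_lt_mul_of_pos_left hpq hk; linarith
  · have := mul_lt_mul_of_pos_left hqr hk; linarith
  · have := mul_lt_mul_of_pos_left hr hk; linarith
end
end

section
open Filter Topology MeasureTheory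
lemma GI_psi_shift (φ : ℝ → ℝ) (c : ℝ) : GI (fun y => φ y * psi c y) = GI (fun y => φ (y + c)) := by
  unfold GI
  rw [← integral_add_right_eq_self (fun y => φ y * psi c y * gam y) c]
  congr 1; ext y
  rw [mul_assoc, psi_gam, add_sub_cancel_right]

lemma GI_psi_sq (c : ℝ) : GI (fun y => psi c y ^ 2) = Real.exp (c ^ 2 / 2) * G0 := by
  have e : ∀ y, psi c y ^ 2 = Real.exp (c ^ 2 / 2) * ((fun _ => (1:ℝ)) y * psi (2 * c) y) := by
    intro y
    unfold psi
    rw [one_mul, ← Real.exp_nat_mul, ← Real.exp_add]; congr 1; push_cast; ring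
  rw [GI_ext e, GI_cmul, GI_psi_shift]; rfl

lemma psi_deriv (c y : ℝ) : HasDerivAt (psi c) (c / 2 * psi c y) y := by
  have h : HasDerivAt (fun y : ℝ => c * y / 2 - c ^ 2 / 4) (c / 2) y := by
    exact ((((hasDerivAt_id y).const_mul c).div_const 2).sub_const _).congr_deriv (by simp)
  exact h.exp.congr_deriv (by unfold psi; ring)

lemma Phi_deriv {φ p : ℝ → ℝ} {C : ℝ} (hp : Continuous p) (d : ∀ y, HasDerivAt φ (p y) y)
    (bφ : ∀ y, |φ y| ≤ C) (bp : ∀ y, |p y| ≤ C) (c : ℝ) :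
    HasDerivAt (fun c => GI (fun y => φ y * psi c y)) (GI (fun y => p y * psi c y)) c := by
  have hφ : Continuous φ := continuous_iff_continuousAt.mpr fun y => (d y).continuousAt
  have e : (fun c => GI (fun y => φ y * psi c y)) = fun c => ∫ y, φ (y + c) * gam y := by
    ext c; rw [GI_psi_shift]; rfl
  rw [e, GI_psi_shift]
  have eφ : ∀ c, EG (fun y => φ (y + c)) := fun c => EG.of_bdd (by fun_prop) fun y => bφ (y + c)
  have ep : ∀ c, EG (fun y => p (y + c)) := fun c => EG.of_bdd (by fun_prop) fun y => bp (y + c)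
  exact (hasDerivAt_integral_of_dominated_loc_of_deriv_le (μ := volume)
    (F := fun c y => φ (y + c) * gam y) (F' := fun c y => p (y + c) * gam y)
    (x₀ := c) (s := univ) (bound := fun y => C * gam y) univ_mem
    (Eventually.of_forall fun c => (eφ c).int.aestronglyMeasurable) (eφ c).int
    (ep c).int.aestronglyMeasurable
    (Eventually.of_forall fun y c _ => by
      rw [Real.norm_eq_abs, abs_mul, abs_of_pos (gam_pos y)]
      exact mul_le_mul_of_nonneg_right (bp _) (gam_pos y).le)
    (EG.const C).int
    (Eventually.of_forall fun y c _ => by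
      refine HasDerivAt.mul_const ?_ _
      exact (HasDerivAt.comp_const_add y c (d (y + c))))).2

lemma Phi_ode {φ p q : ℝ → ℝ} (hφ : EG φ) (hp : EG p) (hq : EG q)
    (d' : ∀ y, HasDerivAt p (q y) y) (Λ c : ℝ) :
    GI (fun y => ((q y - y / 2 * p y) + Λ * φ y) * psi c y)
      = Λ * GI (fun y => φ y * psi c y) - c / 2 * GI (fun y => p y * psi c y) := by
  have h1 := GI_ibp hp hq (EG.psi c) ((EG.psi c).cmul (c / 2)) d' (psi_deriv c)
  have h2 : GI (fun y => p y * (c / 2 * psi c y)) = c / 2 * GI (fun y => p y * psi c y) := by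
    rw [← GI_cmul]; exact GI_ext fun y => by ring
  have h3 : GI (fun y => ((q y - y / 2 * p y) + Λ * φ y) * psi c y)
      = GI (fun y => (q y - y / 2 * p y) * psi c y) + GI (fun y => Λ * (φ y * psi c y)) := by
    rw [← GI_add (by fun_prop) (by fun_prop)]
    exact GI_ext fun y => by ring
  rw [h3, h1, h2, GI_cmul]; ring

lemma spread {φ p q : ℝ → ℝ} {C Λ K σ : ℝ} (hq : EG q)
    (d : ∀ y, HasDerivAt φ (p y) y) (d' : ∀ y, HasDerivAt p (q y) y)
    (bφ : ∀ y, |φ y| ≤ C) (bp : ∀ y, |p y| ≤ C) (hΛ : 0 ≤ Λ) (hΛK : Λ ≤ K) (hσ : σ ^ 2 = 1)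
    {u0 u : ℝ} (hu0 : u0 ∈ Icc (1:ℝ) 2) (hu : u ∈ Icc (1:ℝ) 2) :
    |GI (fun y => φ y * psi (σ * u) y)| ≤ (2:ℝ) ^ (2 * K) * (|GI (fun y => φ y * psi (σ * u0) y)| +
      2 * (√(GI fun y => ((q y - y / 2 * p y) + Λ * φ y) ^ 2) * √(Real.exp 2 * G0))) := by
  have hφc : Continuous φ := continuous_iff_continuousAt.mpr fun y => (d y).continuousAt
  have hpc : Continuous p := continuous_iff_continuousAt.mpr fun y => (d' y).continuousAt
  have eφ : EG φ := EG.of_bdd hφc bφ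
  have ep : EG p := EG.of_bdd hpc bp
  set Φ := fun c => GI (fun y => φ y * psi c y) with hΦ
  set R := √(GI fun y => ((q y - y / 2 * p y) + Λ * φ y) ^ 2) * √(Real.exp 2 * G0) with hR
  have hR0 : 0 ≤ R := by positivity
  have hρ : ∀ z ∈ Icc (1:ℝ) 2, |Λ * Φ (σ * z) - σ * z / 2 * GI (fun y => p y * psi (σ * z) y)| ≤ R := by
    intro z hz
    rw [← Phi_ode eφ ep hq d']
    refine (GI_cs_abs (by fun_prop) (EG.psi _)).trans ?_
    rw [hR, GI_psi_sq]
    refine mul_le_mul_of_nonneg_left (Real.sqrt_le_sqrt ?_) (Real.sqrt_nonneg _)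
    refine mul_le_mul_of_nonneg_right (Real.exp_le_exp.mpr ?_) G0_pos.le
    rw [mul_pow, hσ]; nlinarith [hz.1, hz.2]
  have hd : ∀ z ∈ Icc (1:ℝ) 2, HasDerivAt (fun z => z ^ (-(2 * Λ)) * Φ (σ * z))
      (-(2 * z ^ (-(2 * Λ) - 1) * (Λ * Φ (σ * z) - σ * z / 2 * GI (fun y => p y * psi (σ * z) y)))) z := by
    intro z hz
    have hz0 : 0 < z := by linarith [hz.1]
    have h1 := Real.hasDerivAt_rpow_const (x := z) (p := -(2 * Λ)) (Or.inl hz0.ne')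
    have h2 : HasDerivAt (fun z => Φ (σ * z)) (GI (fun y => p y * psi (σ * z) y) * σ) z := by
      have h3 : HasDerivAt (fun z : ℝ => σ * z) σ z := by
        exact ((hasDerivAt_id z).const_mul σ).congr_deriv (by simp)
      exact (Phi_deriv hpc d bφ bp (σ * z)).comp z h3
    refine (h1.mul h2).congr_deriv ?_
    have e : z ^ (-(2 * Λ)) = z ^ (-(2 * Λ) - 1) * z := by
      rw [← Real.rpow_add_one hz0.ne']; congr 1; ring
    rw [e]; ring
  have hb : ∀ z ∈ Icc (1:ℝ) 2, |(-(2 * z ^ (-(2 * Λ) - 1) * (Λ * Φ (σ * z) - σ * z / 2 * GI (fun y => p y * psi (σ * z) y)))) - 0| ≤ 2 * R := by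
    intro z hz
    have hz0 : 0 < z := by linarith [hz.1]
    have h1 : z ^ (-(2 * Λ) - 1) ≤ 1 := Real.rpow_le_one_of_one_le_of_nonpos hz.1 (by linarith)
    have h0 : 0 ≤ z ^ (-(2 * Λ) - 1) := Real.rpow_nonneg hz0.le _
    rw [sub_zero, abs_neg, abs_mul, abs_of_nonneg (by positivity)]
    exact mul_le_mul (by linarith) (hρ z hz) (abs_nonneg _) (by norm_num)
  have hsub : uIcc u0 u ⊆ Icc 1 2 := uIcc_subset_Icc hu0 hu
  have key := taylor1 (x := u0) (y := u) (fun z hz => hd z (hsub hz)) (fun z hz => hb z (hsub hz))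
  rw [mul_zero, sub_zero] at key
  have hdist : |u - u0| ≤ 1 := abs_le.mpr ⟨by linarith [hu.1, hu0.2], by linarith [hu.2, hu0.1]⟩
  have k2 : 2 * R * |u - u0| ≤ 2 * R := mul_le_of_le_one_right (by linarith) hdist
  have hu00 : 0 < u0 := by linarith [hu0.1]
  have hup : 0 < u := by linarith [hu.1]
  have k3 : |u0 ^ (-(2 * Λ)) * Φ (σ * u0)| ≤ |Φ (σ * u0)| := by
    rw [abs_mul, abs_of_nonneg (Real.rpow_nonneg hu00.le _)]
    exact mul_le_of_le_one_left (abs_nonneg _) (Real.rpow_le_one_of_one_le_of_nonpos hu0.1 (by linarith))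
  have k4 : u ^ (-(2 * Λ)) * |Φ (σ * u)| ≤ |Φ (σ * u0)| + 2 * R := by
    have e : u ^ (-(2 * Λ)) * |Φ (σ * u)| = |u ^ (-(2 * Λ)) * Φ (σ * u)| := by
      rw [abs_mul, abs_of_nonneg (Real.rpow_nonneg hup.le _)]
    have := abs_add_le (u ^ (-(2 * Λ)) * Φ (σ * u) - u0 ^ (-(2 * Λ)) * Φ (σ * u0)) (u0 ^ (-(2 * Λ)) * Φ (σ * u0))
    rw [sub_add_cancel] at this
    linarith
  have k5 : |Φ (σ * u)| = u ^ (2 * Λ) * (u ^ (-(2 * Λ)) * |Φ (σ * u)|) := by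
    rw [← mul_assoc, ← Real.rpow_add hup, add_neg_cancel, Real.rpow_zero, one_mul]
  have k6 : u ^ (2 * Λ) ≤ (2:ℝ) ^ (2 * K) :=
    (Real.rpow_le_rpow hup.le hu.2 (by linarith)).trans
      (Real.rpow_le_rpow_of_exponent_le (by norm_num) (by linarith))
  rw [k5]
  exact mul_le_mul k6 k4 (by have := Real.rpow_nonneg hup.le (-(2 * Λ)); positivity) (Real.rpow_nonneg (by norm_num) _)

/-- Energy comparison under bounded shift. -/
lemma shift_energy {φ p : ℝ → ℝ} {K : ℝ} (hK : 0 ≤ K) (hφ : EG φ) (hp : EG p) (d : ∀ y, HasDerivAt φ (p y) y)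
    (hb : GI (fun y => p y ^ 2) ≤ K * GI (fun y => φ y ^ 2)) {c : ℝ} (hc : |c| ≤ 2) :
    GI (fun y => φ y ^ 2) ≤ 2 * Real.exp (√(8 + 32 * K) + 1) * GI (fun y => φ y ^ 2 * psi (-c) y) := by
  set L := √(8 + 32 * K) with hL
  have hL0 : 0 < L := Real.sqrt_pos.mpr (by linarith)
  have hL2 : L ^ 2 = 8 + 32 * K := Real.sq_sqrt (by linarith)
  have ht := tight hφ hp d
  have pt : ∀ y, φ y ^ 2 - 1 / L ^ 2 * (y ^ 2 * φ y ^ 2) ≤ Real.exp (L + 1) * (φ y ^ 2 * psi (-c) y) := by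
    intro y
    have hn := sq_nonneg (φ y)
    rcases le_or_gt |y| L with h | h
    · have h1 : 1 ≤ Real.exp (L + 1) * psi (-c) y := by
        unfold psi
        rw [← Real.exp_add]
        apply Real.one_le_exp
        have : |c * y| ≤ 2 * L := by
          rw [abs_mul]; exact mul_le_mul hc h (abs_nonneg _) (by norm_num)
        have h2 := (abs_le.mp this).2
        have h3 : c ^ 2 ≤ 4 := by rw [← sq_abs]; nlinarith [abs_nonneg c]
        nlinarith
      have h4 : 0 ≤ 1 / L ^ 2 * (y ^ 2 * φ y ^ 2) := by positivity
      nlinarith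
    · have h1 : L ^ 2 ≤ y ^ 2 := by rw [← sq_abs y]; exact pow_le_pow_left₀ hL0.le h.le 2
      have h2 : φ y ^ 2 ≤ 1 / L ^ 2 * (y ^ 2 * φ y ^ 2) := by
        rw [one_div, inv_mul_eq_div, le_div_iff₀ (by positivity)]
        nlinarith
      have h3 : 0 ≤ Real.exp (L + 1) * (φ y ^ 2 * psi (-c) y) := by
        have : 0 < psi (-c) y := Real.exp_pos _
        positivity
      linarith
  have hm := GI_mono (by fun_prop) (by fun_prop) pt
  rw [GI_sub (by fun_prop) (by fun_prop), GI_cmul, GI_cmul] at hm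
  have h5 : 1 / L ^ 2 * GI (fun y => y ^ 2 * φ y ^ 2) ≤ GI (fun y => φ y ^ 2) / 2 := by
    rw [one_div, inv_mul_eq_div, div_le_iff₀ (by positivity), hL2]
    nlinarith
  linarith
end

section
open Filter Topology MeasureTheory
lemma Sim.M_bound {s1 B C : ℝ} {w p q r : ℝ → ℝ → ℝ} (S : Sim s1 B C w p q r) {a K : ℝ} (ha : s1 < a)
    (hK : 0 ≤ K) (hD : ∀ s, a ≤ s → En p s ≤ K * En w s)
    (hM : Tendsto (fun s => GI (w s)) atTop (𝓝 0)) {s : ℝ} (hs : a ≤ s) :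
    |GI (w s)| ≤ 2 * √(2 * B ^ 2 * (1 + K) * G0 *
      Real.exp (4 * B * Real.exp (-a / 2) + B ^ 2 / 2 * Real.exp (-a))) * Real.exp (-s / 2) * √(En w s) := by
  set L := Real.exp (4 * B * Real.exp (-a / 2) + B ^ 2 / 2 * Real.exp (-a)) with hL
  have hL0 : 0 < L := Real.exp_pos _
  have hG := G0_pos
  have hB := S.B0
  set N := √(2 * B ^ 2 * (1 + K) * G0 * L) * √(En w s) with hN
  have hN0 : 0 ≤ N := by positivity
  have hle : ∀ σ, s ≤ σ → En w σ ≤ En w s * L := by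
    intro σ hσ
    refine (S.E_le (ha.trans_le hs) hσ).trans (mul_le_mul_of_nonneg_left ?_ (En_nonneg _ _))
    apply Real.exp_le_exp.mpr
    have i1 : Real.exp (-s / 2) ≤ Real.exp (-a / 2) := Real.exp_le_exp.mpr (by linarith)
    have i2 : Real.exp (-s) ≤ Real.exp (-a) := Real.exp_le_exp.mpr (by linarith)
    gcongr
  have hr : ∀ σ, s ≤ σ → |GI (r σ)| ≤ N * Real.exp (-σ / 2) := by
    intro σ hσ
    have hσ1 : s1 < σ := ha.trans_le (hs.trans hσ)
    have e1 : GI (r σ) = GI (fun y => ff p q r σ y * 1) := by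
      have : GI (fun y => ff p q r σ y * 1) = GI (r σ) - GI (gg p q σ) := by
        rw [← GI_sub (S.er hσ1) (S.eg hσ1)]
        exact GI_ext fun y => by unfold ff; ring
      rw [this, S.GI_gg hσ1, sub_zero]
    rw [e1]
    refine (GI_cs_abs (S.ef hσ1) (EG.const 1)).trans ?_
    have g0 : GI (fun _ => (1:ℝ) ^ 2) = G0 := by unfold G0; exact GI_ext fun _ => by norm_num
    have hEs := En_nonneg w s
    rw [g0, hN, ← Real.sqrt_sq (Real.exp_pos (-σ / 2)).le, exp_half_sq, ← Real.sqrt_mul (GI_nonneg fun _ => sq_nonneg _),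
      ← Real.sqrt_mul (by positivity), ← Real.sqrt_mul (by positivity)]
    apply Real.sqrt_le_sqrt
    have h1 := S.f_sq hσ1
    have h2 := hD σ (hs.trans hσ)
    have h3 := hle σ hσ
    have h4 : En w σ + En p σ ≤ (1 + K) * (En w s * L) := by
      have : (1 + K) * En w σ ≤ (1 + K) * (En w s * L) := mul_le_mul_of_nonneg_left h3 (by linarith)
      linarith
    have h5 : 0 ≤ 2 * B ^ 2 * Real.exp (-σ) := by positivity
    calc _ ≤ (2 * B ^ 2 * Real.exp (-σ) * ((1 + K) * (En w s * L))) * G0 :=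
          mul_le_mul_of_nonneg_right (h1.trans (mul_le_mul_of_nonneg_left h4 h5)) hG.le
      _ = _ := by ring
  have he : ∀ x : ℝ, HasDerivAt (fun x => Real.exp (-x / 2)) (-(1 / 2) * Real.exp (-x / 2)) x := by
    intro x
    have h : HasDerivAt (fun x : ℝ => -x / 2) (-1 / 2) x := by
      simpa using ((hasDerivAt_id x).neg.div_const 2)
    exact h.exp.congr_deriv (by ring)
  have hbd : ∀ b, s ≤ b → |GI (w s)| ≤ |GI (w b)| + 2 * N * Real.exp (-s / 2) := by
    intro b hb
    have u1 := mono_le (f := fun x => GI (w x) - 2 * N * Real.exp (-x / 2)) hb fun x hx => by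
      have hx1 : s1 < x := ha.trans_le (hs.trans hx.1)
      refine ⟨_, (S.derivM hx1).sub ((he x).const_mul (2 * N)), ?_⟩
      have := (abs_le.mp (hr x hx.1)).1
      linarith
    have u2 := anti_le (f := fun x => GI (w x) + 2 * N * Real.exp (-x / 2)) hb fun x hx => by
      have hx1 : s1 < x := ha.trans_le (hs.trans hx.1)
      refine ⟨_, (S.derivM hx1).add ((he x).const_mul (2 * N)), ?_⟩
      have := (abs_le.mp (hr x hx.1)).2
      linarith
    have hnn : 0 ≤ 2 * N * Real.exp (-b / 2) := by positivity
    rw [abs_le]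
    have := neg_abs_le (GI (w b)); have := le_abs_self (GI (w b))
    constructor <;> linarith
  have hlim : Tendsto (fun b => |GI (w b)| + 2 * N * Real.exp (-s / 2)) atTop (𝓝 (0 + 2 * N * Real.exp (-s / 2))) := by
    have := hM.abs
    rw [abs_zero] at this
    exact this.add_const _
  have := ge_of_tendsto hlim (eventually_atTop.mpr ⟨s, fun b hb => hbd b hb⟩)
  rw [hN] at this
  linarith

section
variable {T : ℝ} {a b v vx vxx vt : ℝ → ℝ → ℝ}

lemma wS_shift (v : ℝ → ℝ → ℝ) (t0 x0 x1 s y : ℝ) :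
    wS v t0 x1 s y = wS v t0 x0 s (y + (x1 - x0) * Real.exp (s / 2)) := by
  unfold wS
  congr 1
  have : Real.exp (-s / 2) * Real.exp (s / 2) = 1 := by
    rw [← Real.exp_add]; simp [show -s / 2 + s / 2 = 0 by ring]
  linear_combination (x1 - x0) * (-this)

lemma M_tendsto (S : Sol T a b v vx vxx vt) {t0 x1 s1 B C : ℝ} (ht0 : t0 ∈ Ioo 0 T)
    (R : Sim s1 B C (wS v t0 x1) (pS vx t0 x1) (qS vxx t0 x1) (rS vt vx t0 x1))
    (hv : v t0 x1 = 0) : Tendsto (fun s => GI (wS v t0 x1 s)) atTop (𝓝 0) := by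
  have : (0:ℝ) = ∫ y : ℝ, (0:ℝ) := by simp
  rw [this]
  refine tendsto_integral_filter_of_dominated_convergence (fun y => C * gam y) ?_ ?_ (EG.const C).int ?_
  · filter_upwards [eventually_gt_atTop s1] with s hs
    exact (R.ew hs).int.aestronglyMeasurable
  · filter_upwards [eventually_gt_atTop s1] with s hs
    refine Eventually.of_forall fun y => ?_
    rw [Real.norm_eq_abs, abs_mul, abs_of_pos (gam_pos y)]
    exact mul_le_mul_of_nonneg_right (R.bw s hs y) (gam_pos y).le
  · refine Eventually.of_forall fun y => ?_
    have h1 : Tendsto (fun s : ℝ => t0 - Real.exp (-s)) atTop (𝓝 t0) := by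
      have := (tend_exp_neg 1 one_pos 1).const_sub t0
      simpa using this
    have h2 : Tendsto (fun s : ℝ => x1 + Real.exp (-s / 2) * y) atTop (𝓝 x1) := by
      have := ((tend_exp_neg (1 / 2) (by norm_num) 1).mul_const y).const_add x1
      simp only [one_mul, zero_mul, add_zero] at this
      refine this.congr fun s => ?_
      rw [show -(1 / 2 * s) = -s / 2 by ring]
    have hc := cAt S.vc ht0 x1
    have h3 := hc.tendsto.comp (h1.prodMk_nhds h2)
    simp only [hv] at h3
    have h4 := h3.mul_const (gam y)
    rw [zero_mul] at h4
    exact h4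

lemma freq_unif {t0 x0 s1 B C a' : ℝ} (ha : s1 < a')
    (R : ∀ x0, Sim s1 B C (wS v t0 x0) (pS vx t0 x0) (qS vxx t0 x0) (rS vt vx t0 x0))
    (hE : 0 < En (wS v t0 x0) a') :
    ∃ K δ, 0 ≤ K ∧ 0 < δ ∧ ∀ x1, |x1 - x0| < δ → 0 < En (wS v t0 x1) a' ∧
      ∀ s, a' ≤ s → En (pS vx t0 x1) s ≤ K * En (wS v t0 x1) s := by
  set E := En (wS v t0 x0) a' with hEd
  have hG := G0_pos
  have hC := (R x0).C0
  set D := 2 * C ^ 2 * Real.exp (a' / 2) * G0 + 1 with hDd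
  have hDp : 0 < D := by positivity
  set K0 := 2 * (C ^ 2 * G0) / E with hK0
  have hK0' : 0 ≤ K0 := by positivity
  refine ⟨(1 + K0) * Real.exp (2 * B ^ 2 * Real.exp (-a')), E / (2 * D), by positivity, by positivity, fun x1 hx1 => ?_⟩
  have e0 := (R x0).ew ha; have e1 := (R x1).ew ha
  have hdiff : E - En (wS v t0 x1) a' ≤ 2 * C ^ 2 * (|x1 - x0| * Real.exp (a' / 2)) * G0 := by
    have : E - En (wS v t0 x1) a' = GI (fun y => wS v t0 x0 a' y ^ 2 - wS v t0 x1 a' y ^ 2) := by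
      rw [GI_sub e0.sq e1.sq]; rfl
    rw [this, G0, ← GI_cmul]
    refine GI_mono (by fun_prop) (by fun_prop) fun y => ?_
    have b0 := (R x0).bw a' ha y
    have b1 := (R x1).bw a' ha y
    have hl : |wS v t0 x1 a' y - wS v t0 x0 a' y| ≤ C * (|x1 - x0| * Real.exp (a' / 2)) := by
      rw [wS_shift v t0 x0 x1]
      have := taylor1 (f := wS v t0 x0 a') (f' := pS vx t0 x0 a') (x := y) (y := y + (x1 - x0) * Real.exp (a' / 2))
        (c := 0) (ω := C) (fun z _ => (R x0).dw a' ha z) (fun z _ => by rw [sub_zero]; exact (R x0).bp a' ha z)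
      rwa [mul_zero, sub_zero, add_sub_cancel_left, abs_mul, abs_of_pos (Real.exp_pos _)] at this
    have h2 : wS v t0 x0 a' y ^ 2 - wS v t0 x1 a' y ^ 2 ≤ |wS v t0 x1 a' y - wS v t0 x0 a' y| * (|wS v t0 x0 a' y| + |wS v t0 x1 a' y|) := by
      rw [show wS v t0 x0 a' y ^ 2 - wS v t0 x1 a' y ^ 2 = -((wS v t0 x1 a' y - wS v t0 x0 a' y) * (wS v t0 x0 a' y + wS v t0 x1 a' y)) by ring]
      refine (neg_le_abs _).trans ?_
      rw [abs_mul]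
      exact mul_le_mul_of_nonneg_left (abs_add_le _ _) (abs_nonneg _)
    have h3 := mul_le_mul hl (add_le_add b0 b1) (by positivity) (by positivity)
    linarith
  have hhalf : E / 2 ≤ En (wS v t0 x1) a' := by
    have i1 : D * |x1 - x0| ≤ E / 2 := by
      have := mul_le_mul_of_nonneg_left hx1.le hDp.le
      rwa [show D * (E / (2 * D)) = E / 2 by field_simp] at this
    have i2 : 2 * C ^ 2 * (|x1 - x0| * Real.exp (a' / 2)) * G0 = (D - 1) * |x1 - x0| := by rw [hDd]; ring
    have := abs_nonneg (x1 - x0)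
    linarith
  refine ⟨by linarith, fun s hs => (R x1).freq_bound ha ?_ hK0' hs⟩
  have hp : En (pS vx t0 x1) a' ≤ C ^ 2 * G0 := by
    have e2 := (R x1).ep ha
    unfold En
    rw [G0, ← GI_cmul]
    refine GI_mono (by fun_prop) (by fun_prop) fun y => ?_
    rw [← sq_abs, mul_one]
    exact pow_le_pow_left₀ (abs_nonneg _) ((R x1).bp a' ha y) 2
  have : K0 * (E / 2) ≤ K0 * En (wS v t0 x1) a' := mul_le_mul_of_nonneg_left hhalf hK0'
  have e : K0 * (E / 2) = C ^ 2 * G0 := by rw [hK0]; field_simp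
  linarith
end
end

section
open Filter Topology MeasureTheory
section
variable {T : ℝ} {a b v vx vxx vt : ℝ → ℝ → ℝ}

lemma isolated (S : Sol T a b v vx vxx vt) {t0 : ℝ} (ht0 : t0 ∈ Ioo 0 T)
    (hnt : ∀ t ∈ Ioo 0 T, ∃ x, v t x ≠ 0) (x0 : ℝ) :
    ∃ δ > 0, ∀ x, x ≠ x0 → |x - x0| < δ → v t0 x ≠ 0 := by
  set tl := t0 / 2 with htl
  have h0 : 0 < tl := by have := ht0.1; positivity
  have h1 : tl < t0 := by linarith
  obtain ⟨B, C, R⟩ := sim_of_sol S h0 h1 ht0.2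
  set s1 := -Real.log (t0 - tl) with hs1
  set a' := s1 + 1 with ha'
  have ha : s1 < a' := by linarith
  have hta := tt_mem h0 h1 ha
  obtain ⟨x, hx⟩ := hnt (t0 - Real.exp (-a')) ⟨by linarith, by linarith [Real.exp_pos (-a'), ht0.2]⟩
  obtain ⟨y, hy⟩ := wS_ne (x0 := x0) hx
  have hE := En_wS_pos (R x0) ha hy
  obtain ⟨K, δ1, hK, hδ1, hfr⟩ := freq_unif ha R hE
  have hfr0 := (hfr x0 (by simpa using hδ1)).2
  obtain ⟨dp, hdp, Wp⟩ := lemmaW K hK (Icc_mem_nhds (show (1:ℝ) < 3 / 2 by norm_num) (show (3 / 2 : ℝ) < 2 by norm_num))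
  obtain ⟨dm, hdm, Wm⟩ := lemmaW K hK (Icc_mem_nhds (show (-2:ℝ) < -(3 / 2) by norm_num) (show (-(3 / 2) : ℝ) < -1 by norm_num))
  set δ := min dp dm with hδ
  have hδ0 : 0 < δ := lt_min hdp hdm
  set P := (2:ℝ) ^ (2 * K) with hP
  have hP0 : 0 < P := Real.rpow_pos_of_pos (by norm_num) _
  set Q := √(Real.exp 2 * G0) with hQ
  have hQ0 : 0 < Q := Real.sqrt_pos.mpr (mul_pos (Real.exp_pos _) G0_pos)
  set C1 := 2 * √(2 * B ^ 2 * (1 + K) * G0 *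
      Real.exp (4 * B * Real.exp (-a' / 2) + B ^ 2 / 2 * Real.exp (-a'))) with hC1
  have hC10 : 0 ≤ C1 := by positivity
  set C' := 2 * Real.exp (√(8 + 32 * K) + 1) with hC'
  have hC'0 : 0 < C' := by positivity
  obtain ⟨A2, hA2, hres⟩ := (R x0).res_small ha hE (η := (δ / (4 * P * Q)) ^ 2) (by positivity)
  obtain ⟨A3, hA3, hsm⟩ := ev_ge ((tend_exp_neg (1 / 2) (by norm_num) (P * C1 * √C')).eventually
    (gt_mem_nhds (show (0:ℝ) < δ / 2 by positivity))) A2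
  refine ⟨min δ1 (Real.exp (-A3 / 2)), lt_min hδ1 (Real.exp_pos _), fun x1 hx1 hxd hv => ?_⟩
  have hd0 : 0 < |x1 - x0| := abs_pos.mpr (sub_ne_zero.mpr hx1)
  have hdδ : |x1 - x0| < δ1 := hxd.trans_le (min_le_left _ _)
  have hdA : |x1 - x0| < Real.exp (-A3 / 2) := hxd.trans_le (min_le_right _ _)
  set s := -2 * Real.log |x1 - x0| with hs
  have hsd : |x1 - x0| = Real.exp (-s / 2) := by
    rw [hs, show -(-2 * Real.log |x1 - x0|) / 2 = Real.log |x1 - x0| by ring, Real.exp_log hd0]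
  have hsA : A3 ≤ s := by
    rw [hsd] at hdA
    have := Real.exp_lt_exp.mp hdA
    linarith
  obtain ⟨ξ, hξ, hR⟩ := hres s (hA3.trans hsA)
  have hAξ : A3 ≤ ξ := hsA.trans hξ.1.le
  have haξ : a' ≤ ξ := (hA2.trans hA3).trans hAξ
  have hsξ : s1 < ξ := ha.trans_le haξ
  have Eξ := (R x0).E_pos ha hE haξ
  set c := (x1 - x0) * Real.exp (ξ / 2) with hc
  have hcabs : |c| = Real.exp ((ξ - s) / 2) := by
    rw [hc, abs_mul, Real.abs_exp, hsd, ← Real.exp_add]; congr 1; ring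
  have hc1 : 1 ≤ |c| := by rw [hcabs]; exact Real.one_le_exp (by linarith [hξ.1])
  have hc2 : |c| ≤ 2 := by
    rw [hcabs]
    have h2 : Real.exp ((ξ - s) / 2) ≤ Real.exp (1 / 2) := Real.exp_le_exp.mpr (by linarith [hξ.2])
    have h3 : Real.exp (1 / 2) ^ 2 = Real.exp 1 := by
      rw [← Real.exp_nat_mul]; congr 1; norm_num
    have h4 := Real.exp_one_lt_d9
    have h5 := Real.exp_pos (1 / 2)
    nlinarith
  -- the shifted function
  have hsh : ∀ y, wS v t0 x1 ξ y = wS v t0 x0 ξ (y + c) := fun y => wS_shift v t0 x0 x1 ξ y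
  have hM := (R x1).M_bound ha hK (hfr x1 hdδ).2 (M_tendsto S ht0 (R x1) hv) haξ
  have hΦ0 : GI (fun y => wS v t0 x0 ξ y * psi c y) = GI (wS v t0 x1 ξ) := by
    rw [GI_psi_shift]; exact GI_ext fun y => (hsh y).symm
  have hEE : En (wS v t0 x1) ξ ≤ C' * En (wS v t0 x0) ξ := by
    have := shift_energy hK ((R x1).ew hsξ) ((R x1).ep hsξ) ((R x1).dw ξ hsξ) ((hfr x1 hdδ).2 ξ haξ) hc2
    rw [GI_psi_shift (fun y => wS v t0 x1 ξ y ^ 2)] at this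
    refine this.trans (le_of_eq ?_)
    rw [hC']
    congr 1
    unfold En
    exact GI_ext fun y => by rw [hsh, neg_add_cancel_right]
  set E := En (wS v t0 x0) ξ with hEd
  have hEs : 0 < √E := Real.sqrt_pos.mpr Eξ
  have hΛ0 : 0 ≤ Lam (wS v t0 x0) (pS vx t0 x0) 0 ξ := by
    unfold Lam; rw [add_zero]; exact div_nonneg (En_nonneg _ _) (En_nonneg _ _)
  have hΛK : Lam (wS v t0 x0) (pS vx t0 x0) 0 ξ ≤ K := by
    unfold Lam; rw [add_zero, div_le_iff₀ Eξ]; exact hfr0 ξ haξ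
  have hb1 : |GI (fun y => wS v t0 x0 ξ y * psi c y)| ≤ C1 * Real.exp (-ξ / 2) * (√C' * √E) := by
    rw [hΦ0, ← Real.sqrt_mul hC'0.le]
    exact hM.trans (mul_le_mul_of_nonneg_left (Real.sqrt_le_sqrt hEE) (by positivity))
  have hb2 : √(Res (wS v t0 x0) (pS vx t0 x0) (qS vxx t0 x0) 0 ξ) ≤ δ / (4 * P * Q) * √E := by
    rw [← Real.sqrt_sq (by positivity : 0 ≤ δ / (4 * P * Q)), ← Real.sqrt_mul (by positivity)]
    exact Real.sqrt_le_sqrt hR.le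
  have hsm' := hsm ξ hAξ
  rw [show -(1 / 2 * ξ) = -ξ / 2 by ring] at hsm'
  have hall : ∀ σ : ℝ, σ ^ 2 = 1 → c = σ * |c| → ∀ u ∈ Icc (1:ℝ) 2,
      |GI (fun y => wS v t0 x0 ξ y * psi (σ * u) y)| ≤ δ * √E := by
    intro σ hσ hcσ u hu
    have := spread (K := K) ((R x0).eq' hsξ) ((R x0).dw ξ hsξ) ((R x0).dp ξ hsξ) ((R x0).bw ξ hsξ) ((R x0).bp ξ hsξ)
      hΛ0 hΛK hσ (u0 := |c|) ⟨hc1, hc2⟩ hu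
    rw [← hcσ] at this
    have hRes : (GI fun y => (qS vxx t0 x0 ξ y - y / 2 * pS vx t0 x0 ξ y
      + Lam (wS v t0 x0) (pS vx t0 x0) 0 ξ * wS v t0 x0 ξ y) ^ 2) = Res (wS v t0 x0) (pS vx t0 x0) (qS vxx t0 x0) 0 ξ := rfl
    rw [hRes, ← hP, ← hQ] at this
    refine this.trans ?_
    have i1 : √(Res (wS v t0 x0) (pS vx t0 x0) (qS vxx t0 x0) 0 ξ) * Q ≤ δ / (4 * P * Q) * √E * Q :=
      mul_le_mul_of_nonneg_right hb2 hQ0.le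
    have i2 : P * (2 * (δ / (4 * P * Q) * √E * Q)) = δ / 2 * √E := by field_simp; ring
    have i3 : P * (C1 * Real.exp (-ξ / 2) * (√C' * √E)) ≤ δ / 2 * √E := by
      have := mul_le_mul_of_nonneg_right hsm'.le hEs.le
      linarith
    have i4 := mul_le_mul_of_nonneg_left (add_le_add hb1 (mul_le_mul_of_nonneg_left i1 (by norm_num : (0:ℝ) ≤ 2))) hP0.le
    refine i4.trans ?_
    rw [mul_add, i2]
    linarith
  rcases lt_or_gt_of_ne (show c ≠ 0 by intro h; rw [h, abs_zero] at hc1; linarith) with h | h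
  · obtain ⟨c', hc', hW⟩ := Wm _ _ ((R x0).ew hsξ) ((R x0).ep hsξ) ((R x0).dw ξ hsξ) Eξ (hfr0 ξ haξ)
    have := hall (-1) (by norm_num) (by rw [abs_of_neg h]; ring) (-c') ⟨by linarith [hc'.2], by linarith [hc'.1]⟩
    rw [show -1 * -c' = c' by ring] at this
    have h3 : δ * √E ≤ dm * √E := mul_le_mul_of_nonneg_right (min_le_right _ _) hEs.le
    exact absurd (lt_of_lt_of_le hW (this.trans h3)) (lt_irrefl _)
  · obtain ⟨c', hc', hW⟩ := Wp _ _ ((R x0).ew hsξ) ((R x0).ep hsξ) ((R x0).dw ξ hsξ) Eξ (hfr0 ξ haξ)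
    have := hall 1 (by norm_num) (by rw [abs_of_pos h]; ring) c' hc'
    rw [show 1 * c' = c' by ring] at this
    have h3 : δ * √E ≤ dp * √E := mul_le_mul_of_nonneg_right (min_le_left _ _) hEs.le
    exact absurd (lt_of_lt_of_le hW (this.trans h3)) (lt_irrefl _)
end
end

section
open Filter Topology MeasureTheory
section
variable {T : ℝ} {a b v vx vxx vt : ℝ → ℝ → ℝ}

lemma slice_cont {g : ℝ → ℝ → ℝ} (h : ContinuousOn (fun p : ℝ × ℝ => g p.1 p.2) (Ioo 0 T ×ˢ (univ : Set ℝ)))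
    {t : ℝ} (ht : t ∈ Ioo 0 T) : Continuous (g t) := by
  refine continuous_iff_continuousAt.mpr fun x => ?_
  have h1 := cAt h ht x
  have h2 : ContinuousAt (fun x : ℝ => (t, x)) x := by fun_prop
  exact ContinuousAt.comp (f := fun x : ℝ => (t, x)) (g := fun p : ℝ × ℝ => g p.1 p.2) h1 h2

lemma fin_z (S : Sol T a b v vx vxx vt) (hnt : ∀ t ∈ Ioo 0 T, ∃ x, v t x ≠ 0) {t : ℝ} (ht : t ∈ Ioo 0 T) :
    zeroNumber (v t) ≠ ⊤ := by
  have hS := zeros_finite (isolated S ht hnt)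
  exact z_ne_top (S.vper t) _ fun k _ h => alt_bound (slice_cont S.vc ht) (S.vper t) hS h

lemma mono_z (S : Sol T a b v vx vxx vt) {t1 t2 : ℝ} (h1 : t1 ∈ Ioo 0 T) (h2 : t2 ∈ Ioo 0 T) (h : t1 ≤ t2) :
    zeroNumber (v t2) ≤ zeroNumber (v t1) := by
  rcases h.eq_or_lt with rfl | h
  · exact le_rfl
  · exact z_le (S.vper _) (S.vper _) fun k hk hA => scheme_mono S h1.1 h2.2 h hk hA

lemma sgn_trans {x y x' y' : ℝ} (h : x * y < 0) (hx : 0 < x * x') (hy : 0 < y * y') : x' * y' < 0 := by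
  by_contra hc
  push Not at hc
  have h1 := mul_pos hx hy
  have h2 := mul_nonneg (neg_pos.mpr h).le hc
  linarith

lemma jump (S : Sol T a b v vx vxx vt) (hnt : ∀ t ∈ Ioo 0 T, ∃ x, v t x ≠ 0) {t0 x0 : ℝ} (ht0 : t0 ∈ Ioo 0 T)
    (hv : v t0 x0 = 0) (hvx : vx t0 x0 = 0) {t1 : ℝ} (ht1 : t1 ∈ Ioo 0 T) (h1 : t1 < t0) :
    zeroNumber (v t0) < zeroNumber (v t1) := by
  obtain ⟨N, hN⟩ := ENat.ne_top_iff_exists.mp (fin_z S hnt ht0)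
  rcases Nat.eq_zero_or_pos N with h0 | hNp
  · obtain ⟨t, ht, htp, htt, p, q, r, hp, hpq, hqr, hr, s1, s2⟩ := drop S ht0 hnt hv hvx
      (ε := min (t0 - t1) (1 / 4)) (lt_min (by linarith) (by norm_num))
    have m1 := min_le_left (t0 - t1) (1 / 4); have m2 := min_le_right (t0 - t1) (1 / 4)
    have htm : t ∈ Ioo 0 T := ⟨htp, htt.trans ht0.2⟩
    have := z_ge (S.vper t) (by norm_num) (alt_two (S.vper t) hpq (by linarith) s1)
    refine lt_of_lt_of_le ?_ (this.trans (mono_z S ht1 htm (by linarith)))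
    rw [← hN, h0]; norm_num
  · obtain ⟨X, hX, hX1, hXφ⟩ := z_attained (S.vper t0) hNp hN.symm
    have hne : ∀ i, v t0 (X i) ≠ 0 := by
      intro i h0; have := hXφ i; rw [h0] at this; simp at this
    obtain ⟨j, hj, hj1⟩ := alt_gap hX hX1 x0
    have hj' : X j < x0 := lt_of_le_of_ne hj (by intro h; exact hne j (by rw [h, hv]))
    have hgp : Function.Periodic (fun i : ℤ => |v t0 (X i)|) (N : ℤ) := by
      intro i; simp only; rw [hX1, S.vper t0]
    obtain ⟨i0, hi0, hmin⟩ := Finset.exists_min_image (Finset.Ico (0:ℤ) N) (fun i => |v t0 (X i)|)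
      ⟨0, by simp [hNp]⟩
    have hm : ∀ i, |v t0 (X i0)| ≤ |v t0 (X i)| := by
      intro i
      obtain ⟨y, hy, hyi⟩ := hgp.exists_mem_Ico₀ (by exact_mod_cast hNp) i
      rw [hyi]
      exact hmin y (by simpa using hy)
    obtain ⟨δ, hδ, hu⟩ := periodic_unif ht1.1 ht0.2 S.vper S.vc (abs_pos.mpr (hne i0))
    obtain ⟨t, ht, htp, htt, p, q, r, hp, hpq, hqr, hr, s1, s2⟩ := drop S ht0 hnt hv hvx
      (ε := min (min (t0 - t1) δ) (min (x0 - X j) (X (j + 1) - x0)))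
      (lt_min (lt_min (by linarith) hδ) (lt_min (by linarith) (by linarith)))
    have m1 := (min_le_left (min (t0 - t1) δ) (min (x0 - X j) (X (j + 1) - x0))).trans (min_le_left _ _)
    have m2 := (min_le_left (min (t0 - t1) δ) (min (x0 - X j) (X (j + 1) - x0))).trans (min_le_right _ _)
    have m3 := (min_le_right (min (t0 - t1) δ) (min (x0 - X j) (X (j + 1) - x0))).trans (min_le_left _ _)
    have m4 := (min_le_right (min (t0 - t1) δ) (min (x0 - X j) (X (j + 1) - x0))).trans (min_le_right _ _)
    have htm : t ∈ Ioo 0 T := ⟨htp, htt.trans ht0.2⟩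
    have hsg : ∀ i, 0 < v t0 (X i) * v t (X i) := by
      intro i
      apply mul_pos_of_near
      refine lt_of_lt_of_le ?_ (hm i)
      exact hu t0 ⟨h1.le, le_rfl⟩ t ⟨by linarith, htt.le⟩ _ _
        (abs_lt.mpr ⟨by linarith, by linarith⟩) (by simpa using hδ)
    have hA := alt_insert (S.vper t) hNp hX hX1 (fun i => sgn_trans (hXφ i) (hsg i) (hsg (i + 1)))
      (j := j) (p := p) (q := q) (r := r) (by linarith) hpq hqr (by linarith) s1 s2
    have := z_ge (S.vper t) (by omega) hA
    refine lt_of_lt_of_le ?_ (this.trans (mono_z S ht1 htm (by linarith)))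
    rw [← hN]; exact_mod_cast (by omega : N < N + 2)

lemma stable (S : Sol T a b v vx vxx vt) {t0 : ℝ} (ht0 : t0 ∈ Ioo 0 T)
    (hm : ∀ x, v t0 x = 0 → vx t0 x ≠ 0) :
    ∃ ε > 0, ∀ t t', |t - t0| < ε → |t' - t0| < ε → t ∈ Ioo 0 T ∧ t' ∈ Ioo 0 T ∧
      ∀ k, Alt k (v t) → Alt k (v t') := by
  have cv := slice_cont S.vc ht0
  have cvx := slice_cont S.vxc ht0
  obtain ⟨z0, -, hz0⟩ := (isCompact_Icc (a := (0:ℝ)) (b := 1)).exists_isMinOn ⟨0, by simp⟩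
    (f := fun x => v t0 x ^ 2 + vx t0 x ^ 2) (by fun_prop)
  set m := v t0 z0 ^ 2 + vx t0 z0 ^ 2 with hmd
  have hmp : 0 < m := by
    by_cases h : v t0 z0 = 0
    · have := hm z0 h; positivity
    · positivity
  have hall : ∀ x, m ≤ v t0 x ^ 2 + vx t0 x ^ 2 := by
    intro x
    have hper : Function.Periodic (fun x => v t0 x ^ 2 + vx t0 x ^ 2) 1 := by
      intro x; simp only; rw [S.vper t0, S.vxper t0]
    obtain ⟨y, hy, hyx⟩ := hper.exists_mem_Ico₀ one_pos x
    rw [hyx]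
    exact hz0 ⟨hy.1, hy.2.le⟩
  set c := √(m / 2) with hc
  have hcp : 0 < c := Real.sqrt_pos.mpr (by positivity)
  have hc2 : c ^ 2 = m / 2 := Real.sq_sqrt (by positivity)
  have hdich : ∀ x, |v t0 x| < c → c ≤ |vx t0 x| := by
    intro x hx
    by_contra hcon
    push Not at hcon
    have i1 := sq_lt_sq' (by linarith [abs_nonneg (v t0 x)]) hx
    have i2 := sq_lt_sq' (by linarith [abs_nonneg (vx t0 x)]) hcon
    rw [sq_abs] at i1 i2
    linarith [hall x]
  have hl : 0 < t0 / 2 := by linarith [ht0.1]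
  have hr : (t0 + T) / 2 < T := by linarith [ht0.2]
  obtain ⟨δ1, hδ1, hu1⟩ := periodic_unif hl hr S.vxper S.vxc (show 0 < c / 4 by positivity)
  set δ := δ1 / 2 with hδ
  have hδp : 0 < δ := by positivity
  set c' := min c (c * δ / 4) with hc'
  have hc'p : 0 < c' := lt_min hcp (by positivity)
  have hc'1 : c' ≤ c := min_le_left _ _
  have hc'2 : c' ≤ c * δ / 4 := min_le_right _ _
  obtain ⟨δ2, hδ2, hu2⟩ := periodic_unif hl hr S.vper S.vc (show 0 < c' / 2 by positivity)
  refine ⟨min (min δ1 δ2) (min (t0 / 2) ((T - t0) / 2)), lt_min (lt_min hδ1 hδ2) (lt_min hl (by linarith [ht0.2])), ?_⟩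
  set ε := min (min δ1 δ2) (min (t0 / 2) ((T - t0) / 2)) with hε
  have m1 : ε ≤ δ1 := (min_le_left _ _).trans (min_le_left _ _)
  have m2 : ε ≤ δ2 := (min_le_left _ _).trans (min_le_right _ _)
  have m3 : ε ≤ t0 / 2 := (min_le_right _ _).trans (min_le_left _ _)
  have m4 : ε ≤ (T - t0) / 2 := (min_le_right _ _).trans (min_le_right _ _)
  have hIcc : ∀ t, |t - t0| < ε → t ∈ Icc (t0 / 2) ((t0 + T) / 2) := by
    intro t ht
    have := abs_lt.mp ht
    constructor <;> linarith
  have hIoo : ∀ t, |t - t0| < ε → t ∈ Ioo 0 T := fun t ht =>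
    ⟨hl.trans_le (hIcc t ht).1, (hIcc t ht).2.trans_lt hr⟩
  have hI0 : t0 ∈ Icc (t0 / 2) ((t0 + T) / 2) := ⟨by linarith [ht0.1], by linarith [ht0.2]⟩
  have hnear : ∀ t, |t - t0| < ε → ∀ x, |v t0 x - v t x| < c' / 2 := fun t ht x =>
    hu2 t0 hI0 t (hIcc t ht) x x (by rw [abs_sub_comm]; linarith) (by simpa using hδ2)
  intro t t' ht ht'
  refine ⟨hIoo t ht, hIoo t' ht', fun k hA => alt_move (S.vper t) (S.vper t') hδp (fun x => ?_) hA⟩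
  rcases le_or_gt c' |v t0 x| with h | h
  · left
    have p1 : 0 < v t0 x * v t x := mul_pos_of_near (by linarith [hnear t ht x])
    have p2 : 0 < v t0 x * v t' x := mul_pos_of_near (by linarith [hnear t' ht' x])
    have h3 := mul_pos p1 p2
    by_contra hcon
    push Not at hcon
    have := mul_nonneg (sq_nonneg (v t0 x)) (neg_nonneg.mpr hcon)
    linarith
  · right
    have hV := hdich x (h.trans_le hc'1)
    obtain ⟨e, he, he1⟩ : ∃ e : ℝ, e * vx t0 x = |vx t0 x| ∧ |e| = 1 := by
      rcases abs_cases (vx t0 x) with ⟨h, _⟩ | ⟨h, _⟩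
      · exact ⟨1, by rw [h, one_mul], by norm_num⟩
      · exact ⟨-1, by rw [h]; ring, by norm_num⟩
    have key : ∀ τ, |τ - t0| < ε → ∀ y z, x - δ ≤ y → y ≤ z → z ≤ x + δ →
        (z - y) * (3 * c / 4) ≤ e * v τ z - e * v τ y := by
      intro τ hτ y z h1 h2 h3
      have ht1 := taylor1 (f := v τ) (f' := vx τ) (x := y) (y := z) (c := vx t0 x) (ω := c / 4)
        (fun u _ => S.hx τ (hIoo τ hτ) u)
        (fun u hu => by
          rw [uIcc_of_le h2] at hu
          exact (hu1 τ (hIcc τ hτ) t0 hI0 u x (by linarith)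
            (abs_lt.mpr ⟨by linarith [hu.1], by linarith [hu.2]⟩)).le)
      rw [abs_of_nonneg (sub_nonneg.mpr h2)] at ht1
      have ht2 : |e * (v τ z - v τ y - (z - y) * vx t0 x)| ≤ c / 4 * (z - y) := by
        rw [abs_mul, he1, one_mul]; exact ht1
      have ht3 := (abs_le.mp ht2).1
      have ht4 : (z - y) * c ≤ (z - y) * (e * vx t0 x) := by
        rw [he]; exact mul_le_mul_of_nonneg_left hV (by linarith)
      linarith
    have hsmall : |e * v t' x| < 3 * c * δ / 8 := by
      rw [abs_mul, he1, one_mul]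
      have h1 := hnear t' ht' x
      have h2 := abs_sub_abs_le_abs_sub (v t' x) (v t0 x)
      rw [abs_sub_comm] at h2
      linarith
    have hs := abs_lt.mp hsmall
    refine ⟨e, fun y z h1 h2 h3 => ?_, ?_, ?_⟩
    · have := key t ht y z h1 h2 h3
      have h5 : 0 ≤ (z - y) * (3 * c / 4) := mul_nonneg (by linarith) (by positivity)
      linarith
    · have := key t' ht' x (x + δ / 2) (by linarith) (by linarith) (by linarith)
      linarith [hs.1]
    · have := key t' ht' (x - δ / 2) x (by linarith) (by linarith) (by linarith)
      linarith [hs.2]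
end
end

/-- **Sturm zero-number (lap number) property on the circle.**
Let `T > 0`, let `a : S¹ × [0,T] → ℝ` be `C¹` and `b : S¹ × [0,T] → ℝ` be continuous,
and let `v : S¹ × (0,T) → ℝ` be a bounded classical solution, not identically zero, of
`v_t = v_xx + a(x,t) v_x + b(x,t) v`.  Then for every `t ∈ (0,T)` the zero number
`z(v(·,t))` is finite, `t ↦ z(v(·,t))` is nonincreasing on `(0,T)`, and it strictly
decreases at `t = t₀` (i.e. `z(v(·,t₁)) > z(v(·,t₂))` for all `t₁ < t₀ < t₂` in `(0,T)`)
if and only if `x ↦ v(x,t₀)` has a multiple zero.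
Here functions on `S¹` are identified with `1`-periodic functions on `ℝ`, and we write
`v t x` for `v(x,t)`. -/
theorem sturm_lap_number_circle
    (T : ℝ) (hT : 0 < T)
    (a b v : ℝ → ℝ → ℝ)
    -- space-periodicity: the data live on the circle S¹ = ℝ/ℤ
    (ha_per : ∀ t, Function.Periodic (a t) 1)
    (hb_per : ∀ t, Function.Periodic (b t) 1)
    (hv_per : ∀ t, Function.Periodic (v t) 1)
    -- regularity of the coefficients: a ∈ C¹(S¹×[0,T]), b ∈ C⁰(S¹×[0,T])
    (ha_reg : ContDiffOn ℝ 1 (fun p : ℝ × ℝ => a p.1 p.2) (Icc 0 T ×ˢ (univ : Set ℝ)))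
    (hb_reg : ContinuousOn (fun p : ℝ × ℝ => b p.1 p.2) (Icc 0 T ×ˢ (univ : Set ℝ)))
    -- v is a classical solution on S¹ × (0,T): continuity of v and of its derivatives
    (hv_cont : ContinuousOn (fun p : ℝ × ℝ => v p.1 p.2) (Ioo 0 T ×ˢ (univ : Set ℝ)))
    (hv_t : ∀ t ∈ Ioo 0 T, ∀ x : ℝ, DifferentiableAt ℝ (fun s => v s x) t)
    (hv_x : ∀ t ∈ Ioo 0 T, Differentiable ℝ (v t))
    (hv_xx : ∀ t ∈ Ioo 0 T, Differentiable ℝ (deriv (v t)))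
    (hv_t_cont : ContinuousOn (fun p : ℝ × ℝ => deriv (fun s => v s p.2) p.1)
      (Ioo 0 T ×ˢ (univ : Set ℝ)))
    (hv_x_cont : ContinuousOn (fun p : ℝ × ℝ => deriv (v p.1) p.2)
      (Ioo 0 T ×ˢ (univ : Set ℝ)))
    (hv_xx_cont : ContinuousOn (fun p : ℝ × ℝ => deriv (deriv (v p.1)) p.2)
      (Ioo 0 T ×ˢ (univ : Set ℝ)))
    -- the linear parabolic equation v_t = v_xx + a v_x + b v on S¹ × (0,T)
    (heq : ∀ t ∈ Ioo 0 T, ∀ x : ℝ,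
      deriv (fun s => v s x) t
        = deriv (deriv (v t)) x + a t x * deriv (v t) x + b t x * v t x)
    -- boundedness of v
    (hbdd : ∃ C, ∀ t ∈ Ioo 0 T, ∀ x : ℝ, |v t x| ≤ C)
    -- v is a non-trivial solution
    (hnt : ∃ t ∈ Ioo 0 T, ∃ x : ℝ, v t x ≠ 0) :
    (∀ t ∈ Ioo 0 T, zeroNumber (v t) ≠ ⊤)
    ∧ (∀ t₁ ∈ Ioo 0 T, ∀ t₂ ∈ Ioo 0 T, t₁ ≤ t₂ → zeroNumber (v t₂) ≤ zeroNumber (v t₁))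
    ∧ (∀ t₀ ∈ Ioo 0 T,
        ((∀ t₁ ∈ Ioo 0 T, ∀ t₂ ∈ Ioo 0 T, t₁ < t₀ → t₀ < t₂ →
            zeroNumber (v t₂) < zeroNumber (v t₁))
          ↔ HasMultipleZero (v t₀))) := by
  have hsub : Ioo 0 T ×ˢ (univ : Set ℝ) ⊆ Icc 0 T ×ˢ (univ : Set ℝ) :=
    Set.prod_mono Ioo_subset_Icc_self subset_rfl
  have hdper : ∀ {f : ℝ → ℝ}, Function.Periodic f 1 → Function.Periodic (deriv f) 1 := by
    intro f hf x
    rw [← deriv_comp_add_const]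
    congr 1
    ext y; exact hf y
  have S : Sol T a b v (fun t => deriv (v t)) (fun t => deriv (deriv (v t)))
      (fun t x => deriv (fun s => v s x) t) :=
    { aper := ha_per
      bper := hb_per
      vper := hv_per
      vxper := fun t => hdper (hv_per t)
      vxxper := fun t => hdper (hdper (hv_per t))
      vtper := fun t x => by
        have : (fun s => v s (x + 1)) = fun s => v s x := funext fun s => hv_per s x
        simp only [this]
      ac := ha_reg.continuousOn.mono hsub
      bc := hb_reg.mono hsub
      vc := hv_cont
      vxc := hv_x_cont
      vxxc := hv_xx_cont
      vtc := hv_t_cont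
      hx := fun t ht x => (hv_x t ht x).hasDerivAt
      hxx := fun t ht x => (hv_xx t ht x).hasDerivAt
      ht := fun t ht x => (hv_t t ht x).hasDerivAt
      eq := heq }
  have hnt' : ∀ t ∈ Ioo 0 T, ∃ x, v t x ≠ 0 := by
    obtain ⟨t, ht, x, hx⟩ := hnt
    exact fun t' ht' => nonvanish S ht hx ht'
  refine ⟨fun t ht => fin_z S hnt' ht, fun t₁ h1 t₂ h2 h => mono_z S h1 h2 h, fun t₀ ht₀ => ⟨fun H => ?_, ?_⟩⟩
  · by_contra hcon
    unfold HasMultipleZero at hcon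
    push Not at hcon
    obtain ⟨ε, hε, hst⟩ := stable S ht₀ hcon
    obtain ⟨i1, i2, i3⟩ := hst (t₀ - ε / 2) (t₀ + ε / 2)
      (by rw [sub_sub_cancel_left, abs_neg, abs_of_pos (by linarith)]; linarith)
      (by rw [add_sub_cancel_left, abs_of_pos (by linarith)]; linarith)
    have := H _ i1 _ i2 (by linarith) (by linarith)
    exact absurd this (not_lt.mpr (z_le (hv_per _) (hv_per _) fun k _ => i3 k))
  · rintro ⟨x0, hx0, hdx0⟩ t₁ h1 t₂ h2 h10 h02
    exact lt_of_le_of_lt (mono_z S ht₀ h2 h02.le) (jump S hnt' ht₀ hx0 hdx0 h1 h10)
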